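/- arXiv:2211.15970 — 6 statements merged into one kernel-verified Lean document; each statement's English description precedes it below -/
import Mathlib

section
/- For every n ≥ 1 and all r, ε > 0 there exists c₀ > 0 such that for every c with 0 < c < c₀ there exist a smooth function H : ℂⁿ ∖ {0} → ℝ, constants a, b ∈ ℝ, and δ > 0 such that: (1) H is strictly plurisubharmonic on ℂⁿ ∖ {0}; (2) H(z) = ‖z‖² + a for all z with ‖z‖ > r + ε − δ; (3) H(z) = c‖z‖² + r²·log(‖z‖²) + b for all z with 0 < ‖z‖ < r + δ. (This is the potential-level formulation of the paper's Proposition: for all sufficiently small c > 0 there is a Kähler form ϱᶜ on ℂⁿ ∖ {0}, namely ϱᶜ = (√−1/2)∂∂̄H, which equals the standard symplectic form ω₀ on a neighborhood of the complement of the open ball of radius r + ε, and equals the model symplectic blow-up form with potential c‖z‖² + r² log‖z‖² on a neighborhood of the punctured closed ball of radius r.) -/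
noncomputable section

/-- A (globally defined) function `H` has positive Levi form on a set `U ⊆ ℂⁿ` if at each
point `z ∈ U` and each direction `w ≠ 0` one has
`D²H(z)(w,w) + D²H(z)(iw,iw) > 0`, where `D²H(z)` is the second real Fréchet derivative.
Together with smoothness this says `H` is strictly plurisubharmonic on `U`, i.e.
`(√−1/2)∂∂̄H` is a Kähler form on `U`. -/
def LeviPositiveOn (n : ℕ) (H : EuclideanSpace ℂ (Fin n) → ℝ)
    (U : Set (EuclideanSpace ℂ (Fin n))) : Prop :=
  ∀ z ∈ U, ∀ w : EuclideanSpace ℂ (Fin n), w ≠ 0 →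
    0 < iteratedFDeriv ℝ 2 H z ![w, w]
        + iteratedFDeriv ℝ 2 H z ![Complex.I • w, Complex.I • w]

theorem levi {E : Type*} [NormedAddCommGroup E] [InnerProductSpace ℂ E]
   (h g : ℝ → ℝ) (hg : ∀ t, 0 < t → HasDerivAt h (g t) t) 
   (z : E) (hz : z ≠ 0) (g' : ℝ) (hg' : HasDerivAt g g' (‖z‖^2)) (h1 : 0 < g (‖z‖^2))
   (h2 : 0 < g (‖z‖^2) + ‖z‖^2 * g') (w : E) (hw : w ≠ 0) :
    0 < iteratedFDeriv ℝ 2 (fun z : E => h (‖z‖^2)) z ![w, w]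
        + iteratedFDeriv ℝ 2 (fun z : E => h (‖z‖^2)) z ![Complex.I • w, Complex.I • w] := by
  let : InnerProductSpace ℝ E := InnerProductSpace.complexToReal
  have e1 : ∀ y : E, y ≠ 0 → HasFDerivAt (fun z : E => h (‖z‖^2)) 
      (g (‖y‖^2) • (2 • innerSL ℝ y)) y := by
    intro y hy
    exact (hg _ (by positivity)).comp_hasFDerivAt y (hasStrictFDerivAt_norm_sq y).hasFDerivAt
  have e2 : fderiv ℝ (fun z : E => h (‖z‖^2)) =ᶠ[nhds z] fun y => g (‖y‖^2) • (2 • innerSL ℝ y) := by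
    filter_upwards [isOpen_ne.mem_nhds hz] with y hy using (e1 y hy).fderiv
  have e3 : HasFDerivAt (fun y : E => g (‖y‖^2)) (g' • (2 • innerSL ℝ z)) z :=
    hg'.comp_hasFDerivAt z (hasStrictFDerivAt_norm_sq z).hasFDerivAt
  have e4 : HasFDerivAt (fun y : E => 2 • innerSL ℝ y) (2 • innerSL ℝ : E →L[ℝ] E →L[ℝ] ℝ) z := 
    (2 • innerSL ℝ : E →L[ℝ] E →L[ℝ] ℝ).hasFDerivAt
  have e5 : HasFDerivAt (fun y : E => g (‖y‖^2) • (2 • innerSL ℝ y)) _ z := e3.smul e4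
  have key : ∀ v : E, iteratedFDeriv ℝ 2 (fun z : E => h (‖z‖^2)) z ![v, v] = 
      2 * g (‖z‖^2) * ‖v‖^2 + 4 * g' * (inner ℝ z v)^2 := by
    intro v
    rw [iteratedFDeriv_two_apply, e2.fderiv_eq, e5.fderiv]
    have hv : (innerSL ℝ v) v = ‖v‖ ^ 2 := real_inner_self_eq_norm_sq v
    simp [innerSL_apply_apply]
    erw [hv]
    ring
  rw [key, key]
  have hI : ‖Complex.I • w‖ = ‖w‖ := by simp [norm_smul]
  have hX : (inner ℝ z w)^2 + (inner ℝ z (Complex.I • w))^2 = ‖inner ℂ z w‖^2 := by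
    rw [real_inner_eq_re_inner ℂ, real_inner_eq_re_inner ℂ, inner_smul_right, ← Complex.normSq_eq_norm_sq, Complex.normSq_apply]
    simp
    ring
  have hC : ‖inner ℂ z w‖^2 ≤ ‖z‖^2 * ‖w‖^2 := by
    rw [← mul_pow]; gcongr; exact norm_inner_le_norm z w
  have hW : 0 < ‖w‖^2 := by positivity
  rw [hI]
  have : 0 < g (‖z‖^2) * ‖w‖^2 + g' * ‖inner ℂ z w‖^2 := by
    rcases le_or_gt 0 g' with h | h
    · positivity
    · nlinarith [mul_pos h2 hW, mul_le_mul_of_nonpos_left hC h.le]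
  rw [← hX] at this
  linarith

theorem aux_cutoff (r t1 t2 c : ℝ) (h0 : 0 < t1) (h12 : t1 < t2)
    (hc : c < 1 - r ^ 2 / t1) :
    ∃ q : ℝ → ℝ, ContDiff ℝ (⊤ : ℕ∞) q ∧ Monotone q ∧ (∀ t, 0 ≤ q t) ∧
      (∀ t ≤ t1, q t = 0) ∧ (∀ t ≥ t2, q t = 1 - c - r ^ 2 / t) := by
  have hd : 0 < t2 - t1 := sub_pos.2 h12
  let χ : ℝ → ℝ := fun t => Real.smoothTransition ((t - t1) / (t2 - t1))
  have hχm : Monotone χ := fun x y hxy => Real.smoothTransition.monotone (by gcongr)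
  have hχ0 : ∀ t ≤ t1, χ t = 0 := fun t ht => Real.smoothTransition.zero_of_nonpos
    (div_nonpos_of_nonpos_of_nonneg (by linarith) hd.le)
  have hχn : ∀ t, 0 ≤ χ t := fun t => Real.smoothTransition.nonneg _
  have hmono : ∀ x y, t1 ≤ x → x ≤ y → 1 - c - r ^ 2 / x ≤ 1 - c - r ^ 2 / y := by
    intro x y hx hxy
    have : 0 < x := by linarith
    gcongr
  have hpos : ∀ x, t1 ≤ x → 0 ≤ 1 - c - r ^ 2 / x := fun x hx => by
    have := hmono t1 x le_rfl hx
    linarith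
  have hq0 : ∀ t ≤ t1, χ t * (1 - c - r ^ 2 / t) = 0 := fun t ht => by rw [hχ0 t ht, zero_mul]
  have hqn : ∀ t, 0 ≤ χ t * (1 - c - r ^ 2 / t) := fun t => by
    rcases le_total t t1 with h | h
    · rw [hq0 t h]
    · exact mul_nonneg (hχn t) (hpos t h)
  refine ⟨fun t => χ t * (1 - c - r ^ 2 / t), ?_, ?_, hqn, hq0, ?_⟩
  · rw [contDiff_iff_contDiffAt]
    intro t
    rcases lt_or_ge t t1 with h | h
    · have : (fun t => χ t * (1 - c - r ^ 2 / t)) =ᶠ[nhds t] fun _ => (0 : ℝ) := by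
        filter_upwards [Iio_mem_nhds h] with s hs using hq0 s (le_of_lt hs)
      exact contDiffAt_const.congr_of_eventuallyEq this
    · have ht : t ≠ 0 := by linarith [h0.trans_le h]
      have hχc : ContDiff ℝ (⊤ : ℕ∞) χ := Real.smoothTransition.contDiff.comp
        ((contDiff_id.sub contDiff_const).div_const _)
      exact hχc.contDiffAt.mul (contDiffAt_const.sub (contDiffAt_const.div contDiffAt_id ht))
  · intro x y hxy
    rcases le_total x t1 with h | h
    · simp only [hq0 x h, hqn y]
    · exact mul_le_mul (hχm hxy) (hmono x y h hxy) (hpos x h) (hχn y)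
  · intro t ht
    have : χ t = 1 := Real.smoothTransition.one_of_one_le (by rw [le_div_iff₀ hd]; linarith)
    simp only [this, one_mul]

theorem aux_radial (r t1 t2 c : ℝ) (h0 : 0 < t1) (h12 : t1 < t2) (hc0 : 0 < c)
    (hc : c < 1 - r ^ 2 / t1) :
    ∃ (h g g' : ℝ → ℝ) (a : ℝ), (∀ t, 0 < t → ContDiffAt ℝ (⊤ : ℕ∞) h t) ∧
      (∀ t, 0 < t → HasDerivAt h (g t) t) ∧ (∀ t, 0 < t → HasDerivAt g (g' t) t) ∧
      (∀ t, 0 < t → 0 < g t) ∧ (∀ t, 0 < t → 0 < g t + t * g' t) ∧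
      (∀ t ≥ t2, h t = t + a) ∧
      (∀ t ≤ t1, h t = c * t + r ^ 2 * Real.log t) := by
  obtain ⟨q, hqs, hqm, hqn, hq0, hq1⟩ := aux_cutoff r t1 t2 c h0 h12 hc
  let Q : ℝ → ℝ := fun t => ∫ s in t1..t, q s
  have hQd : ∀ t, HasDerivAt Q (q t) t := fun t =>
    hqs.continuous.integral_hasStrictDerivAt t1 t |>.hasDerivAt
  have hQs : ContDiff ℝ (⊤ : ℕ∞) Q := by
    rw [contDiff_infty_iff_deriv]
    refine ⟨fun t => (hQd t).differentiableAt, ?_⟩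
    rw [show deriv Q = q from funext fun t => (hQd t).deriv]
    exact hqs
  have hQ0 : ∀ t ≤ t1, Q t = 0 := by
    intro t ht
    have : Set.EqOn q (fun _ => (0 : ℝ)) (Set.uIcc t1 t) := by
      intro s hs
      rw [Set.uIcc_of_ge ht] at hs
      exact hq0 s hs.2
    change ∫ s in t1..t, q s = 0
    rw [intervalIntegral.integral_congr this]
    simp
  have hhd : ∀ t, 0 < t → HasDerivAt (fun t => c * t + r ^ 2 * Real.log t + Q t)
      (c + r ^ 2 * t⁻¹ + q t) t := by
    intro t ht
    have := (((hasDerivAt_id t).const_mul c).add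
      ((Real.hasDerivAt_log ht.ne').const_mul (r ^ 2))).add (hQd t)
    rw [mul_one] at this
    exact this
  have hqd : ∀ t, HasDerivAt q (deriv q t) t := fun t =>
    (hqs.differentiable (by simp) t).hasDerivAt
  refine ⟨fun t => c * t + r ^ 2 * Real.log t + Q t, fun t => c + r ^ 2 * t⁻¹ + q t,
    fun t => r ^ 2 * (-(t ^ 2)⁻¹) + deriv q t,
    c * t2 + r ^ 2 * Real.log t2 + Q t2 - t2, ?_, hhd, ?_, ?_, ?_, ?_, ?_⟩
  · intro t ht
    exact ((contDiffAt_const.mul contDiffAt_id).add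
      (contDiffAt_const.mul (Real.contDiffAt_log.2 ht.ne'))).add hQs.contDiffAt
  · intro t ht
    exact (((hasDerivAt_inv ht.ne').const_mul (r ^ 2)).const_add c).add (hqd t)
  · intro t ht
    have := hqn t
    positivity
  · intro t ht
    have h1 := hqn t
    have h2 : 0 ≤ deriv q t := hqm.deriv_nonneg
    have : c + r ^ 2 * t⁻¹ + q t + t * (r ^ 2 * (-(t ^ 2)⁻¹) + deriv q t)
      = c + q t + t * deriv q t := by field_simp; ring
    simp only [this]
    positivity
  · intro t ht
    have hD : ∀ x ∈ Set.Ico t2 t, HasDerivWithinAt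
        (fun t => c * t + r ^ 2 * Real.log t + Q t - t) 0 (Set.Ici x) x := by
      intro x hx
      have hx0 : 0 < x := by linarith [hx.1]
      have := (hhd x hx0).sub (hasDerivAt_id x)
      rw [hq1 x hx.1] at this
      have e : c + r ^ 2 * x⁻¹ + (1 - c - r ^ 2 / x) - 1 = 0 := by
        rw [div_eq_mul_inv]; ring
      rw [e] at this
      exact this.hasDerivWithinAt
    have hC : ContinuousOn (fun t => c * t + r ^ 2 * Real.log t + Q t - t) (Set.Icc t2 t) := by
      intro x hx
      have hx0 : 0 < x := by linarith [hx.1]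
      exact ((hhd x hx0).sub (hasDerivAt_id x)).continuousAt.continuousWithinAt
    have := constant_of_has_deriv_right_zero hC hD t (Set.right_mem_Icc.2 ht)
    simp only at this ⊢
    linarith
  · intro t ht
    simp only [hQ0 t ht, add_zero]

/-- Potential-level formulation of the symplectic blow-up gluing: for all `r, ε > 0` and all
sufficiently small `c > 0` there is a strictly plurisubharmonic function `H` on `ℂⁿ ∖ {0}`
equal (up to an additive constant) to the standard potential `‖z‖²` for `‖z‖ > r + ε − δ`,
and to the model blow-up potential `c‖z‖² + r² log ‖z‖²` for `0 < ‖z‖ < r + δ`. -/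
theorem stmt0 (n : ℕ) (hn : 1 ≤ n) (r ε : ℝ) (hr : 0 < r) (hε : 0 < ε) :
    ∃ c₀ > 0, ∀ c : ℝ, 0 < c → c < c₀ →
      ∃ (H : EuclideanSpace ℂ (Fin n) → ℝ) (a b δ : ℝ), 0 < δ ∧
        ContDiffOn ℝ (⊤ : ℕ∞) H {z | z ≠ 0} ∧
        LeviPositiveOn n H {z | z ≠ 0} ∧
        (∀ z : EuclideanSpace ℂ (Fin n), r + ε - δ < ‖z‖ → H z = ‖z‖ ^ 2 + a) ∧
        (∀ z : EuclideanSpace ℂ (Fin n), 0 < ‖z‖ → ‖z‖ < r + δ →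
          H z = c * ‖z‖ ^ 2 + r ^ 2 * Real.log (‖z‖ ^ 2) + b) := by
  have hl : r ^ 2 < (r + ε / 3) ^ 2 := by gcongr; linarith
  have h0 : 0 < (r + ε / 3) ^ 2 := by positivity
  have h12 : (r + ε / 3) ^ 2 < (r + 2 * ε / 3) ^ 2 := by gcongr; linarith
  refine ⟨1 - r ^ 2 / (r + ε / 3) ^ 2, ?_, ?_⟩
  · rw [gt_iff_lt, sub_pos, div_lt_one h0]
    exact hl
  intro c hc0 hc
  obtain ⟨h, g, g', a, hs, hd, hd', hp, hp', hout, hin⟩ :=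
    aux_radial r _ _ c h0 h12 hc0 hc
  refine ⟨fun z => h (‖z‖ ^ 2), a, 0, ε / 3, by positivity, ?_, ?_, ?_, ?_⟩
  · intro z hz
    have hz' : z ≠ 0 := hz
    have h1 : ContDiffAt ℝ (⊤ : ℕ∞) (fun z : EuclideanSpace ℂ (Fin n) => ‖z‖ ^ 2) z :=
      (contDiff_norm_sq ℂ).contDiffAt
    exact ((hs (‖z‖ ^ 2) (by positivity)).comp z h1).contDiffWithinAt
  · intro z hz w hw
    have hz' : z ≠ 0 := hz
    have hz2 : 0 < ‖z‖ ^ 2 := by positivity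
    exact levi h g hd z hz' (g' (‖z‖ ^ 2)) (hd' _ hz2) (hp _ hz2) (hp' _ hz2) w hw
  · intro z hz
    apply hout
    have : r + 2 * ε / 3 ≤ ‖z‖ := by linarith
    gcongr
  · intro z hz hz'
    rw [add_zero]
    apply hin
    gcongr

end
end

section
/- For every n ≥ 1, all r, ε > 0 and every c > 0 there exist a smooth function H : ℂⁿ → ℝ, constants a, b ∈ ℝ, and δ > 0 such that: (1) H is strictly plurisubharmonic on all of ℂⁿ; (2) H(z) = ‖z‖² + a for all z with ‖z‖ < r + δ; (3) H(z) = c²‖z‖² + r²·log(‖z‖²/r²) + b for all z with ‖z‖ > r + ε − δ. (This is the potential-level formulation of the paper's Proposition used in the symplectic blow-down construction: for every c > 0 there is a Kähler form ϱ_c = (√−1/2)∂∂̄H on ℂⁿ equal to the standard form ω₀ on a neighborhood of the closed ball of radius r and equal to the model blow-up form with potential c²‖z‖² + r² log(‖z‖²/r²) on a neighborhood of the complement of the open ball of radius r + ε.) -/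
noncomputable section

theorem aux_second {E : Type*} [NormedAddCommGroup E] [InnerProductSpace ℝ E]
    (f p q : ℝ → ℝ) (hf : ∀ t, HasDerivAt f (p t) t) (hp : ∀ t, HasDerivAt p (q t) t) (z w : E) :
    iteratedFDeriv ℝ 2 (fun z : E => f (‖z‖ ^ 2)) z ![w, w]
      = 4 * q (‖z‖ ^ 2) * (inner ℝ z w) ^ 2 + 2 * p (‖z‖ ^ 2) * ‖w‖ ^ 2 := by
  have h1 : ∀ y : E, HasFDerivAt (fun z : E => f (‖z‖ ^ 2))
      (p (‖y‖ ^ 2) • (2 • innerSL ℝ y)) y := fun y =>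
    (hf (‖y‖ ^ 2)).comp_hasFDerivAt y (hasStrictFDerivAt_norm_sq y).hasFDerivAt
  have h2 : fderiv ℝ (fun z : E => f (‖z‖ ^ 2)) =
      fun y => p (‖y‖ ^ 2) • (2 • innerSL ℝ y) := funext fun y => (h1 y).fderiv
  have h3 : HasFDerivAt (fun y : E => p (‖y‖ ^ 2)) (q (‖z‖ ^ 2) • (2 • innerSL ℝ z)) z :=
    (hp (‖z‖ ^ 2)).comp_hasFDerivAt z (hasStrictFDerivAt_norm_sq z).hasFDerivAt
  have h4 : HasFDerivAt (fun y : E => (2 : ℕ) • innerSL ℝ y) ((2 : ℕ) • innerSL ℝ) z :=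
    ((2 : ℕ) • (innerSL ℝ : E →L[ℝ] E →L[ℝ] ℝ)).hasFDerivAt
  have h5 : HasFDerivAt (fun y : E => p (‖y‖ ^ 2) • ((2 : ℕ) • innerSL ℝ y)) _ z := h3.smul h4
  rw [iteratedFDeriv_two_apply, h2, h5.fderiv]
  have h6 : innerSL ℝ w w = ‖w‖ ^ 2 := real_inner_self_eq_norm_sq w
  simp
  rw [h6]
  ring

theorem aux_profile (r η c : ℝ) (hr : 0 < r) (hη : 0 < η) (hc : 0 < c)
    (hη2 : 2 * η ≤ c ^ 2 * r ^ 2) :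
    ∃ f p q : ℝ → ℝ, ∃ b : ℝ, ContDiff ℝ (⊤ : ℕ∞) f ∧ (∀ t, HasDerivAt f (p t) t) ∧
      (∀ t, HasDerivAt p (q t) t) ∧ (∀ t, 0 ≤ t → 0 < p t) ∧ (∀ t, 0 ≤ t → 0 < p t + t * q t) ∧
      (∀ t, 0 ≤ t → t ≤ r ^ 2 + η → f t = t) ∧
      (∀ t, r ^ 2 + 2 * η ≤ t → f t = c ^ 2 * t + r ^ 2 * Real.log (t / r ^ 2) + b) := by
  have hr2 : 0 < r ^ 2 := by positivity
  have hc2 : 0 < c ^ 2 := by positivity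
  obtain ⟨χ, hχ⟩ : ∃ χ : ℝ → ℝ, χ = fun t => Real.smoothTransition ((t - r ^ 2 - η) / η) :=
    ⟨_, rfl⟩
  have χs : ContDiff ℝ (⊤ : ℕ∞) χ := by
    rw [hχ]
    exact Real.smoothTransition.contDiff.comp (by fun_prop)
  have χ0 : ∀ t, t ≤ r ^ 2 + η → χ t = 0 := fun t ht => by
    rw [hχ]
    exact Real.smoothTransition.zero_of_nonpos (div_nonpos_of_nonpos_of_nonneg (by linarith) hη.le)
  have χ1 : ∀ t, r ^ 2 + 2 * η ≤ t → χ t = 1 := fun t ht => by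
    rw [hχ]
    refine Real.smoothTransition.one_of_one_le ?_
    rw [le_div_iff₀ hη]; linarith
  have χn : ∀ t, 0 ≤ χ t := fun t => by rw [hχ]; exact Real.smoothTransition.nonneg _
  have χl : ∀ t, χ t ≤ 1 := fun t => by rw [hχ]; exact Real.smoothTransition.le_one _
  have χm : Monotone χ := by
    rw [hχ]
    intro s t hst
    refine Real.smoothTransition.monotone ?_
    gcongr
  have χd : ∀ t, HasDerivAt χ (deriv χ t) t := fun t =>
    ((χs.differentiable (by simp)) t).hasDerivAt
  have χd0 : ∀ t, 0 ≤ deriv χ t := fun t => χm.deriv_nonneg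
  have χd1 : ∀ t, r ^ 2 + 2 * η < t → deriv χ t = 0 := fun t ht => by
    have : χ =ᶠ[nhds t] fun _ => 1 := by
      filter_upwards [lt_mem_nhds ht] with s hs using χ1 s hs.le
    rw [this.deriv_eq]; simp
  obtain ⟨p, hp⟩ : ∃ p : ℝ → ℝ, p = fun t => 1 + χ t * (c ^ 2 - 1 + r ^ 2 * t⁻¹) := ⟨_, rfl⟩
  have ps : ContDiff ℝ (⊤ : ℕ∞) p := by
    rw [contDiff_iff_contDiffAt]
    intro t
    rcases lt_or_ge 0 t with ht | ht
    · rw [hp]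
      exact contDiffAt_const.add (χs.contDiffAt.mul (contDiffAt_const.add
        (contDiffAt_const.mul (contDiffAt_inv ℝ ht.ne'))))
    · have : p =ᶠ[nhds t] fun _ => 1 := by
        filter_upwards [gt_mem_nhds (show t < r ^ 2 + η by linarith)] with s hs
        rw [hp]; simp [χ0 s hs.le]
      exact contDiffAt_const.congr_of_eventuallyEq this
  have pd : ∀ t, HasDerivAt p (deriv p t) t := fun t =>
    ((ps.differentiable (by simp)) t).hasDerivAt
  have hg : ∀ t, t * p t = t + χ t * ((c ^ 2 - 1) * t + r ^ 2) := fun t => by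
    rw [hp]
    rcases eq_or_ne t 0 with rfl | ht
    · simp [χ0 0 (by positivity)]
    · simp only []
      field_simp
  have gd : ∀ t, p t + t * deriv p t
      = 1 + (deriv χ t * ((c ^ 2 - 1) * t + r ^ 2) + χ t * (c ^ 2 - 1)) := fun t => by
    have e1 : HasDerivAt (fun t => t * p t) (1 * p t + t * deriv p t) t :=
      (hasDerivAt_id t).mul (pd t)
    have e2 : HasDerivAt (fun t => t + χ t * ((c ^ 2 - 1) * t + r ^ 2))
        (1 + (deriv χ t * ((c ^ 2 - 1) * t + r ^ 2) + χ t * ((c ^ 2 - 1) * 1))) t :=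
      (hasDerivAt_id t).add ((χd t).mul (((hasDerivAt_id t).const_mul _).add_const _))
    rw [funext hg] at e1
    have := e1.unique e2
    linarith
  have cvx : ∀ t, 0 < 1 + χ t * (c ^ 2 - 1) := fun t => by
    have h0 := χn t
    have h1 := χl t
    rcases h0.eq_or_lt with h | h
    · rw [← h]; norm_num
    · nlinarith [mul_pos h hc2]
  have pc : Continuous p := ps.continuous
  have fd : ∀ t, HasDerivAt (fun t => ∫ s in (0:ℝ)..t, p s) (p t) t := fun t =>
    intervalIntegral.integral_hasDerivAt_right (pc.intervalIntegrable _ _)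
      (pc.stronglyMeasurableAtFilter _ _) pc.continuousAt
  obtain ⟨f, hf⟩ : ∃ f : ℝ → ℝ, f = fun t => ∫ s in (0:ℝ)..t, p s := ⟨_, rfl⟩
  rw [← hf] at fd
  have key : ∀ t, r ^ 2 + 2 * η ≤ t → f t - (c ^ 2 * t + r ^ 2 * Real.log (t / r ^ 2)) =
      f (r ^ 2 + 2 * η) - (c ^ 2 * (r ^ 2 + 2 * η)
        + r ^ 2 * Real.log ((r ^ 2 + 2 * η) / r ^ 2)) := by
    have hd : ∀ s, r ^ 2 + 2 * η ≤ s →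
        HasDerivAt (fun t => f t - (c ^ 2 * t + r ^ 2 * Real.log (t / r ^ 2))) 0 s := by
      intro s hs
      have hs0 : 0 < s := by linarith
      have := (fd s).sub (((hasDerivAt_id s).const_mul (c ^ 2)).add
        ((((hasDerivAt_id s).div_const (r ^ 2)).log (by simp; constructor <;> positivity)).const_mul
          (r ^ 2)))
      refine this.congr_deriv ?_
      rw [hp]
      simp only [χ1 s hs, id]
      field_simp
      ring
    intro t ht
    refine constant_of_has_deriv_right_zero
      (f := fun t => f t - (c ^ 2 * t + r ^ 2 * Real.log (t / r ^ 2)))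
      (a := r ^ 2 + 2 * η) (b := t) ?_ ?_ t ⟨ht, le_rfl⟩
    · exact fun s hs => (hd s hs.1).continuousAt.continuousWithinAt
    · exact fun s hs => (hd s hs.1).hasDerivWithinAt
  refine ⟨f, p, deriv p, f (r ^ 2 + 2 * η) - (c ^ 2 * (r ^ 2 + 2 * η)
        + r ^ 2 * Real.log ((r ^ 2 + 2 * η) / r ^ 2)), ?_, fd, pd, ?_, ?_, ?_, ?_⟩
  · refine contDiff_infty_iff_deriv.2 ⟨fun t => (fd t).differentiableAt, ?_⟩
    rw [show deriv f = p from funext fun t => (fd t).deriv]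
    exact ps
  · intro t ht
    have h := cvx t
    have : 0 ≤ χ t * (r ^ 2 * t⁻¹) := mul_nonneg (χn t) (by positivity)
    rw [hp]
    simp only []
    linarith
  · intro t ht
    rw [gd]
    have h := cvx t
    have : 0 ≤ deriv χ t * ((c ^ 2 - 1) * t + r ^ 2) := by
      rcases lt_or_ge (r ^ 2 + 2 * η) t with h' | h'
      · rw [χd1 t h']; simp
      · refine mul_nonneg (χd0 t) ?_
        rcases le_total (c ^ 2) 1 with h1 | h1
        · nlinarith [mul_nonneg (sub_nonneg.2 h1) (sub_nonneg.2 h'), mul_pos hc2 hr2,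
            mul_nonneg (sub_nonneg.2 h1) (sub_nonneg.2 hη2), mul_pos hc2 (mul_pos hc2 hr2)]
        · nlinarith [mul_nonneg (sub_nonneg.2 h1) ht]
    linarith
  · intro t ht ht'
    rw [hf]
    have : ∫ s in (0:ℝ)..t, p s = ∫ s in (0:ℝ)..t, (1:ℝ) := by
      refine intervalIntegral.integral_congr fun s hs => ?_
      rw [Set.uIcc_of_le ht] at hs
      rw [hp]
      simp [χ0 s (hs.2.trans ht')]
    simp [this]
  · intro t ht
    linarith [key t ht]

/-- Potential-level formulation of the symplectic blow-down gluing: for all `r, ε > 0` and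
every `c > 0` there is a strictly plurisubharmonic function `H` on all of `ℂⁿ` equal (up to
an additive constant) to the standard potential `‖z‖²` for `‖z‖ < r + δ`, and to the model
blow-up potential `c²‖z‖² + r² log(‖z‖²/r²)` for `‖z‖ > r + ε − δ`. -/
theorem stmt1 (n : ℕ) (hn : 1 ≤ n) (r ε : ℝ) (hr : 0 < r) (hε : 0 < ε) (c : ℝ) (hc : 0 < c) :
    ∃ (H : EuclideanSpace ℂ (Fin n) → ℝ) (a b δ : ℝ), 0 < δ ∧
      ContDiff ℝ (⊤ : ℕ∞) H ∧
      LeviPositiveOn n H Set.univ ∧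
      (∀ z : EuclideanSpace ℂ (Fin n), ‖z‖ < r + δ → H z = ‖z‖ ^ 2 + a) ∧
      (∀ z : EuclideanSpace ℂ (Fin n), r + ε - δ < ‖z‖ →
        H z = c ^ 2 * ‖z‖ ^ 2 + r ^ 2 * Real.log (‖z‖ ^ 2 / r ^ 2) + b) := by
  obtain ⟨η, hη, hη1, hη2⟩ : ∃ η : ℝ, 0 < η ∧ 2 * η ≤ c ^ 2 * r ^ 2 ∧ 2 * η ≤ r * ε := by
    refine ⟨min (c ^ 2 * r ^ 2) (r * ε) / 2, by positivity, ?_, ?_⟩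
    · linarith [min_le_left (c ^ 2 * r ^ 2) (r * ε)]
    · linarith [min_le_right (c ^ 2 * r ^ 2) (r * ε)]
  obtain ⟨δ, hδ, hδ1, hδ2, hδ3⟩ : ∃ δ : ℝ, 0 < δ ∧ δ ≤ ε / 2 ∧ δ ≤ r ∧ δ * (3 * r) ≤ η := by
    refine ⟨min (ε / 2) (min r (η / (3 * r))), by positivity, min_le_left _ _,
      (min_le_right _ _).trans (min_le_left _ _), ?_⟩
    rw [← le_div_iff₀ (by positivity)]
    exact (min_le_right _ _).trans (min_le_right _ _)
  obtain ⟨f, p, q, b, fs, fd, pd, p0, pq, f0, f1⟩ := aux_profile r η c hr hη hc hη1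
  refine ⟨fun z => f (‖z‖ ^ 2), 0, b, δ, hδ, ?_, ?_, ?_, ?_⟩
  · exact fs.comp (contDiff_norm_sq ℂ)
  · intro z _ w hw
    have key : ∀ w : EuclideanSpace ℂ (Fin n),
        iteratedFDeriv ℝ 2 (fun z : EuclideanSpace ℂ (Fin n) => f (‖z‖ ^ 2)) z ![w, w]
        = 4 * q (‖z‖ ^ 2) * (inner ℂ z w).re ^ 2 + 2 * p (‖z‖ ^ 2) * ‖w‖ ^ 2 := by
      intro w
      have hin : (inner ℂ z w).re = inner ℝ z w := by
        simp [PiLp.inner_apply, Complex.inner]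
      rw [hin]
      exact aux_second f p q fd pd z w
    rw [key, key, inner_smul_right, norm_smul]
    have hcs : ‖inner ℂ z w‖ ^ 2 ≤ ‖z‖ ^ 2 * ‖w‖ ^ 2 := by
      rw [← mul_pow]
      gcongr
      exact norm_inner_le_norm z w
    rw [← Complex.normSq_eq_norm_sq, Complex.normSq_apply] at hcs
    have hw2 : 0 < ‖w‖ ^ 2 := by positivity
    have hP := p0 (‖z‖ ^ 2) (by positivity)
    have hQ := pq (‖z‖ ^ 2) (by positivity)
    simp only [Complex.mul_re, Complex.I_re, Complex.I_im, Complex.norm_I]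
    rcases le_total 0 (q (‖z‖ ^ 2)) with h | h
    · have := mul_pos hP hw2
      have := mul_nonneg h (sq_nonneg (inner ℂ z w).re)
      have := mul_nonneg h (sq_nonneg (inner ℂ z w).im)
      nlinarith
    · have := mul_pos hQ hw2
      have := mul_le_mul_of_nonpos_left hcs h
      nlinarith
  · intro z hz
    rw [add_zero]
    refine f0 _ (by positivity) ?_
    have : ‖z‖ ^ 2 ≤ (r + δ) ^ 2 := by gcongr
    nlinarith [mul_nonneg hδ.le (sub_nonneg.2 hδ2)]
  · intro z hz
    refine f1 _ ?_
    have : (r + ε / 2) ^ 2 ≤ ‖z‖ ^ 2 := by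
      gcongr
      linarith
    nlinarith [sq_nonneg ε]

end
end

section
/- Let n ≥ 2 and let A be a real antisymmetric 2n × 2n matrix; let η = Σ_{i<j} A_{ij} · e_i ∧ e_j be the corresponding degree-2 element of the exterior algebra of ℝ^{2n} over ℝ, where e₁, …, e_{2n} is the standard basis. Assume that η is a linear symplectic form, i.e., the n-th power ηⁿ in the exterior algebra is nonzero, and assume that η is not a real multiple of a form with rational coefficients, i.e., there is no nonzero λ ∈ ℝ such that every entry of λA is rational. Then for every l with 1 ≤ l ≤ n − 1, the power η^l is not a real multiple of a form with rational coefficients: there is no nonzero λ ∈ ℝ such that λ·η^l lies in the ℚ-linear span of the wedge monomials e_{i₁} ∧ ⋯ ∧ e_{i_{2l}} in the standard basis vectors. -/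
noncomputable section

/-- The standard basis vector `e i` of `ℝ^m` (viewed as `Fin m → ℝ`). -/
def stdVec (m : ℕ) (i : Fin m) : Fin m → ℝ := Pi.single i 1

/-- The wedge monomial `e_{f 0} ∧ e_{f 1} ∧ ⋯` in the exterior algebra of `ℝ^m`. -/
def wedgeMonomial (m l : ℕ) (f : Fin l → Fin m) : ExteriorAlgebra ℝ (Fin m → ℝ) :=
  (List.ofFn fun i => ExteriorAlgebra.ι ℝ (stdVec m (f i))).prod

/-- The degree-2 element `η = Σ_{i<j} A_{ij} e_i ∧ e_j` of the exterior algebra of `ℝ^m`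
associated to a matrix `A`. -/
def formOfMatrix (m : ℕ) (A : Matrix (Fin m) (Fin m) ℝ) :
    ExteriorAlgebra ℝ (Fin m → ℝ) :=
  ∑ i, ∑ j, if i < j then
    A i j • (ExteriorAlgebra.ι ℝ (stdVec m i) * ExteriorAlgebra.ι ℝ (stdVec m j)) else 0

/-- `x` has rational coefficients: it is a `ℚ`-linear combination of the wedge monomials
`e_{i₁} ∧ ⋯ ∧ e_{i_l}` with `i₁ < ⋯ < i_l`. -/
def HasRatCoeffs (m l : ℕ) (x : ExteriorAlgebra ℝ (Fin m → ℝ)) : Prop :=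
  ∃ q : (Fin l → Fin m) → ℚ,
    (∀ f, ¬ StrictMono f → q f = 0) ∧
    x = ∑ f : Fin l → Fin m, (q f : ℝ) • wedgeMonomial m l f

open ExteriorAlgebra TensorProduct

namespace Aux4

/-- abbreviation for the exterior algebra -/
abbrev EA (m : ℕ) := ExteriorAlgebra ℝ (Fin m → ℝ)
/-- rational exterior algebra -/
abbrev EQ (m : ℕ) := ExteriorAlgebra ℚ (Fin m → ℚ)

/-- contraction -/
abbrev ctr {m : ℕ} (d : Module.Dual ℝ (Fin m → ℝ)) (x : EA m) : EA m :=
  CliffordAlgebra.contractLeft (Q := (0 : QuadraticForm ℝ (Fin m → ℝ))) d x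

lemma ctr_ι_mul {m : ℕ} (d : Module.Dual ℝ (Fin m → ℝ)) (a : Fin m → ℝ) (x : EA m) :
    ctr d (ι ℝ a * x) = d a • x - ι ℝ a * ctr d x :=
  CliffordAlgebra.contractLeft_ι_mul _ _ _

lemma ι_anti {m : ℕ} (a b : Fin m → ℝ) : ι ℝ a * ι ℝ b = - (ι ℝ b * ι ℝ a) :=
  eq_neg_of_add_eq_zero_left (ExteriorAlgebra.ι_add_mul_swap a b)

lemma ctr_ι_ι_mul {m : ℕ} (d : Module.Dual ℝ (Fin m → ℝ)) (a b : Fin m → ℝ) (x : EA m) :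
    ctr d (ι ℝ a * ι ℝ b * x) = ι ℝ (d a • b - d b • a) * x + ι ℝ a * ι ℝ b * ctr d x := by
  rw [mul_assoc, ctr_ι_mul, ctr_ι_mul]
  simp only [map_sub, map_smul, sub_mul, mul_sub, smul_mul_assoc, mul_smul_comm, mul_assoc]
  abel

/-- the vector `d ⌋ η` -/
def row {m : ℕ} (A : Matrix (Fin m) (Fin m) ℝ) (d : Module.Dual ℝ (Fin m → ℝ)) : Fin m → ℝ :=
  fun j => ∑ i, d (stdVec m i) * A i j

lemma row_eq {m : ℕ} (A : Matrix (Fin m) (Fin m) ℝ) (hanti : ∀ i j, A j i = -A i j)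
    (d : Module.Dual ℝ (Fin m → ℝ)) :
    row A d = ∑ i, ∑ j, if i < j then
      A i j • (d (stdVec m i) • stdVec m j - d (stdVec m j) • stdVec m i) else 0 := by
  have h1 : row A d = ∑ i, ∑ j, (d (stdVec m i) * A i j) • stdVec m j := by
    ext k
    simp [row, stdVec, Finset.sum_apply, Pi.single_apply]
  have h2 : ∀ i j, (d (stdVec m i) * A i j) • stdVec m j =
      (if i < j then (d (stdVec m i) * A i j) • stdVec m j else 0) +
      (if j < i then (d (stdVec m i) * A i j) • stdVec m j else 0) := by
    intro i j
    rcases lt_trichotomy i j with h | h | h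
    · simp [h, h.not_gt]
    · subst h
      have : A i i = 0 := by have := hanti i i; linarith
      simp [this]
    · simp [h, h.not_gt]
  rw [h1]
  rw [Finset.sum_congr rfl fun i _ => Finset.sum_congr rfl fun j _ => h2 i j]
  simp_rw [Finset.sum_add_distrib]
  conv_lhs => rw [add_comm, Finset.sum_comm, add_comm]
  simp_rw [← Finset.sum_add_distrib]
  refine Finset.sum_congr rfl fun i _ => Finset.sum_congr rfl fun j _ => ?_
  split_ifs
  · rw [hanti i j]; module
  · simp

lemma ctr_form_mul {m : ℕ} (A : Matrix (Fin m) (Fin m) ℝ) (hanti : ∀ i j, A j i = -A i j)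
    (d : Module.Dual ℝ (Fin m → ℝ)) (x : EA m) :
    ctr d (formOfMatrix m A * x) = ι ℝ (row A d) * x + formOfMatrix m A * ctr d x := by
  rw [row_eq A hanti]
  simp only [formOfMatrix, Finset.sum_mul, map_sum, ctr, ← Finset.sum_add_distrib]
  refine Finset.sum_congr rfl fun i _ => Finset.sum_congr rfl fun j _ => ?_
  split_ifs
  · have := ctr_ι_ι_mul d (stdVec m i) (stdVec m j) x
    simp only [ctr] at this
    simp only [smul_mul_assoc, map_smul, this, smul_add]
  · simp

lemma form_comm {m : ℕ} (A : Matrix (Fin m) (Fin m) ℝ) (a : Fin m → ℝ) :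
    Commute (ι ℝ a) (formOfMatrix m A) := by
  refine Commute.sum_right _ _ _ fun i _ => Commute.sum_right _ _ _ fun j _ => ?_
  split_ifs
  · refine Commute.smul_right ?_ _
    show _ = _
    rw [← mul_assoc, ι_anti a, neg_mul, mul_assoc, ι_anti a, mul_neg, neg_neg, mul_assoc]
  · exact Commute.zero_right _

lemma ctr_pow_mul {m : ℕ} (A : Matrix (Fin m) (Fin m) ℝ) (hanti : ∀ i j, A j i = -A i j)
    (d : Module.Dual ℝ (Fin m → ℝ)) (p : ℕ) :
    ctr d (formOfMatrix m A ^ p) * formOfMatrix m A =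
      (p : ℝ) • (ι ℝ (row A d) * formOfMatrix m A ^ p) := by
  induction p with
  | zero =>
    simp [ctr, CliffordAlgebra.contractLeft_one]
  | succ p ih =>
    rw [pow_succ', ctr_form_mul A hanti, add_mul, mul_assoc, mul_assoc, ih, ← pow_succ, ← pow_succ',
      mul_smul_comm, ← mul_assoc, ← (form_comm A _).eq, mul_assoc, ← pow_succ']
    push_cast
    module

lemma ctr_pow {m : ℕ} (A : Matrix (Fin m) (Fin m) ℝ) (hanti : ∀ i j, A j i = -A i j)
    (d : Module.Dual ℝ (Fin m → ℝ)) (p : ℕ) :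
    ctr d (formOfMatrix m A ^ (p + 1)) =
      ((p : ℝ) + 1) • (ι ℝ (row A d) * formOfMatrix m A ^ p) := by
  induction p with
  | zero =>
    have := ctr_form_mul A hanti d 1
    simpa [ctr, CliffordAlgebra.contractLeft_one] using this
  | succ p ih =>
    rw [pow_succ', ctr_form_mul A hanti, ih,
      mul_smul_comm, ← mul_assoc, ← (form_comm A _).eq, mul_assoc, ← pow_succ']
    push_cast
    module

lemma inj1 {m p : ℕ} (A : Matrix (Fin m) (Fin m) ℝ) (hanti : ∀ i j, A j i = -A i j)
    (hs : formOfMatrix m A ^ (p + 2) ≠ 0) (ψ : Fin m → ℝ)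
    (h : ι ℝ ψ * formOfMatrix m A ^ (p + 1) = 0) : ψ = 0 := by
  have key : ∀ d : Module.Dual ℝ (Fin m → ℝ), d ψ = 0 := by
    intro d
    have h1 := ctr_ι_mul d ψ (formOfMatrix m A ^ (p + 1))
    have h2 := congrArg (· * formOfMatrix m A) h1
    simp only [h, sub_mul, smul_mul_assoc, mul_assoc, ctr_pow_mul A hanti] at h2
    rw [mul_smul_comm, ← mul_assoc, ι_anti, neg_mul, mul_assoc, h, ← pow_succ] at h2
    simp only [ctr, map_zero, zero_mul, mul_zero, neg_zero, smul_zero, sub_zero] at h2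
    exact (smul_eq_zero.mp h2.symm).resolve_right hs
  ext j
  exact key (LinearMap.proj j)

lemma inj2 {m p : ℕ} (A : Matrix (Fin m) (Fin m) ℝ) (hanti : ∀ i j, A j i = -A i j)
    (hs : formOfMatrix m A ^ (p + 2) ≠ 0) (θ φ : Fin m → ℝ)
    (h : ι ℝ θ * ι ℝ φ * formOfMatrix m A ^ p = 0) (i j : Fin m) :
    θ i * φ j = φ i * θ j := by
  have h1 := ctr_ι_ι_mul (LinearMap.proj i) θ φ (formOfMatrix m A ^ p)
  have h2 := congrArg (· * formOfMatrix m A) h1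
  have h3 : ∀ χ : Fin m → ℝ, ι ℝ θ * (ι ℝ φ * (ι ℝ χ * formOfMatrix m A ^ p)) = 0 := by
    intro χ
    rw [← mul_assoc (ι ℝ φ), ι_anti φ, neg_mul, mul_neg, mul_assoc, ← mul_assoc (ι ℝ θ), ι_anti θ,
      neg_mul, mul_assoc, ← mul_assoc (ι ℝ θ), h]
    simp
  simp only [h, add_mul, mul_assoc, ctr_pow_mul A hanti, mul_smul_comm, h3, ← pow_succ] at h2
  simp only [ctr, map_zero, zero_mul, smul_zero, add_zero] at h2
  have h4 := inj1 A hanti hs _ h2.symm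
  have h5 := congrFun h4 j
  simp at h5
  linarith

lemma inj3 {m p k : ℕ} (hk : k ≤ p) (A : Matrix (Fin m) (Fin m) ℝ)
    (hanti : ∀ i j, A j i = -A i j)
    (hs : formOfMatrix m A ^ (p + 2) ≠ 0) (θ φ : Fin m → ℝ)
    (h : ι ℝ θ * ι ℝ φ * formOfMatrix m A ^ k = 0) (i j : Fin m) :
    θ i * φ j = φ i * θ j := by
  refine inj2 A hanti hs θ φ ?_ i j
  obtain ⟨c, rfl⟩ := Nat.exists_eq_add_of_le hk
  rw [pow_add, ← mul_assoc, h, zero_mul]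

/-- extension of scalars -/
def Θ (m : ℕ) : EQ m →ₐ[ℚ] EA m :=
  ExteriorAlgebra.lift ℚ ⟨((ι ℝ).restrictScalars ℚ) ∘ₗ
    (LinearMap.pi fun j => (Algebra.linearMap ℚ ℝ) ∘ₗ LinearMap.proj j), fun v => by
      simp⟩

lemma Θ_ι (m : ℕ) (v : Fin m → ℚ) : Θ m (ι ℚ v) = ι ℝ (fun j => (v j : ℝ)) := by
  simp only [Θ, ExteriorAlgebra.lift_ι_apply]
  rfl

/-- linear part of the comparison map -/
def ψlin (m : ℕ) : (Fin m → ℝ) →ₗ[ℝ] ℝ ⊗[ℚ] EQ m :=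
  ∑ j, (LinearMap.toSpanSingleton ℝ _ ((1 : ℝ) ⊗ₜ[ℚ] (ι ℚ (Pi.single j (1 : ℚ)) : EQ m))) ∘ₗ
    LinearMap.proj j

lemma ψlin_apply (m : ℕ) (v : Fin m → ℝ) :
    ψlin m v = ∑ j, v j ⊗ₜ[ℚ] (ι ℚ (Pi.single j (1 : ℚ)) : EQ m) := by
  simp [ψlin, LinearMap.sum_apply, TensorProduct.smul_tmul']

lemma ψlin_sq (m : ℕ) (v : Fin m → ℝ) : ψlin m v * ψlin m v = 0 := by
  have h1 : ψlin m v * ψlin m v = ∑ i, ∑ j, (v i * v j) ⊗ₜ[ℚ]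
      ((ι ℚ (Pi.single i (1 : ℚ)) * ι ℚ (Pi.single j (1 : ℚ)) : EQ m)) := by
    simp only [ψlin_apply, Finset.sum_mul_sum, Algebra.TensorProduct.tmul_mul_tmul]
  have h2 : ψlin m v * ψlin m v = - (ψlin m v * ψlin m v) := by
    conv_lhs => rw [h1, Finset.sum_comm]
    rw [h1, ← Finset.sum_neg_distrib]
    refine Finset.sum_congr rfl fun i _ => ?_
    rw [← Finset.sum_neg_distrib]
    refine Finset.sum_congr rfl fun j _ => ?_
    rw [← TensorProduct.tmul_neg, mul_comm,
      eq_neg_of_add_eq_zero_left (ExteriorAlgebra.ι_add_mul_swap (R := ℚ)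
        (Pi.single j (1 : ℚ) : Fin m → ℚ) (Pi.single i 1))]
  have h3 : (2 : ℝ) • (ψlin m v * ψlin m v) = 0 := by
    rw [two_smul]
    exact eq_neg_iff_add_eq_zero.mp h2
  exact (smul_eq_zero.mp h3).resolve_left two_ne_zero

/-- comparison map -/
def Ψ (m : ℕ) : EA m →ₐ[ℝ] ℝ ⊗[ℚ] EQ m := ExteriorAlgebra.lift ℝ ⟨ψlin m, ψlin_sq m⟩

lemma Ψ_ι (m : ℕ) (v : Fin m → ℝ) : Ψ m (ι ℝ v) = ψlin m v := by
  simp [Ψ]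

lemma Ψ_Θ (m : ℕ) (y : EQ m) : Ψ m (Θ m y) = (1 : ℝ) ⊗ₜ[ℚ] y := by
  have : ((Ψ m).restrictScalars ℚ).comp (Θ m) =
      (Algebra.TensorProduct.includeRight : EQ m →ₐ[ℚ] ℝ ⊗[ℚ] EQ m) := by
    apply ExteriorAlgebra.hom_ext
    apply LinearMap.pi_ext'
    intro j
    ext
    simp only [AlgHom.toLinearMap_apply, LinearMap.comp_apply, AlgHom.comp_apply, Θ_ι,
      AlgHom.restrictScalars_apply, Ψ_ι, ψlin_apply]
    rw [Finset.sum_eq_single j]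
    · simp
    · intro b _ hb
      simp [hb]
    · simp
  exact DFunLike.congr_fun this y

lemma descend {m : ℕ} (g : ℝ →ₗ[ℚ] ℚ) (θ : Fin m → ℝ) (y : EQ m)
    (h : ι ℝ θ * Θ m y = 0) : ι ℝ (fun j => (g (θ j) : ℝ)) * Θ m y = 0 := by
  have h1 := congrArg (Ψ m) h
  rw [map_mul, Ψ_Θ, Ψ_ι, ψlin_apply, Finset.sum_mul, map_zero] at h1
  simp only [Algebra.TensorProduct.tmul_mul_tmul, mul_one] at h1
  have h2 := congrArg (fun z => TensorProduct.lid ℚ (EQ m) (g.rTensor (EQ m) z)) h1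
  simp only [map_sum, LinearMap.rTensor_tmul, TensorProduct.lid_tmul, map_zero] at h2
  have h3 : (ι ℚ (fun j => g (θ j)) : EQ m) * y = 0 := by
    rw [← h2, ← Finset.univ_sum_single (fun j => g (θ j)), map_sum, Finset.sum_mul]
    refine Finset.sum_congr rfl fun j _ => ?_
    rw [← smul_mul_assoc, ← map_smul, ← Pi.single_smul]
    simp
  have h4 := congrArg (Θ m) h3
  rwa [map_mul, Θ_ι, map_zero] at h4

lemma ctr_rat {m : ℕ} (d : Module.Dual ℝ (Fin m → ℝ))
    (hd : ∀ v : Fin m → ℚ, ∃ q : ℚ, d (fun j => (v j : ℝ)) = q) (y : EQ m) :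
    ∃ z : EQ m, ctr d (Θ m y) = Θ m z := by
  induction y using CliffordAlgebra.left_induction with
  | algebraMap r =>
    refine ⟨0, ?_⟩
    have : Θ m (algebraMap ℚ _ r) = algebraMap ℝ (EA m) (r : ℝ) := by
      rw [AlgHom.commutes]
      exact IsScalarTower.algebraMap_apply ℚ ℝ (EA m) r
    erw [this]
    simp only [ctr, map_zero]
    exact CliffordAlgebra.contractLeft_algebraMap
      (Q := (0 : QuadraticForm ℝ (Fin m → ℝ))) d (r : ℝ)
  | add x y hx hy =>
    obtain ⟨a, ha⟩ := hx
    obtain ⟨b, hb⟩ := hy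
    refine ⟨a + b, ?_⟩
    simp only [ctr] at *
    erw [map_add, map_add, ha, hb, map_add]
  | ι_mul x v hx =>
    obtain ⟨a, ha⟩ := hx
    obtain ⟨q, hq⟩ := hd v
    refine ⟨q • x - ι ℚ v * a, ?_⟩
    have : Θ m (CliffordAlgebra.ι 0 v * x) = ι ℝ (fun j => (v j : ℝ)) * Θ m x := by
      rw [map_mul]; erw [Θ_ι]
    erw [this]
    rw [ctr_ι_mul, ha, hq, map_sub, map_mul, Θ_ι, map_smul]
    congr 1

lemma wedge_rat (m l : ℕ) (f : Fin l → Fin m) : ∃ y, wedgeMonomial m l f = Θ m y := by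
  refine ⟨(List.ofFn fun i => ι ℚ (Pi.single (f i) (1 : ℚ))).prod, ?_⟩
  rw [map_list_prod, List.map_ofFn, wedgeMonomial]
  congr 2
  funext i
  simp only [Function.comp, Θ_ι]
  congr 1
  ext j
  by_cases h : j = f i
  · subst h; simp [stdVec]
  · simp [stdVec, h]

lemma rat_mem {m l : ℕ} {x : EA m} (h : HasRatCoeffs m l x) : ∃ y, x = Θ m y := by
  obtain ⟨q, -, rfl⟩ := h
  choose y hy using wedge_rat m l
  refine ⟨∑ f, q f • y f, ?_⟩
  rw [map_sum]
  refine Finset.sum_congr rfl fun f _ => ?_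
  rw [map_smul, hy]
  exact (algebraMap_smul ℝ (q f) (Θ m (y f)))

lemma main_rel {m p k : ℕ} (hk : k ≤ p) (A : Matrix (Fin m) (Fin m) ℝ)
    (hanti : ∀ i j, A j i = -A i j) (hs : formOfMatrix m A ^ (p + 2) ≠ 0)
    (lam : ℝ) (hlam : lam ≠ 0)
    (h : HasRatCoeffs m (2 * (k + 1)) (lam • formOfMatrix m A ^ (k + 1)))
    (g : ℝ →ₗ[ℚ] ℚ) (d : Module.Dual ℝ (Fin m → ℝ))
    (hd : ∀ v : Fin m → ℚ, ∃ q : ℚ, d (fun j => (v j : ℝ)) = q) (i j : Fin m) :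
    (g (row A d i) : ℝ) * row A d j = row A d i * g (row A d j) := by
  obtain ⟨y, hy⟩ := rat_mem h
  obtain ⟨z, hz⟩ := ctr_rat d hd y
  have h1 : Θ m z = (lam * ((k : ℝ) + 1)) • (ι ℝ (row A d) * formOfMatrix m A ^ k) := by
    rw [← hz, ← hy, mul_smul, ← ctr_pow A hanti]
    simp [ctr]
  have h2 : ι ℝ (row A d) * Θ m z = 0 := by
    rw [h1, mul_smul_comm, ← mul_assoc, ExteriorAlgebra.ι_sq_zero, zero_mul, smul_zero]
  have h3 := descend g _ _ h2
  rw [h1, mul_smul_comm, ← mul_assoc] at h3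
  have h4 : lam * ((k : ℝ) + 1) ≠ 0 := mul_ne_zero hlam (by positivity)
  exact inj3 hk A hanti hs _ _ ((smul_eq_zero.mp h3).resolve_left h4) i j

lemma row_proj {m : ℕ} (A : Matrix (Fin m) (Fin m) ℝ) (a j : Fin m) :
    row A (LinearMap.proj a) j = A a j := by
  simp [row, stdVec, Pi.single_apply]

lemma row_add {m : ℕ} (A : Matrix (Fin m) (Fin m) ℝ) (d e) (j : Fin m) :
    row A (d + e) j = row A d j + row A e j := by
  simp [row, add_mul, Finset.sum_add_distrib]

end Aux4

open Aux4 in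
theorem stmt4 (n : ℕ) (hn : 2 ≤ n) (A : Matrix (Fin (2 * n)) (Fin (2 * n)) ℝ)
    (hanti : ∀ i j, A j i = -A i j)
    (hsymp : (formOfMatrix (2 * n) A) ^ n ≠ 0)
    (hirr : ¬ ∃ lam : ℝ, lam ≠ 0 ∧ ∀ i j, ∃ q : ℚ, lam * A i j = (q : ℝ)) :
    ∀ l : ℕ, 1 ≤ l → l ≤ n - 1 →
      ¬ ∃ lam : ℝ, lam ≠ 0 ∧
        HasRatCoeffs (2 * n) (2 * l) (lam • (formOfMatrix (2 * n) A) ^ l) := by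
  rintro l hl1 hl2 ⟨lam, hlam, hrat⟩
  obtain ⟨k, rfl⟩ : ∃ k, l = k + 1 := ⟨l - 1, by omega⟩
  obtain ⟨p, hp⟩ : ∃ p, n = p + 2 := ⟨n - 2, by omega⟩
  have hk : k ≤ p := by omega
  have hs : (formOfMatrix (2 * n) A) ^ (p + 2) ≠ 0 := by rw [← hp]; exact hsymp
  have hA : ∃ a b, A a b ≠ 0 := by
    by_contra! hA
    exact hirr ⟨1, one_ne_zero, fun i j => ⟨0, by simp [hA i j]⟩⟩
  obtain ⟨a, b, hab⟩ := hA
  obtain ⟨g, hg⟩ : ∃ g : ℝ →ₗ[ℚ] ℚ, g (A a b) = 1 := by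
    have := (Module.forall_dual_apply_eq_zero_iff ℚ (A a b)).not.mpr hab
    push Not at this
    obtain ⟨f, hf⟩ := this
    exact ⟨(f (A a b))⁻¹ • f, by simp [hf]⟩
  have hproj : ∀ i : Fin (2 * n), ∀ v : Fin (2 * n) → ℚ, ∃ q : ℚ,
      (LinearMap.proj i : Module.Dual ℝ (Fin (2 * n) → ℝ)) (fun j => (v j : ℝ)) = q :=
    fun i v => ⟨v i, rfl⟩
  have r1 : ∀ i j k, (g (A i j) : ℝ) * A i k = A i j * g (A i k) := by
    intro i j k
    simpa only [row_proj] using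
      main_rel hk A hanti hs lam hlam hrat g (LinearMap.proj i) (hproj i) j k
  have r2 : ∀ i i' j k, (g (A i j) : ℝ) * A i' k + g (A i' j) * A i k =
      A i' j * g (A i k) + A i j * g (A i' k) := by
    intro i i' j k
    have := main_rel hk A hanti hs lam hlam hrat g
      ((LinearMap.proj i : Module.Dual ℝ (Fin (2 * n) → ℝ)) +
        (LinearMap.proj i' : Module.Dual ℝ (Fin (2 * n) → ℝ)))
      (fun v => ⟨v i + v i', by push_cast; rfl⟩) j k
    simp only [row_add, row_proj, map_add, Rat.cast_add] at this
    linarith [r1 i j k, r1 i' j k]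
  have hB : ∀ i j, (g (A j i) : ℝ) = - g (A i j) := by
    intro i j
    rw [hanti i j]; simp
  have r3 : ∀ i j k l, (g (A i j) : ℝ) * A k l = A i j * g (A k l) := by
    intro i j k l
    have e1 := r2 i k j l
    have e2 := r2 i l j k
    have e3 := r2 i j k l
    rw [hB j k, hanti j k] at e1
    rw [hB j l, hanti j l, hB k l, hanti k l] at e2
    linarith
  refine hirr ⟨(A a b)⁻¹, inv_ne_zero hab, fun i j => ⟨g (A i j), ?_⟩⟩
  have := r3 a b i j
  rw [hg] at this
  field_simp
  simpa using this

end
end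

section
/- Let l ≥ 1 and let W = ℝ^{l+2} be equipped with the nondegenerate symmetric bilinear form B(x, y) = x₀y₀ + x₁y₁ − Σ_{i=2}^{l+1} x_i y_i of signature (2, l). Let SO(B) be the group of linear automorphisms g of W with determinant 1 satisfying B(gx, gy) = B(x, y) for all x, y, regarded as a topological group with the topology induced from the space of linear endomorphisms of W, and let SO⁺(B) be the connected component of the identity in SO(B). Let F be the set of all g ∈ SO⁺(B) for which there exists a linear subspace U ⊆ W of dimension l that is fixed pointwise by g and whose B-orthogonal complement is a 2-dimensional subspace on which B is positive definite. Then the subgroup of SO(B) generated by F is exactly SO⁺(B). -/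
noncomputable section

open Matrix

/-- The diagonal matrix of the signature `(2, l)` bilinear form
`B(x,y) = x₀y₀ + x₁y₁ − Σ_{i≥2} xᵢyᵢ` on `W = ℝ^{l+2}`. -/
def etaMat (l : ℕ) : Matrix (Fin (l + 2)) (Fin (l + 2)) ℝ :=
  Matrix.diagonal fun i => if (i : ℕ) < 2 then (1 : ℝ) else -1

/-- The bilinear form `B(x,y) = x₀y₀ + x₁y₁ − Σ_{i≥2} xᵢyᵢ` of signature `(2, l)`. -/
def Bform (l : ℕ) : LinearMap.BilinForm ℝ (Fin (l + 2) → ℝ) :=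
  Matrix.toBilin' (etaMat l)

/-- The group `SO(B)` of linear automorphisms of `W = ℝ^{l+2}` of determinant `1` preserving
`B`, realized as a subset of the group of invertible `(l+2) × (l+2)` real matrices. -/
def SOset (l : ℕ) : Set (Matrix (Fin (l + 2)) (Fin (l + 2)) ℝ)ˣ :=
  {g | (g : Matrix (Fin (l + 2)) (Fin (l + 2)) ℝ)ᵀ * etaMat l * g = etaMat l ∧
       Matrix.det (g : Matrix (Fin (l + 2)) (Fin (l + 2)) ℝ) = 1}

lemma one_mem_SOset (l : ℕ) :
    (1 : (Matrix (Fin (l + 2)) (Fin (l + 2)) ℝ)ˣ) ∈ SOset l := by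
  constructor <;> simp [SOset]

/-- `SO⁺(B)`: the connected component of the identity in the topological group `SO(B)`
(with the topology induced from the space of matrices), viewed as a set of invertible
matrices. -/
def SOplus (l : ℕ) : Set (Matrix (Fin (l + 2)) (Fin (l + 2)) ℝ)ˣ :=
  Subtype.val '' connectedComponent (⟨1, one_mem_SOset l⟩ : SOset l)

/-- The set `F` of all `g ∈ SO⁺(B)` fixing pointwise an `l`-dimensional subspace `U ⊆ W`
whose `B`-orthogonal complement is a positive 2-plane. -/
def FixSet (l : ℕ) : Set (Matrix (Fin (l + 2)) (Fin (l + 2)) ℝ)ˣ :=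
  {g | g ∈ SOplus l ∧
    ∃ U : Submodule ℝ (Fin (l + 2) → ℝ),
      Module.finrank ℝ U = l ∧
      (∀ u ∈ U, (g : Matrix (Fin (l + 2)) (Fin (l + 2)) ℝ).mulVec u = u) ∧
      Module.finrank ℝ ((Bform l).orthogonal U) = 2 ∧
      (∀ w ∈ (Bform l).orthogonal U, w ≠ 0 → 0 < Bform l w w)}

abbrev MatL (l : ℕ) := Matrix (Fin (l + 2)) (Fin (l + 2)) ℝ

abbrev VecL (l : ℕ) := Fin (l + 2) → ℝ

lemma Bform_def (l : ℕ) (x y : VecL l) : Bform l x y = x ⬝ᵥ (etaMat l *ᵥ y) :=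
  Matrix.toBilin'_apply' _ _ _

lemma Bform_comm (l : ℕ) (x y : VecL l) : Bform l x y = Bform l y x := by
  simp only [Bform_def, etaMat, dotProduct, mulVec_diagonal]
  exact Finset.sum_congr rfl fun i _ => by ring

lemma Bform_nondeg (l : ℕ) : (Bform l).Nondegenerate := by
  apply LinearMap.BilinForm.nondegenerate_toBilin'_of_det_ne_zero'
  rw [etaMat, det_diagonal]
  refine Finset.prod_ne_zero_iff.mpr fun i _ => ?_
  split_ifs <;> norm_num

lemma Bform_isRefl (l : ℕ) : (Bform l).IsRefl := fun x y h => by rw [Bform_comm]; exact h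

/-- An isometry in terms of matrices. -/
lemma isom_iff (l : ℕ) (M : MatL l) :
    Mᵀ * etaMat l * M = etaMat l ↔ ∀ x y, Bform l (M *ᵥ x) (M *ᵥ y) = Bform l x y := by
  have key : ∀ x y, Bform l (M *ᵥ x) (M *ᵥ y) = x ⬝ᵥ ((Mᵀ * etaMat l * M) *ᵥ y) := by
    intro x y
    rw [Bform_def, ← mulVec_mulVec, ← mulVec_mulVec, dotProduct_mulVec x, vecMul_transpose]
  constructor
  · intro h x y
    rw [key, h, Bform_def]
  · intro h
    ext i j
    have := h (Pi.single i 1) (Pi.single j 1)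
    rw [key, Bform_def] at this
    simpa using this

/-- Matrix of the reflection in `u`. -/
def rfl' (l : ℕ) (u : VecL l) : MatL l :=
  1 - (2 / Bform l u u) • vecMulVec u (etaMat l *ᵥ u)

lemma rfl'_mulVec (l : ℕ) (u x : VecL l) :
    rfl' l u *ᵥ x = x - (2 / Bform l u u * Bform l u x) • u := by
  rw [rfl', sub_mulVec, one_mulVec, smul_mulVec, vecMulVec_mulVec, Bform_comm l u x, Bform_def l x u,
    dotProduct_comm x]
  ext i
  simp
  ring

lemma mat_ext (l : ℕ) {M N : MatL l} (h : ∀ x, M *ᵥ x = N *ᵥ x) : M = N :=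
  Matrix.ext_of_mulVec_single fun i => h _

lemma rfl'_sq (l : ℕ) {u : VecL l} (hu : Bform l u u ≠ 0) : rfl' l u * rfl' l u = 1 := by
  apply mat_ext
  intro x
  rw [← mulVec_mulVec, rfl'_mulVec, rfl'_mulVec, one_mulVec]
  ext i
  simp
  field_simp
  ring

lemma rfl'_isom (l : ℕ) {u : VecL l} (hu : Bform l u u ≠ 0) (x y : VecL l) :
    Bform l (rfl' l u *ᵥ x) (rfl' l u *ᵥ y) = Bform l x y := by
  rw [rfl'_mulVec, rfl'_mulVec]
  simp [Bform_comm l x u]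
  field_simp
  ring

lemma rfl'_det (l : ℕ) {u : VecL l} (hu : Bform l u u ≠ 0) : (rfl' l u).det = -1 := by
  have h : rfl' l u = 1 + replicateCol Unit (-(2 / Bform l u u) • u)
      * replicateRow Unit (etaMat l *ᵥ u) := by
    rw [← vecMulVec_eq Unit, rfl', smul_vecMulVec, neg_smul, sub_eq_add_neg]
  rw [h, det_one_add_replicateCol_mul_replicateRow, dotProduct_smul, dotProduct_comm, ← Bform_def]
  simp
  field_simp
  ring

lemma rfl'_smul (l : ℕ) (u : VecL l) {c : ℝ} (hc : c ≠ 0) : rfl' l (c • u) = rfl' l u := by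
  apply mat_ext
  intro x
  rw [rfl'_mulVec, rfl'_mulVec]
  by_cases hu : Bform l u u = 0
  · simp [hu]
  ext i
  simp
  field_simp

lemma Bform_cont (l : ℕ) : Continuous fun p : VecL l × VecL l => Bform l p.1 p.2 := by
  simp only [Bform_def]
  fun_prop

lemma rfl'_contAt (l : ℕ) {u : VecL l} (hu : Bform l u u ≠ 0) : ContinuousAt (rfl' l) u := by
  unfold rfl'
  have h1 : ContinuousAt (fun u => Bform l u u) u :=
    ((Bform_cont l).comp (continuous_id.prodMk continuous_id)).continuousAt
  refine continuousAt_const.sub (ContinuousAt.smul (continuousAt_const.div h1 hu) ?_)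
  apply Continuous.continuousAt
  fun_prop

/-- Unit given by a product of two reflections. -/
def uu (l : ℕ) (u v : VecL l) (hu : Bform l u u ≠ 0) (hv : Bform l v v ≠ 0) : (MatL l)ˣ where
  val := rfl' l u * rfl' l v
  inv := rfl' l v * rfl' l u
  val_inv := by
    rw [mul_assoc, ← mul_assoc (rfl' l v) (rfl' l v), rfl'_sq l hv, one_mul, rfl'_sq l hu]
  inv_val := by
    rw [mul_assoc, ← mul_assoc (rfl' l u) (rfl' l u), rfl'_sq l hu, one_mul, rfl'_sq l hv]

lemma uu_mem (l : ℕ) (u v : VecL l) (hu : Bform l u u ≠ 0) (hv : Bform l v v ≠ 0) :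
    uu l u v hu hv ∈ SOset l := by
  constructor
  · rw [isom_iff]
    intro x y
    simp only [uu, ← mulVec_mulVec]
    rw [rfl'_isom l hu, rfl'_isom l hv]
  · simp [uu, rfl'_det l hu, rfl'_det l hv]

lemma gram_pos (l : ℕ) {u v : VecL l} (hu : 0 < Bform l u u)
    (hD : Bform l u v ^ 2 < Bform l u u * Bform l v v) (a b : ℝ) (hab : a ≠ 0 ∨ b ≠ 0) :
    0 < Bform l (a • u + b • v) (a • u + b • v) := by
  have h : Bform l (a • u + b • v) (a • u + b • v) =
      a ^ 2 * Bform l u u + 2 * a * b * Bform l u v + b ^ 2 * Bform l v v := by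
    simp [Bform_comm l v u]
    ring
  rw [h]
  have h2 : 0 < Bform l u u *
      (a ^ 2 * Bform l u u + 2 * a * b * Bform l u v + b ^ 2 * Bform l v v) := by
    have : Bform l u u * (a ^ 2 * Bform l u u + 2 * a * b * Bform l u v + b ^ 2 * Bform l v v)
      = (a * Bform l u u + b * Bform l u v) ^ 2
        + b ^ 2 * (Bform l u u * Bform l v v - Bform l u v ^ 2) := by ring
    rw [this]
    by_cases hb : b = 0
    · have ha : a ≠ 0 := by tauto
      subst hb
      simp
      positivity
    · have : 0 < b ^ 2 := by positivity
      have := mul_pos this (sub_pos.mpr hD)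
      positivity
  exact pos_of_mul_pos_right h2 hu.le

/-- Products of two reflections in vectors spanning a positive plane lie in `F`. -/
lemma uu_fix (l : ℕ) {u v : VecL l} (hu : 0 < Bform l u u)
    (hv : 0 < Bform l v v) (hD : Bform l u v ^ 2 < Bform l u u * Bform l v v) :
    uu l u v hu.ne' hv.ne' ∈ FixSet l := by
  refine ⟨?_, ?_⟩
  · have hp : ∀ t : ℝ, Bform l (t • u + (1 - t) • v) (t • u + (1 - t) • v) ≠ 0 := by
      intro t
      refine (gram_pos l hu hD t (1 - t) ?_).ne'
      by_cases ht : t = 0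
      · right; simp [ht]
      · left; exact ht
    let f : ℝ → SOset l := fun t => ⟨uu l (t • u + (1 - t) • v) v (hp t) hv.ne', uu_mem _ _ _ _ _⟩
    have hr : Continuous fun t : ℝ => rfl' l (t • u + (1 - t) • v) := by
      rw [continuous_iff_continuousAt]
      intro t
      refine ContinuousAt.comp' (rfl'_contAt l (hp t)) ?_
      fun_prop
    have hf : Continuous f := by
      refine Continuous.subtype_mk ?_ _
      rw [Units.continuous_iff]
      exact ⟨hr.mul continuous_const, continuous_const.mul hr⟩
    have h0 : f 0 = ⟨1, one_mem_SOset l⟩ := by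
      apply Subtype.ext
      apply Units.ext
      simp [f, uu, rfl'_sq l hv.ne']
    have h1 : f 1 = ⟨uu l u v hu.ne' hv.ne', uu_mem _ _ _ _ _⟩ := by
      apply Subtype.ext
      apply Units.ext
      simp [f, uu]
    refine ⟨f 1, ?_, by rw [h1]⟩
    rw [← h0]
    exact (isPreconnected_range hf).subset_connectedComponent ⟨0, rfl⟩ ⟨1, rfl⟩
  · have hli : LinearIndependent ℝ ![u, v] := by
      rw [LinearIndependent.pair_iff]
      intro a b hab
      by_contra hc
      have := gram_pos l hu hD a b (by tauto)
      rw [hab] at this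
      simp at this
    have hfr : Module.finrank ℝ (Submodule.span ℝ (Set.range ![u, v])) = 2 := by
      rw [finrank_span_eq_card hli]; simp
    have hoo := LinearMap.BilinForm.orthogonal_orthogonal (Bform_nondeg l) (Bform_isRefl l)
      (Submodule.span ℝ (Set.range ![u, v]))
    refine ⟨(Bform l).orthogonal (Submodule.span ℝ (Set.range ![u, v])), ?_, ?_, ?_, ?_⟩
    · rw [LinearMap.BilinForm.finrank_orthogonal (Bform_nondeg l), hfr]
      simp
    · intro x hx
      rw [LinearMap.BilinForm.mem_orthogonal_iff] at hx
      have hxu : Bform l u x = 0 := hx u (Submodule.subset_span ⟨0, rfl⟩)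
      have hxv : Bform l v x = 0 := hx v (Submodule.subset_span ⟨1, rfl⟩)
      simp only [uu, ← mulVec_mulVec]
      rw [rfl'_mulVec l v, hxv]
      simp [rfl'_mulVec l u, hxu]
    · rw [hoo, hfr]
    · intro w hw hw0
      rw [hoo] at hw
      simp only [Matrix.range_cons, Matrix.range_empty, Set.union_empty,
        Set.singleton_union, Submodule.mem_span_pair] at hw
      obtain ⟨a, b, rfl⟩ := hw
      apply gram_pos l hu hD
      by_contra hc
      push Not at hc
      apply hw0
      simp [hc.1, hc.2]

/-- Matrices in the group generated by `F`. -/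
def Hm (l : ℕ) : Submonoid (MatL l) :=
  (Subgroup.closure (FixSet l)).toSubmonoid.map (Units.coeHom (MatL l))

lemma Hm_pos (l : ℕ) {u v : VecL l} (hu : 0 < Bform l u u)
    (hv : 0 < Bform l v v) (hD : Bform l u v ^ 2 < Bform l u u * Bform l v v) :
    rfl' l u * rfl' l v ∈ Hm l :=
  ⟨uu l u v hu.ne' hv.ne', Subgroup.subset_closure (uu_fix l hu hv hD), rfl⟩

lemma Hm_symm (l : ℕ) {u v : VecL l} (hu : Bform l u u ≠ 0) (hv : Bform l v v ≠ 0)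
    (h : rfl' l u * rfl' l v ∈ Hm l) : rfl' l v * rfl' l u ∈ Hm l := by
  obtain ⟨g, hg, hgu⟩ := h
  have : g = uu l u v hu hv := Units.ext hgu
  subst this
  exact ⟨_, (Subgroup.closure (FixSet l)).inv_mem hg, rfl⟩

lemma Hm_trans (l : ℕ) {u v w : VecL l} (hv : Bform l v v ≠ 0)
    (h : rfl' l u * rfl' l v ∈ Hm l) (h' : rfl' l v * rfl' l w ∈ Hm l) :
    rfl' l u * rfl' l w ∈ Hm l := by
  have := mul_mem h h'
  rwa [mul_assoc, ← mul_assoc (rfl' l v) (rfl' l v), rfl'_sq l hv, one_mul] at this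

/-- In a Lorentzian plane, products of two negative reflections are products of positive ones. -/
lemma swap_refl (l : ℕ) {a b : VecL l} (ha : Bform l a a ≠ 0) (hb : Bform l b b ≠ 0)
    (hD : Bform l a a * Bform l b b - Bform l a b ^ 2 ≠ 0) :
    rfl' l a * rfl' l b = rfl' l (Bform l a b • a - Bform l a a • b) *
      rfl' l (Bform l a b • b - Bform l b b • a) := by
  apply mat_ext
  intro x
  simp only [← mulVec_mulVec, rfl'_mulVec]
  have e1 : Bform l (Bform l a b • a - Bform l a a • b) (Bform l a b • a - Bform l a a • b)
      = Bform l a a * (Bform l a a * Bform l b b - Bform l a b ^ 2) := by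
    simp [Bform_comm l b a]; ring
  have e2 : Bform l (Bform l a b • b - Bform l b b • a) (Bform l a b • b - Bform l b b • a)
      = Bform l b b * (Bform l a a * Bform l b b - Bform l a b ^ 2) := by
    simp [Bform_comm l b a]; ring
  rw [e1, e2]
  ext i
  simp [Bform_comm l b a]
  generalize Bform l a a = A at *
  generalize Bform l b b = C at *
  generalize Bform l a b = E at *
  clear e1 e2
  obtain ⟨D, hDD⟩ : ∃ D, D = A * C - E ^ 2 := ⟨_, rfl⟩
  rw [← hDD] at hD ⊢
  have hC : C = (D + E ^ 2) / A := by
    field_simp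
    linarith
  have hne : D + E ^ 2 ≠ 0 := by
    rw [hDD]
    simpa using And.intro ha hb
  clear hDD
  subst hC
  field_simp
  ring

lemma Bform_single (l : ℕ) (i j : Fin (l + 2)) :
    Bform l (Pi.single i 1) (Pi.single j 1) =
      if i = j then (if (i : ℕ) < 2 then 1 else -1) else 0 := by
  rw [Bform, Matrix.toBilin'_single, etaMat, diagonal_apply]

lemma Bform_single_ne (l : ℕ) (i : Fin (l + 2)) :
    Bform l (Pi.single i 1) (Pi.single i 1) ≠ 0 := by
  rw [Bform_single, if_pos rfl]
  split_ifs <;> norm_num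

lemma ev_lt (l : ℕ) {f g : VecL l → ℝ} (hf : Continuous f) (hg : Continuous g) {x : VecL l}
    (h : f x < g x) : ∀ᶠ w in nhds x, f w < g w :=
  (isOpen_lt hf hg).mem_nhds h

lemma Bform_cont' (l : ℕ) {X : Type*} [TopologicalSpace X] {f g : X → VecL l} (hf : Continuous f) (hg : Continuous g) :
    Continuous fun w => Bform l (f w) (g w) := (Bform_cont l).comp (hf.prodMk hg)

lemma near (l : ℕ) (i : Fin (l + 2)) :
    ∀ᶠ w in nhds ((2 : ℝ) • (Pi.single i 1 : VecL l)),
      rfl' l w * rfl' l (Pi.single i 1) ∈ Hm l := by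
  by_cases hi : (i : ℕ) < 2
  · obtain ⟨j, hj, hij⟩ : ∃ j : Fin (l + 2), (j : ℕ) < 2 ∧ i ≠ j := by
      by_cases h0 : i = 0
      · exact ⟨1, by simp, by simp [h0]⟩
      · exact ⟨0, by simp, h0⟩
    have hii := Bform_single l i i
    have hjj := Bform_single l j j
    have hij' := Bform_single l i j
    have hji' := Bform_single l j i
    rw [if_neg hij] at hij'
    rw [if_neg hij.symm] at hji'
    simp only [if_true, hi, hj] at hii hjj
    have e1 := ev_lt l (x := (2 : ℝ) • (Pi.single i 1 : VecL l)) continuous_const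
      (Bform_cont' l continuous_id continuous_id) (f := fun _ => 0) (by simp [hii])
    have e2 := ev_lt l (x := (2 : ℝ) • (Pi.single i 1 : VecL l))
      ((Bform_cont' l continuous_id (continuous_const (y := (Pi.single j 1 : VecL l)))).pow 2)
      ((Bform_cont' l continuous_id continuous_id).mul
        (continuous_const (y := Bform l (Pi.single j 1) (Pi.single j 1))))
      (by simp [hii, hjj, hij'])
    filter_upwards [e1, e2] with w h1 h2
    refine Hm_trans l (Bform_single_ne l j) (Hm_pos l h1 (by rw [hjj]; norm_num) h2) ?_
    exact Hm_pos l (by rw [hjj]; norm_num) (by rw [hii]; norm_num)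
      (by rw [hii, hjj, hji']; norm_num)
  · have hi0 : i ≠ 0 := fun h => hi (by simp [h])
    have hi1 : i ≠ 1 := fun h => hi (by simp [h])
    have hii := Bform_single l i i
    have h00 := Bform_single l 0 0
    have h11 := Bform_single l 1 1
    have hi0' := Bform_single l i 0
    have h0i' := Bform_single l 0 i
    have hi1' := Bform_single l i 1
    have h01' := Bform_single l 0 1
    simp [hi, hi0, hi0.symm, hi1] at hii h00 h11 hi0' h0i' hi1' h01'
    set c : VecL l := (2 : ℝ) • Pi.single i 1 + Pi.single 0 1 with hc
    have hcc : Bform l c c = -3 := by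
      simp [hc, hii, h00, hi0', h0i']; norm_num
    have cw : Continuous fun w => Bform l w c := Bform_cont' l continuous_id continuous_const
    have ww : Continuous fun w => Bform l w w := Bform_cont' l continuous_id continuous_id
    let p : VecL l → VecL l := fun w => Bform l w c • w - Bform l w w • c
    let q : VecL l → VecL l := fun w => Bform l w c • c - Bform l c c • w
    have hp : Continuous p := (cw.smul continuous_id).sub (ww.smul continuous_const)
    have hq : Continuous q := (cw.smul continuous_const).sub (continuous_const_smul (Bform l c c))
    set x : VecL l := (2 : ℝ) • (Pi.single i 1 : VecL l) with hx
    have hxx : Bform l x x = -4 := by simp [hx, hii]; norm_num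
    have hxc : Bform l x c = -4 := by simp [hx, hc, hii, hi0']; norm_num
    have hpx : p x = (4 : ℝ) • Pi.single 0 1 := by
      simp only [p, hxx, hxc]
      ext k; simp [hx, hc]
    have hqx : q x = (-2 : ℝ) • Pi.single i 1 + (-4 : ℝ) • Pi.single 0 1 := by
      simp only [q, hcc, hxc]
      ext k; simp [hx, hc]; ring
    have e1 := ev_lt l (x := x) ww continuous_const (g := fun _ => 0) (by simp [hxx])
    have e2 := ev_lt l (x := x) ((ww.mul (continuous_const (y := Bform l c c))).sub (cw.pow 2))
      continuous_const (g := fun _ => 0) (by simp [hxx, hxc, hcc]; norm_num)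
    have e3 := ev_lt l (x := x) continuous_const
      (Bform_cont' l hp hp) (f := fun _ => 0) (by simp [hpx, h00])
    have e4 := ev_lt l (x := x) continuous_const
      (Bform_cont' l hq hq) (f := fun _ => 0)
      (by simp [hqx, h00, hii, hi0', h0i']; norm_num)
    have e5 := ev_lt l (x := x)
      ((Bform_cont' l hp (continuous_const (y := (Pi.single 1 1 : VecL l)))).pow 2)
      ((Bform_cont' l hp hp).mul
        (continuous_const (y := Bform l (Pi.single 1 1) (Pi.single 1 1))))
      (by simp [hpx, h00, h11, h01'])
    have e6 := ev_lt l (x := x)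
      ((Bform_cont' l hq (continuous_const (y := (Pi.single 1 1 : VecL l)))).pow 2)
      ((Bform_cont' l hq hq).mul
        (continuous_const (y := Bform l (Pi.single 1 1) (Pi.single 1 1))))
      (by simp [hqx, h00, h11, h01', hi1', hii, hi0', h0i']; norm_num)
    have h11p : 0 < Bform l (Pi.single 1 1) (Pi.single 1 1) := by rw [h11]; norm_num
    have hcn : Bform l c c ≠ 0 := by rw [hcc]; norm_num
    have key : ∀ᶠ w in nhds x, rfl' l w * rfl' l c ∈ Hm l := by
      filter_upwards [e1, e2, e3, e4, e5, e6] with w h1 h2 h3 h4 h5 h6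
      rw [swap_refl l h1.ne hcn h2.ne]
      exact Hm_trans l h11p.ne' (Hm_pos l h3 h11p h5)
        (Hm_symm l h4.ne' h11p.ne' (Hm_pos l h4 h11p h6))
    have k0 := Hm_symm l (by rw [hxx]; norm_num) hcn key.self_of_nhds
    rw [hx, rfl'_smul l _ (by norm_num : (2 : ℝ) ≠ 0)] at k0
    filter_upwards [key] with w hw
    exact Hm_trans l hcn hw k0

set_option maxHeartbeats 1000000 in
lemma local_gen (l : ℕ) (d : ℕ) : d ≤ l + 2 → ∀ᶠ M in nhds (1 : MatL l),
    Mᵀ * etaMat l * M = etaMat l →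
    (∀ j : Fin (l + 2), (j : ℕ) < l + 2 - d → M *ᵥ Pi.single j 1 = Pi.single j 1) →
    M ∈ Hm l := by
  induction d with
  | zero =>
    intro _
    refine Filter.Eventually.of_forall fun M _ h => ?_
    have : M = 1 := Matrix.ext_of_mulVec_single fun i => by
      rw [h i (by simpa using i.2), one_mulVec]
    rw [this]
    exact one_mem _
  | succ d ih =>
    intro hd
    have ih := ih (by omega)
    let k : Fin (l + 2) := ⟨l + 2 - (d + 1), by omega⟩
    let e : VecL l := Pi.single k 1
    have hee : Bform l e e ≠ 0 := Bform_single_ne l k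
    let w : MatL l → VecL l := fun M => e + M *ᵥ e
    have hw : Continuous w := by fun_prop
    have hw1 : w 1 = (2 : ℝ) • e := by simp [w, two_smul]
    have hw1n : Bform l (w 1) (w 1) ≠ 0 := by rw [hw1]; simpa using hee
    have t1 : ∀ᶠ M in nhds (1 : MatL l), rfl' l (w M) * rfl' l e ∈ Hm l := by
      have := near l k
      have ht := hw.tendsto 1
      rw [hw1] at ht
      exact ht.eventually this
    have t2 : ∀ᶠ M in nhds (1 : MatL l), Bform l (w M) (w M) ≠ 0 := by
      have hc : Continuous fun M => Bform l (w M) (w M) := Bform_cont' l hw hw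
      exact hc.continuousAt.eventually_ne hw1n
    have hc : ContinuousAt (fun M => rfl' l e * rfl' l (w M) * M) 1 := by
      have : ContinuousAt (fun M => rfl' l (w M)) 1 :=
        ContinuousAt.comp' (rfl'_contAt l hw1n) hw.continuousAt
      exact (continuousAt_const.mul this).mul continuousAt_id
    have hv1 : rfl' l e * rfl' l (w 1) * 1 = 1 := by
      rw [hw1, rfl'_smul l e (by norm_num), rfl'_sq l hee, one_mul]
    have t3 := hc.tendsto
    simp only [hv1] at t3
    have t3 := t3.eventually ih
    filter_upwards [t1, t2, t3] with M h1 h2 h3 hM hfix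
    rw [isom_iff] at hM
    have hN : rfl' l e * rfl' l (w M) * M ∈ Hm l := by
      apply h3
      · rw [isom_iff]
        intro x y
        simp only [← mulVec_mulVec]
        rw [rfl'_isom l hee, rfl'_isom l h2, hM]
      · intro j hj
        simp only [← mulVec_mulVec]
        by_cases hjk : j = k
        · have h2' : Bform l (M *ᵥ e) (M *ᵥ e) = Bform l e e := hM e e
          have hh : rfl' l (w M) *ᵥ (M *ᵥ e) = - e := by
            rw [rfl'_mulVec]
            have : Bform l (w M) (w M) = 2 * Bform l (w M) (M *ᵥ e) := by
              simp [w, h2', Bform_comm l (M *ᵥ e) e]; ring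
            have h4 : 2 / Bform l (w M) (w M) * Bform l (w M) (M *ᵥ e) = 1 := by
              rw [this] at h2 ⊢
              have : Bform l (w M) (M *ᵥ e) ≠ 0 := fun h => h2 (by rw [h]; simp)
              field_simp
            rw [h4]
            simp [w]
          rw [hjk]
          change rfl' l e *ᵥ (rfl' l (w M) *ᵥ (M *ᵥ e)) = e
          rw [hh, rfl'_mulVec]
          ext i
          simp
          field_simp
          ring
        · have hjlt : (j : ℕ) < l + 2 - (d + 1) := by
            have : (j : ℕ) ≠ l + 2 - (d + 1) := fun h => hjk (Fin.ext h)
            omega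
          have hMj := hfix j hjlt
          have hej : Bform l e (Pi.single j 1) = 0 := by
            rw [Bform_single, if_neg (Ne.symm hjk)]
          have hMej : Bform l (M *ᵥ e) (Pi.single j 1) = 0 := by
            conv_lhs => rw [← hMj]
            rw [hM, hej]
          have hwj : Bform l (w M) (Pi.single j 1) = 0 := by
            simp only [w, map_add, LinearMap.add_apply, hej, hMej, add_zero]
          rw [hMj, rfl'_mulVec l (w M), hwj, mul_zero, zero_smul, sub_zero, rfl'_mulVec, hej,
            mul_zero, zero_smul, sub_zero]
    have := mul_mem h1 hN
    have e2 : rfl' l (w M) * rfl' l e * (rfl' l e * rfl' l (w M) * M) = M := by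
      calc _ = rfl' l (w M) * (rfl' l e * rfl' l e) * rfl' l (w M) * M := by
            simp only [mul_assoc]
        _ = M := by rw [rfl'_sq l hee, mul_one, rfl'_sq l h2, one_mul]
    rwa [e2] at this

/-- `SO(B)` as a subgroup. -/
def SOgrp (l : ℕ) : Subgroup (MatL l)ˣ where
  carrier := SOset l
  one_mem' := one_mem_SOset l
  mul_mem' := by
    rintro a b ⟨ha, ha'⟩ ⟨hb, hb'⟩
    rw [isom_iff] at ha hb
    refine ⟨?_, by simp [ha', hb']⟩
    rw [isom_iff]
    intro x y
    rw [Units.val_mul, ← mulVec_mulVec, ← mulVec_mulVec, ha, hb]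
  inv_mem' := by
    rintro a ⟨ha, ha'⟩
    rw [isom_iff] at ha
    have hinv : (a : MatL l) * (↑a⁻¹ : MatL l) = 1 := a.mul_inv
    refine ⟨?_, ?_⟩
    · rw [isom_iff]
      intro x y
      rw [← ha, mulVec_mulVec, mulVec_mulVec, hinv, one_mulVec, one_mulVec]
    · have := congrArg Matrix.det hinv
      rwa [det_mul, ha', one_mul, det_one] at this

lemma SOplus_eq (l : ℕ) : SOplus l =
    ((Subgroup.connectedComponentOfOne (SOgrp l)).map (SOgrp l).subtype : Set (MatL l)ˣ) := rfl

lemma closure_eq (l : ℕ) :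
    (Subgroup.closure (FixSet l) : Set (MatL l)ˣ) = SOplus l := by
  apply Set.Subset.antisymm
  · rw [SOplus_eq, SetLike.coe_subset_coe, Subgroup.closure_le, ← SOplus_eq]
    exact fun g hg => hg.1
  · rintro _ ⟨g, hg, rfl⟩
    let K : Subgroup (SOgrp l) := (Subgroup.closure (FixSet l)).comap (SOgrp l).subtype
    have hK : (K : Set (SOgrp l)) ∈ nhds 1 := by
      have hc : Continuous fun x : SOgrp l => ((x : (MatL l)ˣ) : MatL l) :=
        Units.continuous_val.comp continuous_subtype_val
      have ht := (hc.tendsto 1).eventually (local_gen l (l + 2) le_rfl)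
      filter_upwards [ht] with x hx
      obtain ⟨y, hy, hyx⟩ := hx x.2.1 (by intro j hj; omega)
      have : y = (x : (MatL l)ˣ) := Units.ext hyx
      rw [this] at hy
      exact hy
    have ho := K.isOpen_of_mem_nhds hK
    have hcl := K.isClosed_of_isOpen ho
    have : connectedComponent (1 : SOgrp l) ⊆ K :=
      IsClopen.connectedComponent_subset ⟨hcl, ho⟩ K.one_mem
    exact this hg

/-- The subgroup of `SO(B)` generated by the elements of `SO⁺(B)` fixing pointwise a
codimension-2 subspace with positive-definite orthogonal complement is exactly `SO⁺(B)`. -/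
theorem stmt6 (l : ℕ) (hl : 1 ≤ l) :
    (Subgroup.closure (FixSet l) :
      Set (Matrix (Fin (l + 2)) (Fin (l + 2)) ℝ)ˣ) = SOplus l := by
  exact closure_eq l

end
end

section
/- Let n ≥ 1, let W ⊆ ℝ^{2n} be a compact set that contains the origin in its interior and is starshaped with respect to the origin (t·x ∈ W whenever x ∈ W and t ∈ [0,1]), and let U be an open set containing W. Then there exists ε > 0 with the following property: for every smooth map f : ℝ^{2n} → ℝ^{2n} which is injective on W, satisfies ω₀(Df(x)u, Df(x)v) = ω₀(u, v) for every x ∈ W and all u, v ∈ ℝ^{2n} (i.e., f is a symplectic embedding of W), and satisfies sup_{x ∈ W} (‖f(x) − x‖ + ‖Df(x) − Id‖) < ε, there exists a smooth family (f_t)_{t ∈ [0,1]} of symplectic embeddings of W into U joining the inclusion to f: the map (t, x) ↦ f_t(x) is smooth on a neighborhood of [0,1] × W, f₀ is the inclusion of W, f₁ = f on W, and for every t ∈ [0,1] the map f_t is injective on W, maps W into U, and satisfies ω₀(Df_t(x)u, Df_t(x)v) = ω₀(u, v) for every x ∈ W and all u, v. -/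
noncomputable section

/-- The standard linear symplectic form `ω₀(u,v) = Σᵢ (u_{2i} v_{2i+1} − u_{2i+1} v_{2i})`
on `ℝ^{2n}` (0-based indexing of the coordinate pairs). -/
def omega0 (n : ℕ) (u v : EuclideanSpace ℝ (Fin (2 * n))) : ℝ :=
  ∑ i : Fin n,
    (u ⟨2 * (i : ℕ), by have := i.isLt; omega⟩ * v ⟨2 * (i : ℕ) + 1, by have := i.isLt; omega⟩ -
      u ⟨2 * (i : ℕ) + 1, by have := i.isLt; omega⟩ * v ⟨2 * (i : ℕ), by have := i.isLt; omega⟩)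


lemma contDiff_param_aux {H : Type} [NormedAddCommGroup H] [NormedSpace ℝ H]
    [FiniteDimensional ℝ H] (k : ℕ) :
    ∀ {E : Type} [NormedAddCommGroup E] [NormedSpace ℝ E] [CompleteSpace E]
      (Ψ : H × ℝ → E), ContDiff ℝ (⊤ : ℕ∞) Ψ →
      ContDiff ℝ k (fun x => ∫ r in (0 : ℝ)..1, Ψ (x, r)) := by
  induction k with
  | zero =>
    intro E _ _ _ Ψ hΨ
    refine contDiff_zero.2 ?_
    apply intervalIntegral.continuous_parametric_intervalIntegral_of_continuous'
    exact hΨ.continuous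
  | succ k ih =>
    intro E _ _ _ Ψ hΨ
    have : ProperSpace H := FiniteDimensional.proper ℝ H
    let Ψ' : H × ℝ → H →L[ℝ] E := fun p =>
      (fderiv ℝ Ψ p).comp (ContinuousLinearMap.inl ℝ H ℝ)
    have hΨ' : ContDiff ℝ (⊤ : ℕ∞) Ψ' := by
      have h1 : ContDiff ℝ (⊤ : ℕ∞) (fderiv ℝ Ψ) :=
        hΨ.fderiv_right (by exact_mod_cast le_top)
      exact h1.clm_comp contDiff_const
    refine contDiff_succ_iff_hasFDerivAt.2 ⟨fun x => ∫ r in (0 : ℝ)..1, Ψ' (x, r), ih Ψ' hΨ', ?_⟩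
    intro x
    obtain ⟨C, hC⟩ := ((isCompact_closedBall x 1).prod (isCompact_Icc (a := (0 : ℝ)) (b := 1))).exists_bound_of_continuousOn
      hΨ'.continuous.continuousOn
    refine intervalIntegral.hasFDerivAt_integral_of_dominated_of_fderiv_le
      (F := fun x r => Ψ (x, r)) (F' := fun x r => Ψ' (x, r)) (bound := fun _ => C)
      (Metric.closedBall_mem_nhds x one_pos) ?_ ?_ ?_ ?_ ?_ ?_
    · refine Filter.Eventually.of_forall fun y => ?_
      exact (hΨ.continuous.comp (by fun_prop)).aestronglyMeasurable
    · exact (hΨ.continuous.comp (by fun_prop)).intervalIntegrable _ _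
    · exact (hΨ'.continuous.comp (by fun_prop)).aestronglyMeasurable
    · refine Filter.Eventually.of_forall fun r hr y hy => ?_
      rw [Set.uIoc_of_le zero_le_one] at hr
      exact hC (y, r) ⟨hy, hr.1.le, hr.2⟩
    · exact intervalIntegrable_const
    · refine Filter.Eventually.of_forall fun r hr y hy => ?_
      have h1 : HasFDerivAt Ψ (fderiv ℝ Ψ (y, r)) (y, r) :=
        (hΨ.differentiable (by simp) _).hasFDerivAt
      exact h1.comp y (hasFDerivAt_prodMk_left y r)

lemma contDiff_param {H : Type} [NormedAddCommGroup H] [NormedSpace ℝ H]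
    [FiniteDimensional ℝ H] {E : Type} [NormedAddCommGroup E] [NormedSpace ℝ E] [CompleteSpace E]
    (Ψ : H × ℝ → E) (hΨ : ContDiff ℝ (⊤ : ℕ∞) Ψ) :
    ContDiff ℝ (⊤ : ℕ∞) (fun x => ∫ r in (0 : ℝ)..1, Ψ (x, r)) :=
  contDiff_infty.2 fun k => contDiff_param_aux k Ψ hΨ

/-- `omega0` as a bilinear map. -/
def omegaL (n : ℕ) : EuclideanSpace ℝ (Fin (2 * n)) →ₗ[ℝ] EuclideanSpace ℝ (Fin (2 * n)) →ₗ[ℝ] ℝ :=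
  LinearMap.mk₂ ℝ (omega0 n)
    (by intro a b c; simp only [omega0, PiLp.add_apply, ← Finset.sum_add_distrib]
        exact Finset.sum_congr rfl fun i _ => by ring)
    (by intro a b c; simp only [omega0, PiLp.smul_apply, smul_eq_mul, Finset.mul_sum]
        exact Finset.sum_congr rfl fun i _ => by ring)
    (by intro a b c; simp only [omega0, PiLp.add_apply, ← Finset.sum_add_distrib]
        exact Finset.sum_congr rfl fun i _ => by ring)
    (by intro a b c; simp only [omega0, PiLp.smul_apply, smul_eq_mul, Finset.mul_sum]
        exact Finset.sum_congr rfl fun i _ => by ring)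

lemma omegaL_apply (n : ℕ) (u v : EuclideanSpace ℝ (Fin (2 * n))) :
    omegaL n u v = omega0 n u v := rfl

lemma isUnit_one_add {R : Type*} [NormedRing R] [CompleteSpace R] (Y : R) (hY : ‖Y‖ < 1) :
    IsUnit (1 + Y) := by
  have := isUnit_one_sub_of_norm_lt_one (x := -Y) (by rwa [norm_neg])
  rwa [sub_neg_eq_add] at this

/-- Cayley path from `A⁻¹` to the identity, preserving a bilinear form. -/
lemma cayley_path {E : Type} [NormedAddCommGroup E] [NormedSpace ℝ E] [CompleteSpace E]
    [Nontrivial E]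
    (ω : E →ₗ[ℝ] E →ₗ[ℝ] ℝ) (A : E →L[ℝ] E) (ε : ℝ) (hε : ε ≤ 1 / 4)
    (hA : ∀ u v, ω (A u) (A v) = ω u v) (hAε : ‖A - 1‖ < ε) :
    ∃ B : ℝ → (E →L[ℝ] E), ContDiffOn ℝ (⊤ : ℕ∞) B (Set.Ioo (-1) 2) ∧ B 0 * A = 1 ∧ B 1 = 1 ∧
      ∀ t ∈ Set.Icc (0 : ℝ) 1, (∀ u v, ω (B t u) (B t v) = ω u v) ∧ ‖B t - 1‖ ≤ 4 * ε ∧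
        Function.Injective (B t) := by
  have hε0 : 0 < ε := lt_of_le_of_lt (norm_nonneg _) hAε
  have hu : IsUnit (A + 1) := by
    have h1 : IsUnit (1 + (1 / 2 : ℝ) • (A - 1)) := by
      apply isUnit_one_add
      rw [norm_smul]
      norm_num
      linarith
    have h2 : A + 1 = (algebraMap ℝ (E →L[ℝ] E) 2) * (1 + (1 / 2 : ℝ) • (A - 1)) := by
      rw [← Algebra.smul_def, smul_add, smul_smul]
      norm_num
      rw [two_smul]
      abel
    rw [h2]
    exact ((isUnit_iff_ne_zero.2 (by norm_num : (2 : ℝ) ≠ 0)).map _).mul h1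
  obtain ⟨P, hP⟩ := hu
  set Q : E →L[ℝ] E := ↑P⁻¹ with hQ
  have hPQ : (A + 1) * Q = 1 := by rw [← hP]; exact P.mul_inv
  have hQP : Q * (A + 1) = 1 := by rw [← hP]; exact P.inv_mul
  have hcA : Q * A = A * Q := by
    have : Q * (A + 1) = (A + 1) * Q := by rw [hPQ, hQP]
    rw [mul_add, add_mul] at this
    simpa using this
  set X := (A - 1) * Q with hX
  have hX1 : X * (A + 1) = A - 1 := by rw [hX, mul_assoc, hQP, mul_one]
  have hXA : X * A = A * X := by
    rw [hX, mul_assoc, hcA, ← mul_assoc, ← mul_assoc]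
    congr 1
    noncomm_ring
  have hXn : ‖X‖ ≤ ε := by
    have h1 : (2 : ℝ) • X = (A - 1) - X * (A - 1) := by
      rw [two_smul]
      have : X * (A + 1) = X * (A - 1) + (X + X) := by noncomm_ring
      exact eq_sub_of_add_eq' (this.symm.trans hX1)
    have h2 : ‖(2 : ℝ) • X‖ ≤ ‖A - 1‖ + ‖X‖ * ‖A - 1‖ := by
      rw [h1]
      exact (norm_sub_le _ _).trans (add_le_add le_rfl (norm_mul_le _ _))
    rw [norm_smul] at h2
    norm_num at h2
    nlinarith [norm_nonneg X, norm_nonneg (A - 1)]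
  have hskew : ∀ u v, ω (X u) v + ω u (X v) = 0 := by
    intro u v
    have e : ∀ w, w = (A + 1) (Q w) := fun w => by
      have := congrArg (fun T : E →L[ℝ] E => T w) hPQ
      simpa using this.symm
    have e2 : ∀ w, X w = A (Q w) - Q w := fun w => by simp [hX]
    have h1 : ω u (X v) = ω ((A + 1) (Q u)) (X v) := by rw [← e u]
    have h2 : ω (X u) v = ω (X u) ((A + 1) (Q v)) := by rw [← e v]
    rw [h1, h2, e2, e2]
    simp [hA]
    ring
  let Y : ℝ → (E →L[ℝ] E) := fun t => (1 - t) • X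
  have hYn : ∀ t ∈ Set.Ioo (-1 : ℝ) 2, ‖Y t‖ ≤ 1 / 2 := by
    intro t ht
    simp only [Y, norm_smul, Real.norm_eq_abs]
    have : |1 - t| ≤ 2 := abs_le.2 ⟨by linarith [ht.2], by linarith [ht.1]⟩
    nlinarith [norm_nonneg X]
  have hYu : ∀ t ∈ Set.Ioo (-1 : ℝ) 2, IsUnit (1 + Y t) := fun t ht =>
    isUnit_one_add _ (by linarith [hYn t ht])
  have hYd : ContDiff ℝ (⊤ : ℕ∞) Y := by fun_prop
  refine ⟨fun t => (1 - Y t) * Ring.inverse (1 + Y t), ?_, ?_, ?_, ?_⟩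
  · intro t ht
    obtain ⟨p, hp⟩ := hYu t ht
    have h1 : ContDiffAt ℝ (⊤ : ℕ∞) (Ring.inverse : (E →L[ℝ] E) → (E →L[ℝ] E)) (1 + Y t) := by
      rw [← hp]; exact contDiffAt_ringInverse ℝ p
    have h2 : ContDiffAt ℝ (⊤ : ℕ∞) (fun s => Ring.inverse (1 + Y s)) t :=
      ContDiffAt.comp (f := fun s => 1 + Y s) t h1 (contDiff_const.add hYd).contDiffAt
    exact ((contDiff_const.sub hYd).contDiffAt.mul h2).contDiffWithinAt
  · have hY0 : Y 0 = X := by simp [Y]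
    have hu0 := hYu 0 (by norm_num)
    simp only [hY0] at hu0 ⊢
    have h1 : 1 + X = A * (1 - X) := by
      have h3 : X * A + X = A - 1 := by rw [← hX1]; noncomm_ring
      have h4 : A = X * A + X + 1 := by rw [h3]; abel
      rw [mul_sub, mul_one, ← hXA]
      nth_rewrite 1 [h4]
      abel
    have h2 : A * (1 - X) = (1 - X) * A := by
      rw [mul_sub, sub_mul, hXA]; simp
    have h5 : (1 - X) * Ring.inverse (1 + X) = Ring.inverse (1 + X) * (1 - X) := by
      have hc : (1 + X) * (1 - X) = (1 - X) * (1 + X) := by noncomm_ring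
      calc (1 - X) * Ring.inverse (1 + X)
          = Ring.inverse (1 + X) * (1 + X) * ((1 - X) * Ring.inverse (1 + X)) := by
            rw [Ring.inverse_mul_cancel _ hu0, one_mul]
        _ = Ring.inverse (1 + X) * ((1 + X) * (1 - X)) * Ring.inverse (1 + X) := by
            simp only [mul_assoc]
        _ = Ring.inverse (1 + X) * (1 - X) * ((1 + X) * Ring.inverse (1 + X)) := by
            rw [hc]; simp only [mul_assoc]
        _ = _ := by rw [Ring.mul_inverse_cancel _ hu0, mul_one]
    rw [h5, mul_assoc, ← h2, ← h1, Ring.inverse_mul_cancel _ hu0]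
  · simp [Y]
  · intro t ht
    have ht' : t ∈ Set.Ioo (-1 : ℝ) 2 := ⟨by linarith [ht.1], by linarith [ht.2]⟩
    have hut := hYu t ht'
    have hYε : ‖Y t‖ ≤ ε := by
      simp only [Y, norm_smul, Real.norm_eq_abs]
      have : |1 - t| ≤ 1 := abs_le.2 ⟨by linarith [ht.2], by linarith [ht.1]⟩
      nlinarith [norm_nonneg X]
    have hYs : ∀ u v, ω (Y t u) v + ω u (Y t v) = 0 := by
      intro u v
      have := hskew u v
      simp only [Y, ContinuousLinearMap.smul_apply, map_smul, LinearMap.smul_apply, smul_eq_mul]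
      rw [← mul_add, this, mul_zero]
    set R := Ring.inverse (1 + Y t) with hR
    have hRm : (1 + Y t) * R = 1 := Ring.mul_inverse_cancel _ hut
    have hRm' : R * (1 + Y t) = 1 := Ring.inverse_mul_cancel _ hut
    refine ⟨?_, ?_, ?_⟩
    · intro u v
      have e : ∀ w, w = R w + Y t (R w) := fun w => by
        have := congrArg (fun T : E →L[ℝ] E => T w) hRm
        simpa using this.symm
      have h1 : ω u v = ω (R u + Y t (R u)) (R v + Y t (R v)) := by rw [← e u, ← e v]
      rw [h1]
      have := hYs (R u) (R v)
      simp
      linarith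
    · change ‖(1 - Y t) * R - 1‖ ≤ 4 * ε
      set D := (1 - Y t) * R - 1 with hD
      have h1 : D = -((2 : ℝ) • Y t) - D * Y t := by
        have h3 : D * (1 + Y t) = -((2 : ℝ) • Y t) := by
          rw [hD, sub_mul, mul_assoc, hRm', two_smul]; noncomm_ring
        rw [← h3]; noncomm_ring
      have h2 : ‖D‖ ≤ 2 * ‖Y t‖ + ‖D‖ * ‖Y t‖ := by
        calc ‖D‖ = ‖-((2 : ℝ) • Y t) - D * Y t‖ := by rw [← h1]
          _ ≤ ‖-((2 : ℝ) • Y t)‖ + ‖D * Y t‖ := norm_sub_le _ _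
          _ ≤ _ := by
            refine add_le_add ?_ (norm_mul_le _ _)
            rw [norm_neg, norm_smul]; norm_num
      nlinarith [norm_nonneg D, norm_nonneg (Y t), hYn t ht']
    · have h1 : IsUnit ((1 - Y t) * R) := by
        refine IsUnit.mul ?_ ?_
        · exact isUnit_one_sub_of_norm_lt_one (by linarith [hYn t ht'])
        · exact hut.ringInverse
      obtain ⟨p, hp⟩ := h1
      have hl : (↑p⁻¹ : E →L[ℝ] E) * ((1 - Y t) * R) = 1 := by rw [← hp]; exact p.inv_mul
      intro a b hab
      have h := congrArg (↑p⁻¹ : E →L[ℝ] E) hab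
      have e : ∀ w, (↑p⁻¹ : E →L[ℝ] E) (((1 - Y t) * R) w) = w := fun w => by
        have := congrArg (fun T : E →L[ℝ] E => T w) hl
        simpa using this
      exact (e a).symm.trans (h.trans (e b))

/-- Smooth Alexander rescaling. -/
def alexG {E : Type} [NormedAddCommGroup E] [NormedSpace ℝ E] (f : E → E) (p : ℝ × E) : E :=
  ∫ r in (0 : ℝ)..1, fderiv ℝ f ((r * p.1) • p.2) p.2

lemma alexG_contDiff {E : Type} [NormedAddCommGroup E] [NormedSpace ℝ E] [FiniteDimensional ℝ E]
    {f : E → E} (hf : ContDiff ℝ (⊤ : ℕ∞) f) : ContDiff ℝ (⊤ : ℕ∞) (alexG f) := by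
  have : CompleteSpace E := FiniteDimensional.complete ℝ E
  have h1 : ContDiff ℝ (⊤ : ℕ∞) (fderiv ℝ f) := hf.fderiv_right (by exact_mod_cast le_top)
  refine contDiff_param (H := ℝ × E)
    (fun q : (ℝ × E) × ℝ => fderiv ℝ f ((q.2 * q.1.1) • q.1.2) q.1.2) ?_
  exact (h1.comp (by fun_prop)).clm_apply (by fun_prop)

lemma alexG_zero {E : Type} [NormedAddCommGroup E] [NormedSpace ℝ E] [FiniteDimensional ℝ E]
    (f : E → E) (x : E) : alexG f (0, x) = fderiv ℝ f 0 x := by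
  have : CompleteSpace E := FiniteDimensional.complete ℝ E
  simp [alexG]

lemma alexG_smul {E : Type} [NormedAddCommGroup E] [NormedSpace ℝ E] [FiniteDimensional ℝ E]
    {f : E → E} (hf : ContDiff ℝ (⊤ : ℕ∞) f) (t : ℝ) (x : E) :
    t • alexG f (t, x) = f (t • x) - f 0 := by
  have : CompleteSpace E := FiniteDimensional.complete ℝ E
  have h1 : ContDiff ℝ (⊤ : ℕ∞) (fderiv ℝ f) := hf.fderiv_right (by exact_mod_cast le_top)
  have hd : ∀ r : ℝ, HasDerivAt (fun r : ℝ => f ((r * t) • x))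
      (t • fderiv ℝ f ((r * t) • x) x) r := by
    intro r
    have h2 : HasFDerivAt f (fderiv ℝ f ((r * t) • x)) ((r * t) • x) :=
      (hf.differentiable (by simp) _).hasFDerivAt
    have h3 : HasDerivAt (fun r : ℝ => (r * t) • x) (t • x) r := by
      have := ((hasDerivAt_id r).mul_const t).smul_const x
      simpa using this
    have := h2.comp_hasDerivAt r h3
    rw [map_smul] at this
    exact this
  have h4 := intervalIntegral.integral_eq_sub_of_hasDerivAt (a := 0) (b := 1)
    (fun r _ => hd r) (Continuous.intervalIntegrable (by
      have := h1.continuous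
      fun_prop) _ _)
  rw [intervalIntegral.integral_smul] at h4
  simpa [alexG] using h4

lemma alexG_hasFDerivAt {E : Type} [NormedAddCommGroup E] [NormedSpace ℝ E]
    [FiniteDimensional ℝ E]
    {f : E → E} (hf : ContDiff ℝ (⊤ : ℕ∞) f) (t : ℝ) (x : E) :
    HasFDerivAt (fun y => alexG f (t, y)) (fderiv ℝ f (t • x)) x := by
  rcases eq_or_ne t 0 with rfl | ht
  · have : (fun y => alexG f (0, y)) = fun y => fderiv ℝ f 0 y := funext fun y => alexG_zero f y
    rw [this, zero_smul]
    exact (fderiv ℝ f 0).hasFDerivAt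
  · have : (fun y => alexG f (t, y)) = fun y => t⁻¹ • (f (t • y) - f 0) := by
      funext y
      rw [← alexG_smul hf, smul_smul, inv_mul_cancel₀ ht, one_smul]
    rw [this]
    have h2 : HasFDerivAt f (fderiv ℝ f (t • x)) (t • x) :=
      (hf.differentiable (by simp) _).hasFDerivAt
    have h3 : HasFDerivAt (fun y : E => t • y) (t • ContinuousLinearMap.id ℝ E) x :=
      (hasFDerivAt_id x).const_smul t
    have h4 := ((h2.comp x h3).sub_const (f 0)).const_smul t⁻¹
    have h5 : fderiv ℝ f (t • x) =
        t⁻¹ • (fderiv ℝ f (t • x)).comp (t • ContinuousLinearMap.id ℝ E) := by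
      ext v
      simp [smul_smul, inv_mul_cancel₀ ht]
    rw [h5]
    exact h4

lemma alexG_norm {E : Type} [NormedAddCommGroup E] [NormedSpace ℝ E]
    [FiniteDimensional ℝ E]
    {f : E → E} (hf : ContDiff ℝ (⊤ : ℕ∞) f) (t : ℝ) (ht : t ∈ Set.Icc (0 : ℝ) 1) (x : E) (ε : ℝ)
    (h : ∀ s ∈ Set.Icc (0 : ℝ) 1, ‖fderiv ℝ f (s • x) - ContinuousLinearMap.id ℝ E‖ ≤ ε) :
    ‖alexG f (t, x) - x‖ ≤ ε * ‖x‖ := by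
  have : CompleteSpace E := FiniteDimensional.complete ℝ E
  have h1 : ContDiff ℝ (⊤ : ℕ∞) (fderiv ℝ f) := hf.fderiv_right (by exact_mod_cast le_top)
  have e : alexG f (t, x) - x =
      ∫ r in (0 : ℝ)..1, (fderiv ℝ f ((r * t) • x) x - x) := by
    rw [intervalIntegral.integral_sub]
    · simp [alexG]
    · refine Continuous.intervalIntegrable ?_ _ _
      have := h1.continuous
      fun_prop
    · exact intervalIntegrable_const
  rw [e]
  have := intervalIntegral.norm_integral_le_of_norm_le_const (a := 0) (b := 1) (C := ε * ‖x‖)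
    (f := fun r => fderiv ℝ f ((r * t) • x) x - x) (by
      intro r hr
      rw [Set.uIoc_of_le zero_le_one] at hr
      have h2 := h (r * t) ⟨mul_nonneg hr.1.le ht.1, mul_le_one₀ hr.2 ht.1 ht.2⟩
      have h3 := (fderiv ℝ f ((r * t) • x) - ContinuousLinearMap.id ℝ E).le_opNorm x
      simp only [ContinuousLinearMap.sub_apply, ContinuousLinearMap.id_apply] at h3
      exact h3.trans (mul_le_mul_of_nonneg_right h2 (norm_nonneg _)))
  simpa using this

/-- Alexander's trick for symplectic embeddings: if `W ⊆ ℝ^{2n}` is compact, starshaped with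
respect to the origin (which lies in its interior), and `U ⊇ W` is open, then every smooth
symplectic embedding of `W`, sufficiently `C¹`-close to the inclusion, can be joined to the
inclusion by a smooth family of symplectic embeddings of `W` into `U`. -/
theorem stmt7 (n : ℕ) (hn : 1 ≤ n) (W U : Set (EuclideanSpace ℝ (Fin (2 * n))))
    (hWc : IsCompact W) (hW0 : 0 ∈ interior W)
    (hstar : ∀ x ∈ W, ∀ t : ℝ, t ∈ Set.Icc (0 : ℝ) 1 → t • x ∈ W)
    (hU : IsOpen U) (hWU : W ⊆ U) :
    ∃ ε > (0 : ℝ), ∀ f : EuclideanSpace ℝ (Fin (2 * n)) → EuclideanSpace ℝ (Fin (2 * n)),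
      ContDiff ℝ (⊤ : ℕ∞) f →
      Set.InjOn f W →
      (∀ x ∈ W, ∀ u v, omega0 n (fderiv ℝ f x u) (fderiv ℝ f x v) = omega0 n u v) →
      (∀ x ∈ W, ‖f x - x‖ +
        ‖fderiv ℝ f x - ContinuousLinearMap.id ℝ (EuclideanSpace ℝ (Fin (2 * n)))‖ < ε) →
      ∃ (V : Set (ℝ × EuclideanSpace ℝ (Fin (2 * n))))
        (F : ℝ × EuclideanSpace ℝ (Fin (2 * n)) → EuclideanSpace ℝ (Fin (2 * n))),
        IsOpen V ∧ Set.Icc (0 : ℝ) 1 ×ˢ W ⊆ V ∧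
        ContDiffOn ℝ (⊤ : ℕ∞) F V ∧
        (∀ x ∈ W, F (0, x) = x) ∧
        (∀ x ∈ W, F (1, x) = f x) ∧
        (∀ t ∈ Set.Icc (0 : ℝ) 1,
          Set.InjOn (fun x => F (t, x)) W ∧
          Set.MapsTo (fun x => F (t, x)) W U ∧
          (∀ x ∈ W, ∀ u v,
            omega0 n (fderiv ℝ (fun y => F (t, y)) x u) (fderiv ℝ (fun y => F (t, y)) x v)
              = omega0 n u v)) := by
  obtain ⟨δ, hδ, hδU⟩ := hWc.exists_thickening_subset_open hU hWU
  obtain ⟨M, hM⟩ := hWc.isBounded.exists_norm_le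
  have h0W : (0 : EuclideanSpace ℝ (Fin (2 * n))) ∈ W := interior_subset hW0
  have hM0 : 0 ≤ M := (norm_nonneg _).trans (hM 0 h0W)
  have hKpos : 0 < 9 * M + 1 := by linarith
  refine ⟨min (1 / 4) (δ / (9 * M + 1)), lt_min (by norm_num) (by positivity), ?_⟩
  set ε := min (1 / 4 : ℝ) (δ / (9 * M + 1)) with hε
  have hε4 : ε ≤ 1 / 4 := min_le_left _ _
  have hεδ : ε * (9 * M + 1) ≤ δ := by
    have : ε ≤ δ / (9 * M + 1) := min_le_right _ _
    rwa [le_div_iff₀ hKpos] at this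
  intro f hf hinj hsymp hclose
  have hcl1 : ∀ x ∈ W, ‖f x - x‖ < ε := fun x hx =>
    lt_of_le_of_lt (le_add_of_nonneg_right (norm_nonneg _)) (hclose x hx)
  have hcl2 : ∀ x ∈ W, ‖fderiv ℝ f x -
      ContinuousLinearMap.id ℝ (EuclideanSpace ℝ (Fin (2 * n)))‖ < ε := fun x hx =>
    lt_of_le_of_lt (le_add_of_nonneg_left (norm_nonneg _)) (hclose x hx)
  have hε0 : 0 < ε := (norm_nonneg _).trans_lt (hcl1 0 h0W)
  have : Nonempty (Fin (2 * n)) := ⟨⟨0, by omega⟩⟩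
  obtain ⟨B, hBd, hB0, hB1, hB⟩ := cayley_path (omegaL n) (fderiv ℝ f 0) ε hε4
    (fun u v => hsymp 0 h0W u v) (hcl2 0 h0W)
  have hstart : ∀ x, B 0 (alexG f (0, x)) + (0 : ℝ) • f 0 = x := by
    intro x
    rw [alexG_zero, zero_smul, add_zero]
    have := congrArg (fun T : EuclideanSpace ℝ (Fin (2 * n)) →L[ℝ] _ => T x) hB0
    simpa using this
  refine ⟨Set.Ioo (-1) 2 ×ˢ Set.univ, fun p => B p.1 (alexG f p) + p.1 • f 0,
    isOpen_Ioo.prod isOpen_univ, ?_, ?_, ?_, ?_, ?_⟩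
  · rintro ⟨t, x⟩ ⟨ht, _⟩
    exact ⟨⟨by linarith [ht.1], by linarith [ht.2]⟩, trivial⟩
  · refine ContDiffOn.add ?_ (ContDiff.contDiffOn (by fun_prop))
    exact (hBd.comp contDiff_fst.contDiffOn (fun p hp => hp.1)).clm_apply
      (alexG_contDiff hf).contDiffOn
  · intro x _
    exact hstart x
  · intro x _
    have := alexG_smul hf 1 x
    simp only [one_smul] at this
    simp [hB1, this]
  · intro t ht
    obtain ⟨hBs, hBn, hBi⟩ := hB t ht
    refine ⟨?_, ?_, ?_⟩
    · intro x hx y hy hxy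
      have hxy' : alexG f (t, x) = alexG f (t, y) := hBi (add_right_cancel hxy)
      rcases eq_or_ne t 0 with rfl | ht0
      · rw [← hstart x, ← hstart y, hxy']
      · have h1 : f (t • x) - f 0 = f (t • y) - f 0 := by
          rw [← alexG_smul hf, ← alexG_smul hf, hxy']
        have h2 := hinj (hstar x hx t ht) (hstar y hy t ht) (sub_left_injective h1)
        exact smul_right_injective _ ht0 h2
    · intro x hx
      refine hδU (Metric.mem_thickening_iff.2 ⟨x, hx, ?_⟩)
      rw [dist_eq_norm]
      have h1 := alexG_norm hf t ht x ε (fun s hs => (hcl2 _ (hstar x hx s hs)).le)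
      have hxM := hM x hx
      set g := alexG f (t, x) with hg
      have h2 : ‖g‖ ≤ 2 * M := by
        have : ‖g‖ ≤ ‖g - x‖ + ‖x‖ := by simpa using norm_add_le (g - x) x
        nlinarith [norm_nonneg x]
      have h3 : ‖(B t - 1) g‖ ≤ 4 * ε * (2 * M) :=
        ((B t - 1).le_opNorm g).trans (mul_le_mul hBn h2 (norm_nonneg _) (by positivity))
      have h4 : ‖t • f 0‖ < ε := by
        rw [norm_smul, Real.norm_eq_abs, abs_of_nonneg ht.1]
        have := hcl1 0 h0W
        rw [sub_zero] at this
        nlinarith [ht.1, ht.2, norm_nonneg (f 0)]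
      have h5 : B t g + t • f 0 - x = (B t - 1) g + (g - x) + t • f 0 := by
        simp only [ContinuousLinearMap.sub_apply, ContinuousLinearMap.one_apply]
        abel
      change ‖B t g + t • f 0 - x‖ < δ
      rw [h5]
      have h6 := norm_add₃_le (a := (B t - 1) g) (b := g - x) (c := t • f 0)
      nlinarith [mul_le_mul_of_nonneg_left hxM hε0.le]
    · intro x hx u v
      have hd : HasFDerivAt (fun y => B t (alexG f (t, y)) + t • f 0)
          ((B t).comp (fderiv ℝ f (t • x))) x :=
        ((B t).hasFDerivAt.comp x (alexG_hasFDerivAt hf t x)).add_const _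
      have hd' := hd.fderiv
      simp only at hd' ⊢
      rw [hd']
      exact (hBs _ _).trans (hsymp _ (hstar x hx t ht) u v)

end
end

section
/- Let n ≥ 1 and let W ⊆ ℂⁿ be a compact set that contains the origin in its interior and is starshaped with respect to the origin (t·z ∈ W whenever z ∈ W and t ∈ [0,1]). Let f be a holomorphic embedding of W into ℂⁿ with f(0) = 0 and f(W) ⊆ W; concretely, f is holomorphic and injective on some open set containing W. Then f can be joined to the inclusion by a family of holomorphic embeddings of W into W fixing the origin: there exists F : [0,1] × W → ℂⁿ, jointly continuous (and smooth in the parameter t), such that F(0, ·) is the inclusion of W, F(1, ·) = f on W, and for every t ∈ [0,1]: F(t, ·) extends to a map that is holomorphic and injective on some open set containing W, F(t, 0) = 0, and F(t, W) ⊆ W. -/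
noncomputable section

section Helpers

open Set Metric Topology Filter MeasureTheory

theorem osg_fderiv_apply {E F : Type*} [NormedAddCommGroup E] [NormedSpace ℂ E] [FiniteDimensional ℂ E]
    [NormedAddCommGroup F] [NormedSpace ℂ F] [FiniteDimensional ℂ F]
    {U : Set E} (hU : IsOpen U) {f : E → F} (hf : DifferentiableOn ℂ f U) (v : E) :
    DifferentiableOn ℂ (fun z => fderiv ℂ f z v) U := by
  intro z0 hz0
  apply DifferentiableAt.differentiableWithinAt
  have : CompleteSpace F := FiniteDimensional.complete ℂ F
  have hfc : ContinuousAt f z0 := (hf.differentiableAt (hU.mem_nhds hz0)).continuousAt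
  obtain ⟨R, hR, hRU⟩ : ∃ R > 0, ball z0 (3 * R) ⊆ U ∩ f ⁻¹' (ball (f z0) 1) := by
    obtain ⟨R, hR, h⟩ := Metric.mem_nhds_iff.1
      (Filter.inter_mem (hU.mem_nhds hz0) (hfc.preimage_mem_nhds (ball_mem_nhds _ one_pos)))
    exact ⟨R / 3, by positivity, by rwa [show 3 * (R / 3) = R by ring]⟩
  have hbd : ∀ x ∈ ball z0 (2 * R), ‖fderiv ℂ f x‖ ≤ 2 / R := by
    intro x hx
    have hsub : ball x R ⊆ ball z0 (3 * R) := by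
      apply ball_subset_ball'
      rw [mem_ball] at hx
      linarith
    apply Complex.norm_fderiv_le_div_of_mapsTo_ball _ _ hR
    · exact hf.mono (hsub.trans (hRU.trans inter_subset_left))
    · intro y hy
      have h1 := (hRU (hsub hy)).2
      have h2 := (hRU (hsub (mem_ball_self hR))).2
      simp only [mem_preimage, mem_ball, mem_closedBall] at h1 h2 ⊢
      have := dist_triangle_right (f y) (f x) (f z0)
      linarith
  obtain ⟨r, hr, hrv⟩ : ∃ r : ℝ, 0 < r ∧ r * ‖v‖ < R := by
    refine ⟨R / (‖v‖ + 1), by positivity, ?_⟩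
    rw [div_mul_eq_mul_div, div_lt_iff₀ (by positivity)]
    nlinarith [norm_nonneg v]
  have hmem : ∀ x ∈ ball z0 R, ∀ ζ ∈ closedBall (0 : ℂ) r, x + ζ • v ∈ ball z0 (2 * R) := by
    intro x hx ζ hζ
    rw [mem_ball, dist_eq_norm] at *
    rw [mem_closedBall, dist_zero_right] at hζ
    have h1 : ‖x + ζ • v - z0‖ ≤ ‖x - z0‖ + ‖ζ • v‖ := by
      rw [add_sub_right_comm]; exact norm_add_le _ _
    rw [norm_smul] at h1
    nlinarith [norm_nonneg v]
  have h2U : ball z0 (2 * R) ⊆ U :=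
    (ball_subset_ball (by linarith)).trans (hRU.trans inter_subset_left)
  have hfd : ∀ x ∈ ball z0 (2 * R), DifferentiableAt ℂ f x := fun x hx =>
    hf.differentiableAt (hU.mem_nhds (h2U hx))
  have hc : ∀ θ : ℝ, circleMap 0 r θ ∈ closedBall (0 : ℂ) r :=
    fun θ => circleMap_mem_closedBall _ hr.le θ
  -- Cauchy formula
  have hcauchy : ∀ x ∈ ball z0 R, fderiv ℂ f x v =
      (2 * Real.pi * Complex.I : ℂ)⁻¹ • ∮ ζ in C(0, r), ((ζ - 0) ^ 2)⁻¹ • f (x + ζ • v) := by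
    intro x hx
    have hop : IsOpen ((fun ζ : ℂ => x + ζ • v) ⁻¹' (ball z0 (2 * R))) :=
      isOpen_ball.preimage (by fun_prop)
    rw [Complex.two_pi_I_inv_smul_circleIntegral_sub_sq_inv_smul_of_differentiable hop
      (fun ζ hζ => hmem x hx ζ hζ) (f := fun ζ => f (x + ζ • v)) _ (mem_ball_self hr)]
    · have h1 : HasDerivAt (fun ζ : ℂ => x + ζ • v) v 0 := by
        simpa using ((hasDerivAt_id (0 : ℂ)).smul_const v).const_add x
      have h2 : HasFDerivAt f (fderiv ℂ f x) (x + (0 : ℂ) • v) := by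
        simpa using (hfd x (by simpa using hmem x hx 0 (by simp [hr.le]))).hasFDerivAt
      exact (h2.comp_hasDerivAt (0 : ℂ) h1).deriv.symm
    · intro ζ hζ
      exact ((hfd _ hζ).comp ζ (by fun_prop)).differentiableWithinAt
  have hev : (fun z => fderiv ℂ f z v) =ᶠ[𝓝 z0] fun x =>
      (2 * Real.pi * Complex.I : ℂ)⁻¹ • ∮ ζ in C(0, r), ((ζ - 0) ^ 2)⁻¹ • f (x + ζ • v) := by
    filter_upwards [ball_mem_nhds z0 hR] with x hx using hcauchy x hx
  refine DifferentiableAt.congr_of_eventuallyEq (DifferentiableAt.const_smul ?_ _) hev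
  borelize E
  borelize F
  borelize (E →L[ℂ] F)
  have : ProperSpace (E →L[ℂ] F) := FiniteDimensional.proper ℂ _
  have : ProperSpace E := FiniteDimensional.proper ℂ _
  let c : ℝ → ℂ := fun θ => deriv (circleMap 0 r) θ • ((circleMap 0 r θ - 0) ^ 2)⁻¹
  have hcc : Continuous c := by
    change Continuous fun θ => deriv (circleMap 0 r) θ • ((circleMap 0 r θ - 0) ^ 2)⁻¹
    refine Continuous.fun_smul ?_ ?_
    · rw [show deriv (circleMap 0 r) = fun θ => circleMap 0 r θ * Complex.I from
        funext fun θ => deriv_circleMap 0 r θ]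
      fun_prop
    · refine Continuous.inv₀ (by fun_prop) fun θ => ?_
      simp [hr.ne']
  obtain ⟨C, hC⟩ : ∃ C, ∀ θ ∈ uIcc 0 (2 * Real.pi), ‖c θ‖ ≤ C :=
    isCompact_uIcc.exists_bound_of_continuousOn hcc.continuousOn
  have hFc : ∀ x ∈ ball z0 R, Continuous fun θ => c θ • f (x + circleMap 0 r θ • v) := by
    intro x hx
    refine hcc.smul (continuous_iff_continuousAt.2 fun θ => ?_)
    exact ContinuousAt.comp (f := fun θ => x + circleMap 0 r θ • v)
      (hfd _ (hmem x hx _ (hc θ))).continuousAt (by fun_prop)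
  have key := intervalIntegral.hasFDerivAt_integral_of_dominated_of_fderiv_le (𝕜 := ℂ)
    (μ := volume) (a := 0) (b := 2 * Real.pi) (bound := fun _ => C * (2 / R))
    (F := fun x θ => c θ • f (x + circleMap 0 r θ • v))
    (F' := fun x θ => c θ • fderiv ℂ f (x + circleMap 0 r θ • v)) (x₀ := z0)
    (ball_mem_nhds z0 hR) ?_ ?_ ?_ ?_ ?_ ?_
  · convert key.differentiableAt using 3 with x
    simp only [circleIntegral, c, smul_smul, smul_eq_mul]
  · filter_upwards [ball_mem_nhds z0 hR] with x hx
    exact (hFc x hx).aestronglyMeasurable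
  · exact (hFc z0 (mem_ball_self hR)).intervalIntegrable _ _
  · refine hcc.aestronglyMeasurable.smul ?_
    refine Measurable.aestronglyMeasurable ?_
    exact (measurable_fderiv ℂ f).comp (by fun_prop : Continuous _).measurable
  · refine .of_forall fun θ hθ x hx => ?_
    rw [norm_smul]
    have := hC θ (uIoc_subset_uIcc hθ)
    exact mul_le_mul this (hbd _ (hmem x hx _ (hc θ))) (norm_nonneg _) ((norm_nonneg _).trans this)
  · exact intervalIntegrable_const
  · refine .of_forall fun θ hθ x hx => ?_
    have h1 := (hfd _ (hmem x hx _ (hc θ))).hasFDerivAt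
    have h2 : HasFDerivAt (fun x => x + circleMap 0 r θ • v) (ContinuousLinearMap.id ℂ E) x :=
      (hasFDerivAt_id x).add_const _
    have h3 := (h1.comp x h2).const_smul (c θ)
    rw [ContinuousLinearMap.comp_id] at h3
    exact h3

theorem osg_contDiffOn {E F : Type*} [NormedAddCommGroup E] [NormedSpace ℂ E] [FiniteDimensional ℂ E]
    [NormedAddCommGroup F] [NormedSpace ℂ F] [FiniteDimensional ℂ F]
    {U : Set E} (hU : IsOpen U) (n : ℕ) :
    ∀ {f : E → F}, DifferentiableOn ℂ f U → ContDiffOn ℂ n f U := by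
  induction n with
  | zero => intro f hf; exact (contDiffOn_zero (𝕜 := ℂ)).2 hf.continuousOn
  | succ n ih =>
    intro f hf
    push_cast
    rw [contDiffOn_succ_iff_fderiv_of_isOpen hU]
    refine ⟨hf, by simp, ?_⟩
    rw [contDiffOn_clm_apply]
    exact fun v => ih (osg_fderiv_apply hU hf v)

theorem osg_contDiffAt {E F : Type*} [NormedAddCommGroup E] [NormedSpace ℂ E] [FiniteDimensional ℂ E]
    [NormedAddCommGroup F] [NormedSpace ℂ F] [FiniteDimensional ℂ F]
    {U : Set E} (hU : IsOpen U) {f : E → F} (hf : DifferentiableOn ℂ f U) {z : E} (hz : z ∈ U) :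
    ContDiffAt ℂ 1 f z := by
  have := osg_contDiffOn hU 1 hf
  exact_mod_cast this.contDiffAt (hU.mem_nhds hz)

/-- Existence of zeros from the minimum principle. -/
theorem osg_exists_zero {G : ℂ → ℂ} {U : Set ℂ} {z0 : ℂ} {r δ : ℝ} (hr : 0 < r)
    (hU : closedBall z0 r ⊆ U) (hG : DifferentiableOn ℂ G U)
    (hs : ∀ z ∈ sphere z0 r, δ ≤ ‖G z‖) (h0 : ‖G z0‖ < δ) : ∃ z ∈ closedBall z0 r, G z = 0 := by
  by_contra! hne
  have hδ : 0 < δ := (norm_nonneg _).trans_lt h0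
  have hd : DiffContOnCl ℂ (fun z => (G z)⁻¹) (ball z0 r) := by
    apply DifferentiableOn.diffContOnCl
    rw [closure_ball _ hr.ne']
    exact (hG.mono hU).inv hne
  have := Complex.norm_le_of_forall_mem_frontier_norm_le (C := δ⁻¹) isBounded_ball hd
    (fun z hz => by
      rw [frontier_ball _ hr.ne'] at hz
      rw [norm_inv]
      exact inv_anti₀ hδ (hs z hz)) (subset_closure (mem_ball_self hr))
  rw [norm_inv] at this
  have h3 := (inv_le_inv₀ (norm_pos_iff.2 (hne z0 (mem_closedBall_self hr.le))) hδ).1 this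
  linarith

/-- The one-dimensional case. -/
theorem osg_one {f : ℂ → ℂ} {U : Set ℂ} (hU : IsOpen U) (hf : DifferentiableOn ℂ f U)
    (hinj : InjOn f U) {p : ℂ} (hp : p ∈ U) : deriv f p ≠ 0 := by
  intro h0
  obtain ⟨r, hr, hrU⟩ : ∃ r > 0, closedBall p r ⊆ U := nhds_basis_closedBall.mem_iff.1 (hU.mem_nhds hp)
  have hfp := hf.differentiableAt (hU.mem_nhds hp)
  -- min on the sphere
  have hcomp : IsCompact (sphere p r) := isCompact_sphere p r
  have hne : (sphere p r).Nonempty := NormedSpace.sphere_nonempty.2 hr.le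
  obtain ⟨s0, hs0, hmin⟩ := hcomp.exists_isMinOn hne
    (f := fun z => ‖f z - f p‖) ((hf.continuousOn.mono (sphere_subset_closedBall.trans hrU)).sub
      continuousOn_const).norm
  set m := ‖f s0 - f p‖ with hm
  have hmpos : 0 < m := by
    rw [hm, norm_pos_iff, sub_ne_zero]
    intro h
    have := hinj (hrU (sphere_subset_closedBall hs0)) hp h
    rw [this] at hs0
    simp at hs0; exact hr.ne hs0
  -- derivative nonzero in punctured nhds
  have han : AnalyticAt ℂ (deriv f) p := (hf.analyticAt (hU.mem_nhds hp)).deriv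
  have hder : ∀ᶠ w in 𝓝[≠] p, deriv f w ≠ 0 := by
    rcases han.eventually_eq_zero_or_eventually_ne_zero with h | h
    · exfalso
      obtain ⟨ρ, hρ, hb⟩ := Metric.mem_nhds_iff.1 (h.and (hU.mem_nhds hp))
      have hw : p + (ρ / 2 : ℝ) ∈ ball p ρ := by
        simp [abs_of_pos hρ, hρ]
      have := isOpen_ball.is_const_of_deriv_eq_zero (convex_ball p ρ).isPreconnected
        (hf.mono fun x hx => (hb hx).2) (fun x hx => (hb hx).1) hw (mem_ball_self hρ)
      have h3 := hinj (hb hw).2 hp this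
      simp at h3
      exact hρ.ne' h3
    · exact h
  have h1 : ∀ᶠ w in 𝓝[≠] p, ‖f w - f p‖ < m / 2 := by
    have : Tendsto (fun w => ‖f w - f p‖) (𝓝 p) (𝓝 0) := by
      have := (hfp.continuousAt.sub (continuousAt_const (y := f p))).norm
      simpa [ContinuousAt] using this
    exact (this.eventually (gt_mem_nhds (by positivity))).filter_mono nhdsWithin_le_nhds
  have h2 : ∀ᶠ w in 𝓝[≠] p, ‖slope f p w‖ < m / (4 * r) := by
    have := hfp.hasDerivAt.tendsto_slope.norm
    rw [h0, norm_zero] at this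
    exact this.eventually (gt_mem_nhds (by positivity))
  have h3 : ∀ᶠ w in 𝓝[≠] p, w ∈ ball p r :=
    Filter.Eventually.filter_mono nhdsWithin_le_nhds (ball_mem_nhds p hr)
  obtain ⟨w, hw0, hw1, hw2, hw3, hwp⟩ :=
    (hder.and (h1.and (h2.and (h3.and self_mem_nhdsWithin)))).exists
  have hwp : w ≠ p := hwp
  have hwU : w ∈ U := hrU (ball_subset_closedBall hw3)
  obtain ⟨z, hz, hz0⟩ := osg_exists_zero (G := dslope f w) (δ := m / (4 * r)) hr hrU
    ((Complex.differentiableOn_dslope (hU.mem_nhds hwU)).2 hf) (by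
      intro z hz
      have hzw : z ≠ w := by
        rintro rfl
        exact sphere_disjoint_ball.ne_of_mem hz hw3 rfl
      rw [dslope_of_ne _ hzw, slope_def_module, norm_smul, norm_inv]
      have e1 : m ≤ ‖f z - f p‖ := hmin hz
      have e2 : ‖f z - f p‖ ≤ ‖f z - f w‖ + ‖f w - f p‖ := by
        simpa using norm_add_le (f z - f w) (f w - f p)
      have e3 : ‖z - w‖ ≤ 2 * r := by
        have := dist_triangle_right z w p
        rw [← dist_eq_norm]
        rw [mem_sphere] at hz
        rw [mem_ball] at hw3
        linarith
      have e4 : 0 < ‖z - w‖ := norm_pos_iff.2 (sub_ne_zero.2 hzw)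
      rw [inv_mul_eq_div, div_le_div_iff₀ (by positivity) e4]
      have : m / 2 ≤ ‖f z - f w‖ := by linarith
      calc m * ‖z - w‖ ≤ m * (2 * r) := by gcongr
        _ = (m / 2) * (4 * r) := by ring
        _ ≤ _ := by gcongr) (by
      rw [dslope_of_ne _ hwp.symm, slope_comm]; exact hw2)
  by_cases hzw : z = w
  · rw [hzw, dslope_same] at hz0; exact hw0 hz0
  · rw [dslope_of_ne _ hzw, slope_def_module, smul_eq_zero, inv_eq_zero, sub_eq_zero, sub_eq_zero] at hz0
    rcases hz0 with h | h
    · exact hzw h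
    · exact hzw (hinj (hrU hz) hwU h)

theorem osg_straighten {E : Type*} [NormedAddCommGroup E] [NormedSpace ℂ E] [FiniteDimensional ℂ E]
    {U : Set E} (hU : IsOpen U) {h : E → ℂ} (hh : DifferentiableOn ℂ h U) {p : E} (hp : p ∈ U)
    (u : E) :
    ∃ Φ : OpenPartialHomeomorph E E, p ∈ Φ.source ∧ Φ.source ⊆ U ∧
      (∀ z, Φ z = z + (h z - fderiv ℂ h p z) • u) ∧ DifferentiableOn ℂ Φ.symm Φ.target ∧
      HasFDerivAt Φ.symm (ContinuousLinearMap.id ℂ E) (Φ p) := by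
  have : CompleteSpace E := FiniteDimensional.complete ℂ E
  set l := fderiv ℂ h p
  let g : E → E := fun z => z + (h z - l z) • u
  have hgd : DifferentiableOn ℂ g U :=
    differentiableOn_id.add ((hh.sub l.differentiable.differentiableOn).smul_const u)
  have hgc : ContDiffAt ℂ 1 g p := osg_contDiffAt hU hgd hp
  have hg' : HasFDerivAt g ((ContinuousLinearEquiv.refl ℂ E : E ≃L[ℂ] E) : E →L[ℂ] E) p := by
    have h1 : HasFDerivAt h l p := (hh.differentiableAt (hU.mem_nhds hp)).hasFDerivAt
    have h2 := (hasFDerivAt_id p).add ((h1.sub l.hasFDerivAt).smul_const u)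
    convert h2 using 1
    · rfl
    · ext x
      simp
  let Φ0 := hgc.toOpenPartialHomeomorph g hg' one_ne_zero
  have hΦ0 : ∀ z, Φ0 z = g z := fun z => rfl
  have hp0 : p ∈ Φ0.source := hgc.mem_toOpenPartialHomeomorph_source hg' one_ne_zero
  have hsymm : ContDiffAt ℂ 1 Φ0.symm (g p) := hgc.to_localInverse hg' one_ne_zero
  have hsymm' : HasFDerivAt Φ0.symm (ContinuousLinearMap.id ℂ E) (g p) :=
    (hgc.hasStrictFDerivAt' hg' one_ne_zero).to_localInverse.hasFDerivAt
  let T := interior {y | DifferentiableAt ℂ Φ0.symm y}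
  have hT : g p ∈ T := by
    rw [mem_interior_iff_mem_nhds]
    have := hsymm.eventually (by simp)
    filter_upwards [this] with y hy using hy.differentiableAt one_ne_zero
  let Φ1 := (Φ0.symm.restrOpen T isOpen_interior).symm.restrOpen U hU
  refine ⟨Φ1, ?_, ?_, ?_, ?_, ?_⟩
  · simp only [Φ1, OpenPartialHomeomorph.restrOpen_source, OpenPartialHomeomorph.symm_source]
    refine ⟨?_, hp⟩
    change p ∈ Φ0.source ∩ Φ0 ⁻¹' T
    exact ⟨hp0, hT⟩
  · simp only [Φ1, OpenPartialHomeomorph.restrOpen_source]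
    exact inter_subset_right
  · intro z; rfl
  · intro y hy
    have hy1 : y ∈ (Φ0.symm.restrOpen T isOpen_interior).source := hy.1
    rw [OpenPartialHomeomorph.restrOpen_source] at hy1
    have hy2 : y ∈ {y | DifferentiableAt ℂ Φ0.symm y} := interior_subset hy1.2
    have : DifferentiableAt ℂ Φ0.symm y := hy2
    exact this.differentiableWithinAt
  · exact hsymm'

/-- The inductive claim. -/
def OsgClaim.{u} (n : ℕ) : Prop :=
  ∀ (E F : Type u) [NormedAddCommGroup E] [NormedSpace ℂ E] [FiniteDimensional ℂ E]
    [NormedAddCommGroup F] [NormedSpace ℂ F] [FiniteDimensional ℂ F] (U : Set E) (f : E → F),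
    Module.finrank ℂ E = n → Module.finrank ℂ F = n → IsOpen U → DifferentiableOn ℂ f U →
    InjOn f U → ∀ p ∈ U, ∀ v, fderiv ℂ f p v = 0 → v = 0

theorem osg_finrank_ker {E : Type*} [NormedAddCommGroup E] [NormedSpace ℂ E]
    [FiniteDimensional ℂ E] {n : ℕ} (hE : Module.finrank ℂ E = n + 1) (l : E →L[ℂ] ℂ)
    {u : E} (hu : l u ≠ 0) :
    Module.finrank ℂ (LinearMap.ker (l : E →ₗ[ℂ] ℂ)) = n := by
  have h1 := LinearMap.finrank_range_add_finrank_ker (l : E →ₗ[ℂ] ℂ)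
  have h2 : LinearMap.range (l : E →ₗ[ℂ] ℂ) = ⊤ :=
    LinearMap.range_eq_top.2 (LinearMap.surjective (by
      intro h; apply hu; exact congrArg (fun m : E →ₗ[ℂ] ℂ => m u) h))
  rw [h2, finrank_top, Module.finrank_self, hE] at h1
  omega

theorem osg_rank_step.{u} {n : ℕ} (IH : OsgClaim.{u} n)
    {E F : Type u} [NormedAddCommGroup E] [NormedSpace ℂ E] [FiniteDimensional ℂ E]
    [NormedAddCommGroup F] [NormedSpace ℂ F] [FiniteDimensional ℂ F] {U : Set E} {f : E → F}
    (hE : Module.finrank ℂ E = n + 1) (hF : Module.finrank ℂ F = n + 1) (hU : IsOpen U)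
    (hf : DifferentiableOn ℂ f U) (hinj : InjOn f U) {q : E} (hq : q ∈ U) {v : E} (hv : v ≠ 0)
    (hfv : fderiv ℂ f q v = 0) : fderiv ℂ f q = 0 := by
  by_contra hne
  obtain ⟨w, hw⟩ : ∃ w, fderiv ℂ f q w ≠ 0 := by
    by_contra! h
    exact hne (ContinuousLinearMap.ext h)
  obtain ⟨l0, hl0⟩ := SeparatingDual.exists_ne_zero (R := ℂ) hw
  have hfq := (hf.differentiableAt (hU.mem_nhds hq)).hasFDerivAt
  let h : E → ℂ := fun z => l0 (f z)
  have hh : DifferentiableOn ℂ h U := l0.differentiable.comp_differentiableOn hf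
  have hh' : fderiv ℂ h q = l0.comp (fderiv ℂ f q) := (l0.hasFDerivAt.comp q hfq).fderiv
  let u : E := (l0 (fderiv ℂ f q w))⁻¹ • w
  have hu : fderiv ℂ h q u = 1 := by
    rw [hh']
    simp [u, hl0]
  obtain ⟨Φ, hqΦ, hΦU, hΦ, hsd, hs'⟩ := osg_straighten hU hh hq u
  set l := fderiv ℂ h q with hl
  let K := LinearMap.ker (l : E →ₗ[ℂ] ℂ)
  let K' := LinearMap.ker (l0 : F →ₗ[ℂ] ℂ)
  have hlΦ : ∀ z, l (Φ z) = h z := by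
    intro z
    rw [hΦ, map_add, map_smul, hu]
    simp
  -- a projection onto the kernel
  obtain ⟨π, hπ⟩ : ∃ π : F →L[ℂ] K', ∀ x : K', π x = x :=
    Submodule.ClosedComplemented.of_finiteDimensional K'
  let V : Set K := (fun k : K => Φ q + (k : E)) ⁻¹' Φ.target
  have hVo : IsOpen V := Φ.open_target.preimage (by fun_prop)
  have hlk : ∀ k : K, l (k : E) = 0 := fun k => k.2
  have hmemK' : ∀ k ∈ V, f (Φ.symm (Φ q + (k : E))) - f q ∈ K' := by
    intro k hk
    have h1 : h (Φ.symm (Φ q + (k : E))) = h q := by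
      rw [← hlΦ, Φ.right_inv hk, map_add, hlk, hlΦ, add_zero]
    change l0 (f (Φ.symm (Φ q + (k : E))) - f q) = 0
    rw [map_sub]
    exact sub_eq_zero.2 h1
  let g : K → K' := fun k => π (f (Φ.symm (Φ q + (k : E))) - f q)
  have hgd : DifferentiableOn ℂ g V := by
    intro k hk
    have hk' : Φ q + (k : E) ∈ Φ.target := hk
    have h1 : DifferentiableAt ℂ (fun k : K => Φ q + (k : E)) k :=
      (K.subtypeL.differentiableAt).const_add _
    have h2 : DifferentiableAt ℂ Φ.symm (Φ q + (k : E)) :=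
      hsd.differentiableAt (Φ.open_target.mem_nhds hk')
    have h3 : DifferentiableAt ℂ f (Φ.symm (Φ q + (k : E))) :=
      hf.differentiableAt (hU.mem_nhds (hΦU (Φ.map_target hk')))
    have h4 := (h3.comp k (h2.comp k h1)).sub_const (f q)
    exact (π.differentiableAt.comp k h4).differentiableWithinAt
  have hginj : InjOn g V := by
    intro a ha b hb hab
    have e1 : f (Φ.symm (Φ q + (a : E))) - f q = f (Φ.symm (Φ q + (b : E))) - f q := by
      have ea := hπ ⟨_, hmemK' a ha⟩
      have eb := hπ ⟨_, hmemK' b hb⟩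
      have : (⟨_, hmemK' a ha⟩ : K') = ⟨_, hmemK' b hb⟩ := by rw [← ea, ← eb]; exact hab
      exact congrArg Subtype.val this
    have e2 := hinj (hΦU (Φ.map_target ha)) (hΦU (Φ.map_target hb)) (sub_left_inj.1 e1)
    have e3 := Φ.symm.injOn ha hb e2
    exact Subtype.ext (add_left_cancel e3)
  have h0V : (0 : K) ∈ V := by
    change Φ q + ((0 : K) : E) ∈ Φ.target
    simpa using Φ.map_source hqΦ
  have hlv : l v = 0 := by rw [hh', ContinuousLinearMap.comp_apply, hfv, map_zero]
  have hg' : HasFDerivAt g (π.comp ((fderiv ℂ f q).comp K.subtypeL)) 0 := by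
    have h1 : HasFDerivAt (fun k : K => Φ q + (k : E)) K.subtypeL 0 :=
      (K.subtypeL.hasFDerivAt).const_add _
    have e0 : Φ q + ((0 : K) : E) = Φ q := by simp
    have h2 : HasFDerivAt Φ.symm (ContinuousLinearMap.id ℂ E) (Φ q + ((0 : K) : E)) := by
      rw [e0]; exact hs'
    have h3 : HasFDerivAt f (fderiv ℂ f q) (Φ.symm (Φ q + ((0 : K) : E))) := by
      rw [e0, Φ.left_inv hqΦ]; exact hfq
    have h4 := (h3.comp (0 : K) (h2.comp (0 : K) h1)).sub_const (f q)
    exact π.hasFDerivAt.comp (0 : K) h4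
  have := IH K K' V g (osg_finrank_ker hE l (u := u) (by rw [hu]; exact one_ne_zero))
    (osg_finrank_ker hF l0 hl0) hVo hgd hginj 0 h0V ⟨v, hlv⟩ (by
      rw [hg'.fderiv]
      simp [hfv])
  exact hv (congrArg Subtype.val this)


theorem osg_dim_one {E F : Type*} [NormedAddCommGroup E] [NormedSpace ℂ E] [FiniteDimensional ℂ E]
    [NormedAddCommGroup F] [NormedSpace ℂ F] [FiniteDimensional ℂ F] {U : Set E} {f : E → F}
    (hF : Module.finrank ℂ F = 1) (hU : IsOpen U)
    (hf : DifferentiableOn ℂ f U) (hinj : InjOn f U) {p : E} (hp : p ∈ U) {v : E} (hv : v ≠ 0)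
    (hfv : fderiv ℂ f p v = 0) : False := by
  let L : F ≃L[ℂ] ℂ := ContinuousLinearEquiv.ofFinrankEq (by rw [hF, Module.finrank_self])
  let y : ℂ → E := fun ζ => p + ζ • v
  have hy : ∀ ζ, HasDerivAt y v ζ := fun ζ => by
    change HasDerivAt (fun ζ : ℂ => p + ζ • v) v ζ
    simpa using ((hasDerivAt_id ζ).smul_const v).const_add p
  have hyc : Continuous y := by fun_prop
  have hfd : ∀ z ∈ U, HasFDerivAt f (fderiv ℂ f z) z := fun z hz =>
    (hf.differentiableAt (hU.mem_nhds hz)).hasFDerivAt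
  have hg : ∀ ζ ∈ y ⁻¹' U, HasDerivAt (fun ζ => L (f (y ζ))) (L (fderiv ℂ f (y ζ) v)) ζ := by
    intro ζ hζ
    exact (L : F →L[ℂ] ℂ).hasFDerivAt.comp_hasDerivAt ζ ((hfd _ hζ).comp_hasDerivAt ζ (hy ζ))
  have hy0 : y 0 = p := by simp [y]
  have h0 : (0 : ℂ) ∈ y ⁻¹' U := by rw [mem_preimage, hy0]; exact hp
  refine osg_one (hU.preimage hyc) (fun ζ hζ => (hg ζ hζ).differentiableAt.differentiableWithinAt)
    ?_ h0 ?_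
  · intro a ha b hb hab
    have h1 := hinj ha hb (L.injective hab)
    have h2 : a • v = b • v := add_left_cancel h1
    exact smul_left_injective ℂ hv h2
  · rw [(hg 0 h0).deriv, hy0, hfv, map_zero]

/-- Iterated directional derivatives. -/
noncomputable def osgIter {E : Type*} [NormedAddCommGroup E] [NormedSpace ℂ E] (J : E → ℂ) (v : E) :
    ℕ → E → ℂ
  | 0 => J
  | k + 1 => fun z => fderiv ℂ (osgIter J v k) z v

theorem osgIter_diff {E : Type*} [NormedAddCommGroup E] [NormedSpace ℂ E] [FiniteDimensional ℂ E]
    {U : Set E} (hU : IsOpen U) {J : E → ℂ} (hJ : DifferentiableOn ℂ J U) (v : E) (k : ℕ) :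
    DifferentiableOn ℂ (osgIter J v k) U := by
  induction k with
  | zero => exact hJ
  | succ k ih => exact osg_fderiv_apply hU ih v

theorem osgIter_deriv {E : Type*} [NormedAddCommGroup E] [NormedSpace ℂ E] [FiniteDimensional ℂ E]
    {U : Set E} (hU : IsOpen U) {J : E → ℂ} (hJ : DifferentiableOn ℂ J U) (p v : E) (k : ℕ) :
    ∀ ζ : ℂ, p + ζ • v ∈ U →
      iteratedDeriv k (fun ζ : ℂ => J (p + ζ • v)) ζ = osgIter J v k (p + ζ • v) := by
  induction k with
  | zero => intro ζ _; simp [osgIter]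
  | succ k ih =>
    intro ζ hζ
    rw [iteratedDeriv_succ]
    have hop : IsOpen ((fun ζ : ℂ => p + ζ • v) ⁻¹' U) := hU.preimage (by fun_prop)
    have hev : iteratedDeriv k (fun ζ : ℂ => J (p + ζ • v)) =ᶠ[𝓝 ζ]
        fun ζ => osgIter J v k (p + ζ • v) := by
      filter_upwards [hop.mem_nhds hζ] with ξ hξ using ih ξ hξ
    rw [hev.deriv_eq]
    have h1 : HasDerivAt (fun ζ : ℂ => p + ζ • v) v ζ := by
      simpa using ((hasDerivAt_id ζ).smul_const v).const_add p
    have h2 := ((osgIter_diff hU hJ v k).differentiableAt (hU.mem_nhds hζ)).hasFDerivAt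
    exact (h2.comp_hasDerivAt ζ h1).deriv

/-- A holomorphic function with a zero, not identically zero near it, has a zero at which an
iterated directional derivative does not vanish, the previous one vanishing on the zero set. -/
theorem osg_minimal {E : Type*} [NormedAddCommGroup E] [NormedSpace ℂ E] [FiniteDimensional ℂ E]
    {U : Set E} (hU : IsOpen U) {J : E → ℂ} (hJ : DifferentiableOn ℂ J U) {p q : E} {ρ : ℝ}
    (hρ : ball p ρ ⊆ U) (hq : q ∈ ball p ρ) (hp0 : J p = 0) (hq0 : J q ≠ 0) :
    ∃ (h : E → ℂ) (v p' : E), DifferentiableOn ℂ h U ∧ p' ∈ U ∧ J p' = 0 ∧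
      (∀ z ∈ U, J z = 0 → h z = 0) ∧ fderiv ℂ h p' v = 1 := by
  classical
  set v := q - p with hv
  have hρ0 : 0 < ρ := pos_of_mem_ball hq
  have hv0 : v ≠ 0 := by
    intro h
    rw [hv, sub_eq_zero] at h
    rw [h] at hq0; exact hq0 hp0
  have hvn : 0 < ‖v‖ := norm_pos_iff.2 hv0
  have hsub : ∀ ζ ∈ ball (0 : ℂ) (ρ / ‖v‖), p + ζ • v ∈ U := by
    intro ζ hζ
    apply hρ
    rw [mem_ball_zero_iff, lt_div_iff₀ hvn] at hζ
    rw [mem_ball, dist_eq_norm, add_sub_cancel_left, norm_smul]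
    exact hζ
  have hφ : DifferentiableOn ℂ (fun ζ : ℂ => J (p + ζ • v)) (ball 0 (ρ / ‖v‖)) := by
    intro ζ hζ
    exact ((hJ.differentiableAt (hU.mem_nhds (hsub ζ hζ))).comp ζ
      (by fun_prop)).differentiableWithinAt
  have h1mem : (1 : ℂ) ∈ ball (0 : ℂ) (ρ / ‖v‖) := by
    rw [mem_ball_zero_iff, lt_div_iff₀ hvn, norm_one, one_mul, hv, ← dist_eq_norm]
    exact hq
  have hpU : p ∈ U := hρ (mem_ball_self hρ0)
  have hex : ∃ m, ∃ z ∈ U, J z = 0 ∧ osgIter J v m z ≠ 0 := by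
    by_contra! hall
    have hs := Complex.hasSum_taylorSeries_on_ball hφ h1mem
    have hz : ∀ k, iteratedDeriv k (fun ζ : ℂ => J (p + ζ • v)) 0 = 0 := by
      intro k
      rw [osgIter_deriv hU hJ p v k 0 (by simpa using hpU)]
      simpa using hall k p hpU hp0
    simp only [hz, smul_zero] at hs
    have := hs.unique hasSum_zero
    apply hq0
    simpa [hv] using this
  obtain ⟨p', hp'U, hJp', hm⟩ := Nat.find_spec hex
  have hm0 : Nat.find hex ≠ 0 := by
    intro h
    rw [h] at hm
    exact hm hJp'
  obtain ⟨m, hmm⟩ := Nat.exists_eq_succ_of_ne_zero hm0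
  rw [hmm] at hm
  have hmin := Nat.find_min hex (m := m) (by omega)
  push Not at hmin
  set a := osgIter J v (m + 1) p' with ha
  have hd := osgIter_diff hU hJ v m
  refine ⟨fun z => a⁻¹ * osgIter J v m z, v, p', hd.const_mul _, hp'U, hJp', ?_, ?_⟩
  · intro z hz hz0
    simp [hmin z hz hz0]
  · rw [fderiv_const_mul (hd.differentiableAt (hU.mem_nhds hp'U))]
    change a⁻¹ * a = 1
    exact inv_mul_cancel₀ hm


/-- Near a minimal point, the zero set of `J` is a smooth hypersurface; here we extract a complex
curve in it. -/
theorem osg_curve {E : Type*} [NormedAddCommGroup E] [NormedSpace ℂ E] [FiniteDimensional ℂ E]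
    {U : Set E} (hU : IsOpen U) {J h : E → ℂ} (hJ : DifferentiableOn ℂ J U)
    (hh : DifferentiableOn ℂ h U) {p v k0 : E} (hp : p ∈ U) (hJp : J p = 0)
    (hJh : ∀ z ∈ U, J z = 0 → h z = 0) (hv : fderiv ℂ h p v = 1) (hk0 : fderiv ℂ h p k0 = 0)
    (hk0' : k0 ≠ 0) :
    ∃ (γ : ℂ → E) (ρ : ℝ), 0 < ρ ∧ DifferentiableOn ℂ γ (ball 0 ρ) ∧ InjOn γ (ball 0 ρ) ∧
      ∀ s ∈ ball (0 : ℂ) ρ, γ s ∈ U ∧ J (γ s) = 0 := by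
  obtain ⟨Φ, hpΦ, hΦU, hΦ, hsd, -⟩ := osg_straighten hU hh hp v
  have hhp := (hh.differentiableAt (hU.mem_nhds hp)).hasFDerivAt
  set l := fderiv ℂ h p with hl
  let c : ℂ → ℂ → E := fun ζ s => p + s • k0 + ζ • v
  have hcc : Continuous fun x : ℂ × ℂ => c x.1 x.2 := by fun_prop
  have hc00 : c 0 0 = p := by simp [c]
  have hJat : ∀ z ∈ U, ContinuousAt J z := fun z hz =>
    (hJ.differentiableAt (hU.mem_nhds hz)).continuousAt
  -- nonvanishing along the line
  have hline : ∀ᶠ ζ in 𝓝[≠] (0 : ℂ), h (c ζ 0) ≠ 0 := by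
    have hd : HasDerivAt (fun ζ : ℂ => h (c ζ 0)) 1 0 := by
      have h1 : HasDerivAt (fun ζ : ℂ => c ζ 0) v 0 := by
        simpa [c] using ((hasDerivAt_id (0 : ℂ)).smul_const v).const_add p
      have h2 : HasFDerivAt h l ((fun ζ : ℂ => c ζ 0) 0) := by
        simp only [hc00]; exact hhp
      have := HasFDerivAt.comp_hasDerivAt (f := fun ζ : ℂ => c ζ 0) (0 : ℂ) h2 h1
      rw [hv] at this
      exact this
    exact hd.eventually_ne one_ne_zero
  have hsrc : ∀ᶠ ζ in 𝓝 (0 : ℂ), c ζ 0 ∈ Φ.source := by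
    have : ContinuousAt (fun ζ => c ζ 0) 0 := by
      apply Continuous.continuousAt; fun_prop
    apply this.preimage_mem_nhds
    rw [hc00]; exact Φ.open_source.mem_nhds hpΦ
  rw [eventually_nhdsWithin_iff] at hline
  obtain ⟨r, hr, hrs⟩ := nhds_basis_closedBall.eventually_iff.1 (hline.and hsrc)
  have hrsp : ∀ ζ ∈ sphere (0 : ℂ) r, J (c ζ 0) ≠ 0 := by
    intro ζ hζ h0
    have h1 := hrs (sphere_subset_closedBall hζ)
    refine h1.1 ?_ (hJh _ (hΦU h1.2) h0)
    rintro rfl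
    simp at hζ; exact hr.ne hζ
  have hJc : ∀ ζ ∈ closedBall (0 : ℂ) r, ContinuousAt (fun x : ℂ × ℂ => J (c x.1 x.2)) (ζ, 0) := by
    intro ζ hζ
    exact ContinuousAt.comp (f := fun x : ℂ × ℂ => c x.1 x.2) (hJat _ (hΦU (hrs hζ).2))
      hcc.continuousAt
  obtain ⟨s0, hs0, hmin⟩ := (isCompact_sphere (0 : ℂ) r).exists_isMinOn
    (NormedSpace.sphere_nonempty.2 hr.le) (f := fun ζ => ‖J (c ζ 0)‖) (by
      intro ζ hζ
      have h1 := hJc ζ (sphere_subset_closedBall hζ)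
      exact (ContinuousAt.comp (f := fun ζ : ℂ => (ζ, (0 : ℂ))) h1
        (by apply Continuous.continuousAt; fun_prop)).norm.continuousWithinAt)
  set m := ‖J (c s0 0)‖ with hm
  have hm0 : 0 < m := norm_pos_iff.2 (hrsp s0 hs0)
  have ev1 : ∀ᶠ s in 𝓝 (0 : ℂ), ∀ ζ ∈ closedBall (0 : ℂ) r, c ζ s ∈ Φ.source := by
    apply (isCompact_closedBall (0 : ℂ) r).eventually_forall_of_forall_eventually
    intro ζ hζ
    have hcs : Continuous fun x : ℂ × ℂ => c x.2 x.1 := by fun_prop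
    exact (hcs.continuousAt (x := ((0 : ℂ), ζ))).preimage_mem_nhds
      (Φ.open_source.mem_nhds (hrs hζ).2)
  have ev2 : ∀ᶠ s in 𝓝 (0 : ℂ), ∀ ζ ∈ sphere (0 : ℂ) r, m / 2 < ‖J (c ζ s)‖ := by
    apply (isCompact_sphere (0 : ℂ) r).eventually_forall_of_forall_eventually
    intro ζ hζ
    have h1 := (ContinuousAt.comp (f := fun x : ℂ × ℂ => (x.2, x.1)) (x := ((0 : ℂ), ζ))
      (hJc ζ (sphere_subset_closedBall hζ)) (by apply Continuous.continuousAt; fun_prop)).norm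
    have h2 : m ≤ ‖J (c ζ 0)‖ := hmin hζ
    have h3 : m / 2 < ‖J (c (ζ, (0 : ℂ)).1 (ζ, (0 : ℂ)).2)‖ := by
      simp only; linarith
    exact h1.eventually (lt_mem_nhds h3)
  have ev3 : ∀ᶠ s in 𝓝 (0 : ℂ), ‖J (c 0 s)‖ < m / 2 := by
    have h1 := hJc 0 (mem_closedBall_self hr.le)
    have h2 := (ContinuousAt.comp (f := fun s : ℂ => ((0 : ℂ), s)) h1
        (by apply Continuous.continuousAt; fun_prop)).norm
    refine h2.eventually (gt_mem_nhds ?_)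
    simp only [Function.comp_apply, hc00, hJp, norm_zero]
    positivity
  obtain ⟨ρ, hρ, hb⟩ := Metric.mem_nhds_iff.1 (ev1.and (ev2.and ev3))
  have key : ∀ s ∈ ball (0 : ℂ) ρ, ∃ z ∈ Φ.source, J z = 0 ∧ Φ z = Φ p + s • k0 := by
    intro s hs
    obtain ⟨e1, e2, e3⟩ := hb hs
    have hop : IsOpen ((fun ζ => c ζ s) ⁻¹' Φ.source) :=
      Φ.open_source.preimage (by fun_prop)
    obtain ⟨ζ, hζ, hζ0⟩ := osg_exists_zero (G := fun ζ => J (c ζ s)) hr (fun ζ hζ => e1 ζ hζ)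
      (by
        intro ζ hζ
        refine DifferentiableAt.differentiableWithinAt ?_
        exact (hJ.differentiableAt (hU.mem_nhds (hΦU hζ))).comp ζ (by fun_prop))
      (fun ζ hζ => (e2 ζ hζ).le) e3
    refine ⟨c ζ s, e1 ζ hζ, hζ0, ?_⟩
    rw [hΦ, hΦ, hJh _ (hΦU (e1 ζ hζ)) hζ0, hJh p hp hJp]
    simp only [c, map_add, map_smul, hv, hk0, smul_eq_mul, mul_zero, mul_one, add_zero]
    module
  refine ⟨fun s => Φ.symm (Φ p + s • k0), ρ, hρ, ?_, ?_, ?_⟩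
  · intro s hs
    obtain ⟨z, hz, -, hz'⟩ := key s hs
    have ht : Φ p + s • k0 ∈ Φ.target := by rw [← hz']; exact Φ.map_source hz
    have h1 := hsd.differentiableAt (Φ.open_target.mem_nhds ht)
    exact (h1.comp s (by fun_prop)).differentiableWithinAt
  · intro s hs t ht hst
    obtain ⟨z, hz, -, hz'⟩ := key s hs
    obtain ⟨w, hw, -, hw'⟩ := key t ht
    simp only [← hz', ← hw', Φ.left_inv hz, Φ.left_inv hw] at hst
    rw [hst, hw'] at hz'
    exact (smul_left_injective ℂ hk0' (add_left_cancel hz')).symm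
  · intro s hs
    obtain ⟨z, hz, hz0, hz'⟩ := key s hs
    simp only [← hz', Φ.left_inv hz]
    exact ⟨hΦU hz, hz0⟩

theorem osg_step.{u} {n : ℕ} (IH : OsgClaim.{u} n) : OsgClaim.{u} (n + 1) := by
  intro E F _ _ _ _ _ _ U f hE hF hU hf hinj p hp v hfv
  by_contra hv
  rcases Nat.eq_zero_or_pos n with rfl | hn
  · exact osg_dim_one hF hU hf hinj hp hv hfv
  let bE : Module.Basis (Fin (n + 1)) ℂ E := Module.finBasisOfFinrankEq ℂ E hE
  let bF : Module.Basis (Fin (n + 1)) ℂ F := Module.finBasisOfFinrankEq ℂ F hF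
  let M : E → Matrix (Fin (n + 1)) (Fin (n + 1)) ℂ := fun z =>
    LinearMap.toMatrix bE bF (fderiv ℂ f z : E →ₗ[ℂ] F)
  let J : E → ℂ := fun z => (M z).det
  have hJd : DifferentiableOn ℂ J U := by
    have hent : ∀ i j, DifferentiableOn ℂ (fun z => M z i j) U := by
      intro i j
      have h1 := osg_fderiv_apply hU hf (bE j)
      have h2 := (LinearMap.toContinuousLinearMap (bF.coord i)).differentiable.comp_differentiableOn h1
      refine h2.congr fun z _ => ?_
      simp [M, LinearMap.toMatrix_apply]
    simp only [J, Matrix.det_apply]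
    refine DifferentiableOn.fun_sum fun σ _ => ?_
    refine DifferentiableOn.fun_const_smul ?_ _
    intro z hz
    exact (HasFDerivAt.finsetProd (u := Finset.univ) (g := fun i z => M z (σ i) i) fun i _ =>
      ((hent (σ i) i).differentiableAt
        (hU.mem_nhds hz)).hasFDerivAt).differentiableAt.differentiableWithinAt
  have hJ0 : ∀ z, J z = 0 ↔ ∃ w, w ≠ 0 ∧ fderiv ℂ f z w = 0 := by
    intro z
    rw [← Matrix.exists_mulVec_eq_zero_iff]
    constructor
    · rintro ⟨x, hx, hx0⟩
      refine ⟨bE.equivFun.symm x, (LinearEquiv.map_ne_zero_iff _).2 hx, ?_⟩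
      have := LinearMap.toMatrix_mulVec_repr bE bF (fderiv ℂ f z : E →ₗ[ℂ] F) (bE.equivFun.symm x)
      have e : (bE.repr (bE.equivFun.symm x) : Fin (n + 1) → ℂ) = x := by
        rw [← bE.equivFun_apply, LinearEquiv.apply_symm_apply]
      rw [e, hx0] at this
      apply bF.equivFun.injective
      rw [map_zero, bF.equivFun_apply]
      exact this.symm
    · rintro ⟨w, hw, hw0⟩
      refine ⟨bE.repr w, ?_, ?_⟩
      · rw [← bE.equivFun_apply]
        simpa using hw
      · rw [LinearMap.toMatrix_mulVec_repr bE bF]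
        simp [hw0]
  have hrank : ∀ z ∈ U, J z = 0 → fderiv ℂ f z = 0 := by
    intro z hz hz0
    obtain ⟨w, hw, hw0⟩ := (hJ0 z).1 hz0
    exact osg_rank_step IH hE hF hU hf hinj hz hw hw0
  have hJp : J p = 0 := (hJ0 p).2 ⟨v, hv, hfv⟩
  obtain ⟨ρ, hρ, hρU⟩ := Metric.mem_nhds_iff.1 (hU.mem_nhds hp)
  -- `J` is not identically zero
  obtain ⟨q, hq, hJq⟩ : ∃ q ∈ ball p ρ, J q ≠ 0 := by
    by_contra! hall
    have hvn : 0 < ‖v‖ := norm_pos_iff.2 hv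
    have hw : p + ((ρ / 2 / ‖v‖ : ℝ) : ℂ) • v ∈ ball p ρ := by
      rw [mem_ball, dist_eq_norm, add_sub_cancel_left, norm_smul, Complex.norm_real,
        Real.norm_of_nonneg (by positivity), div_mul_cancel₀ _ hvn.ne']
      linarith
    let _ : NormedSpace ℝ E := NormedSpace.restrictScalars ℝ ℂ E
    have h1 := isOpen_ball.is_const_of_fderiv_eq_zero (𝕜 := ℂ) (convex_ball p ρ).isPreconnected
      (hf.mono hρU) (fun z hz => hrank z (hρU hz) (hall z hz)) hw (mem_ball_self hρ)
    have h2 := hinj (hρU hw) hp h1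
    rw [add_eq_left, smul_eq_zero] at h2
    rcases h2 with h2 | h2
    · rw [Complex.ofReal_eq_zero] at h2
      have : 0 < ρ / 2 / ‖v‖ := by positivity
      exact this.ne' h2
    · exact hv h2
  obtain ⟨h, v', p', hh, hp'U, hJp', hJh, hv'⟩ := osg_minimal hU hJd hρU hq hJp hJq
  obtain ⟨k0, hk0, hk0'⟩ : ∃ k0, fderiv ℂ h p' k0 = 0 ∧ k0 ≠ 0 := by
    have := LinearMap.ker_ne_bot_of_finrank_lt (f := (fderiv ℂ h p' : E →ₗ[ℂ] ℂ))
      (by rw [Module.finrank_self, hE]; omega)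
    obtain ⟨k, hk, hk'⟩ := Submodule.exists_mem_ne_zero_of_ne_bot this
    exact ⟨k, hk, hk'⟩
  obtain ⟨γ, r, hr, hγd, hγi, hγ⟩ := osg_curve hU hJd hh hp'U hJp' hJh hv' hk0 hk0'
  have hd : ∀ s ∈ ball (0 : ℂ) r, HasDerivAt (fun s => f (γ s)) 0 s := by
    intro s hs
    have h1 := (hγd.differentiableAt (isOpen_ball.mem_nhds hs)).hasDerivAt
    have h2 := (hf.differentiableAt (hU.mem_nhds (hγ s hs).1)).hasFDerivAt
    rw [hrank _ (hγ s hs).1 (hγ s hs).2] at h2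
    exact h2.comp_hasDerivAt s h1
  have hw : ((r / 2 : ℝ) : ℂ) ∈ ball (0 : ℂ) r := by
    rw [mem_ball_zero_iff, Complex.norm_real, Real.norm_of_nonneg (by positivity)]
    linarith
  have h1 := isOpen_ball.is_const_of_deriv_eq_zero (convex_ball (0 : ℂ) r).isPreconnected
    (fun s hs => (hd s hs).differentiableAt.differentiableWithinAt) (fun s hs => (hd s hs).deriv)
    hw (mem_ball_self hr)
  have h2 := hγi hw (mem_ball_self hr) (hinj (hγ _ hw).1 (hγ _ (mem_ball_self hr)).1 h1)
  rw [Complex.ofReal_eq_zero] at h2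
  linarith

theorem osg_main.{u} (n : ℕ) : OsgClaim.{u} n := by
  induction n with
  | zero =>
    intro E F _ _ _ _ _ _ U f hE _ _ _ _ p _ v _
    have := Module.finrank_zero_iff.1 hE
    exact Subsingleton.elim _ _
  | succ n ih => exact osg_step ih


/-- A path of invertible linear maps from the identity to `A`. -/
theorem alex_path {E : Type*} [NormedAddCommGroup E] [NormedSpace ℂ E] [FiniteDimensional ℂ E]
    (A : E →L[ℂ] E) (hA : ∀ v, A v = 0 → v = 0) :
    ∃ κ : ℝ, ∀ s : ℝ, ∀ v : E,
      (1 - ((s : ℂ) + (κ * (s * (1 - s)) : ℝ) * Complex.I)) • v +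
        ((s : ℂ) + (κ * (s * (1 - s)) : ℝ) * Complex.I) • A v = 0 → v = 0 := by
  have hfin : Set.Finite {μ : ℂ | Module.End.HasEigenvalue (A : E →ₗ[ℂ] E) μ} :=
    Module.End.finite_hasEigenvalue _
  obtain ⟨κ, hκ⟩ := (hfin.image fun μ : ℂ =>
    ((1 - μ)⁻¹).im / (((1 - μ)⁻¹).re * (1 - ((1 - μ)⁻¹).re))).infinite_compl.nonempty
  refine ⟨κ, fun s v h => ?_⟩
  by_contra hv
  by_cases hs0 : s = 0
  · subst hs0; simp at h; exact hv h
  by_cases hs1 : s = 1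
  · subst hs1; simp at h; exact hv (hA v h)
  set c : ℂ := (s : ℂ) + (κ * (s * (1 - s)) : ℝ) * Complex.I with hc
  have hre : c.re = s := by simp [hc, -Complex.ofReal_mul]
  have him : c.im = κ * (s * (1 - s)) := by simp [hc, -Complex.ofReal_mul]
  have hc0 : c ≠ 0 := by
    intro h0; rw [h0] at hre; exact hs0 hre.symm
  apply hκ
  refine ⟨1 - c⁻¹, ?_, ?_⟩
  · refine Module.End.hasEigenvalue_of_hasEigenvector (x := v) ⟨?_, hv⟩
    rw [Module.End.mem_eigenspace_iff]
    change A v = _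
    have h2 : c • A v = (c - 1) • v := by
      rw [← sub_eq_zero, ← h]; module
    rw [← inv_smul_smul₀ hc0 (A v), h2, smul_smul]
    congr 1
    field_simp
  · simp only [sub_sub_cancel, inv_inv, hre, him]
    have : (1 - s) ≠ 0 := sub_ne_zero.2 (Ne.symm hs1)
    field_simp

/-- The remainder term. -/
noncomputable def alexR {E : Type*} [NormedAddCommGroup E] [NormedSpace ℂ E] (f : E → E)
    (A : E →L[ℂ] E) (β : ℂ) (z : E) : E := β⁻¹ • (f (β • z) - A (β • z))

theorem alexR_contDiffAt {E : Type*} [NormedAddCommGroup E] [NormedSpace ℂ E]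
    [FiniteDimensional ℂ E] {V : Set E} (hV : IsOpen V) {f : E → E} (hf : DifferentiableOn ℂ f V)
    (h0 : (0 : E) ∈ V) (hf0 : f 0 = 0) (z : E) {β : ℂ} (hβ : β • z ∈ V) :
    ContDiffAt ℂ (⊤ : ℕ∞) (fun ζ => alexR f (fderiv ℂ f 0) ζ z) β := by
  have : CompleteSpace E := FiniteDimensional.complete ℂ E
  let O : Set ℂ := (fun ζ : ℂ => ζ • z) ⁻¹' V
  have hO : IsOpen O := hV.preimage (by fun_prop)
  have h0O : (0 : ℂ) ∈ O := by simpa [O] using h0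
  set A := fderiv ℂ f 0 with hA
  let k : ℂ → E := fun ζ => f (ζ • z) - A (ζ • z)
  have hk : DifferentiableOn ℂ k O := by
    intro ζ hζ
    have h1 : DifferentiableAt ℂ f (ζ • z) := hf.differentiableAt (hV.mem_nhds hζ)
    have h2 : DifferentiableAt ℂ (fun ζ : ℂ => ζ • z) ζ := by fun_prop
    exact ((h1.comp ζ h2).sub (A.differentiableAt.comp ζ h2)).differentiableWithinAt
  have hk' : HasDerivAt k 0 0 := by
    have h2 : HasDerivAt (fun ζ : ℂ => ζ • z) z 0 := by
      simpa using (hasDerivAt_id (0 : ℂ)).smul_const z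
    have h1 : HasFDerivAt f A ((0 : ℂ) • z) := by
      rw [zero_smul]; exact (hf.differentiableAt (hV.mem_nhds h0)).hasFDerivAt
    have h3 := (h1.sub (A.hasFDerivAt (x := (0 : ℂ) • z))).comp_hasDerivAt (0 : ℂ) h2
    rw [sub_self, zero_apply] at h3
    exact h3
  have he : (fun ζ => alexR f A ζ z) = dslope k 0 := by
    funext ζ
    by_cases hζ : ζ = 0
    · subst hζ
      rw [dslope_same, hk'.deriv]
      simp [alexR]
    · rw [dslope_of_ne _ hζ, slope_def_module]
      simp [alexR, k, hf0]
  rw [he]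
  have h5 := (Complex.differentiableOn_dslope (hO.mem_nhds h0O)).2 hk
  exact (h5.contDiffOn hO).contDiffAt (hO.mem_nhds hβ)

theorem alexR_continuousAt {E : Type*} [NormedAddCommGroup E] [NormedSpace ℂ E]
    {V : Set E} (hV : IsOpen V) {f : E → E} (hf : DifferentiableOn ℂ f V)
    (h0 : (0 : E) ∈ V) (hf0 : f 0 = 0) (z : E) {β : ℂ} (hβ : β • z ∈ V) :
    ContinuousAt (fun p : ℂ × E => alexR f (fderiv ℂ f 0) p.1 p.2) (β, z) := by
  set A := fderiv ℂ f 0 with hA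
  have hs : Continuous fun p : ℂ × E => p.1 • p.2 := by fun_prop
  by_cases hb : β = 0
  · subst hb
    have h1 : HasFDerivAt f A 0 := (hf.differentiableAt (hV.mem_nhds h0)).hasFDerivAt
    have h2 := h1.isLittleO
    simp only [hf0, sub_zero] at h2
    have h3 : Tendsto (fun p : ℂ × E => p.1 • p.2) (𝓝 (0, z)) (𝓝 0) := by
      simpa using hs.tendsto ((0 : ℂ), z)
    have h4 := h2.comp_tendsto h3
    have h5 : (fun p : ℂ × E => p.1 • p.2) =O[𝓝 (0, z)] fun p => p.1 := by
      have : (fun p : ℂ × E => p.2) =O[𝓝 ((0 : ℂ), z)] fun _ => (1 : ℂ) :=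
        (continuous_snd.tendsto ((0 : ℂ), z)).isBigO_one ℂ
      simpa using (Asymptotics.isBigO_refl (fun p : ℂ × E => p.1) (𝓝 ((0 : ℂ), z))).smul this
    have h6 := (h4.trans_isBigO h5).tendsto_inv_smul_nhds_zero
    unfold ContinuousAt
    simpa [alexR, Function.comp_def] using h6
  · have h1 : ContinuousAt f (β • z) := (hf.differentiableAt (hV.mem_nhds hβ)).continuousAt
    have h2 : ContinuousAt (fun p : ℂ × E => f (p.1 • p.2)) (β, z) :=
      ContinuousAt.comp (f := fun p : ℂ × E => p.1 • p.2) h1 hs.continuousAt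
    have h3 : ContinuousAt (fun p : ℂ × E => p.1⁻¹) (β, z) := continuousAt_fst.inv₀ hb
    exact h3.smul (h2.sub (A.continuous.comp hs).continuousAt)


theorem alex_main {E : Type*} [NormedAddCommGroup E] [NormedSpace ℂ E] [FiniteDimensional ℂ E]
    (W : Set E) (hWc : IsCompact W) (hW0 : 0 ∈ interior W)
    (hstar : ∀ z ∈ W, ∀ t : ℝ, t ∈ Set.Icc (0 : ℝ) 1 → (t : ℂ) • z ∈ W)
    (f : E → E) (V : Set E) (hV : IsOpen V) (hWV : W ⊆ V)
    (hf : DifferentiableOn ℂ f V) (hfinj : Set.InjOn f V)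
    (hf0 : f 0 = 0) (hfW : f '' W ⊆ W) (hA : ∀ v, fderiv ℂ f 0 v = 0 → v = 0) :
    ∃ F : ℝ → E → E,
      ContinuousOn (fun p : ℝ × E => F p.1 p.2) (Set.Icc (0 : ℝ) 1 ×ˢ W) ∧
      (∀ z ∈ W, ContDiffOn ℝ (⊤ : ℕ∞) (fun t => F t z) (Set.Icc (0 : ℝ) 1)) ∧
      (∀ z ∈ W, F 0 z = z) ∧
      (∀ z ∈ W, F 1 z = f z) ∧
      (∀ t ∈ Set.Icc (0 : ℝ) 1,
        ∃ (V' : Set E) (g : E → E), IsOpen V' ∧ W ⊆ V' ∧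
          DifferentiableOn ℂ g V' ∧ Set.InjOn g V' ∧
          g 0 = 0 ∧ Set.EqOn g (F t) W ∧ g '' W ⊆ W) := by
  have h0W : (0 : E) ∈ W := interior_subset hW0
  have h0V := hWV h0W
  set A := fderiv ℂ f 0 with hAdef
  obtain ⟨κ, hκ⟩ := alex_path A hA
  let c : ℝ → ℂ := fun s => (s : ℂ) + (κ * (s * (1 - s)) : ℝ) * Complex.I
  have hcc : ContDiff ℝ (⊤ : ℕ∞) c := by
    have h1 : ContDiff ℝ (⊤ : ℕ∞) (fun s : ℝ => (s : ℂ)) := Complex.ofRealCLM.contDiff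
    have h2 : ContDiff ℝ (⊤ : ℕ∞) (fun s : ℝ => ((κ * (s * (1 - s)) : ℝ) : ℂ)) :=
      Complex.ofRealCLM.contDiff.comp
        (contDiff_const.mul (contDiff_id.mul (contDiff_const.sub contDiff_id)))
    exact h1.add (h2.mul contDiff_const)
  let B : ℝ → E → E := fun s z => (1 - c s) • z + c s • A z
  have hB : ∀ s z, B s z = 0 → z = 0 := fun s z h => hκ s z h
  have hc0 : c 0 = 0 := by simp [c]
  have hc1 : c 1 = 1 := by simp [c]
  have hB0 : ∀ z, B 0 z = z := fun z => by simp [B, hc0]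
  have hB1 : ∀ z, B 1 z = A z := fun z => by simp [B, hc1]
  have hBcont : Continuous fun p : ℝ × E => B p.1 p.2 := by
    have := hcc.continuous
    fun_prop
  let σ : ℝ → ℝ := Real.smoothTransition
  have hσc : ContDiff ℝ (⊤ : ℕ∞) σ := Real.smoothTransition.contDiff
  have hσ0 : ∀ x ≤ 0, σ x = 0 := fun x hx => Real.smoothTransition.zero_of_nonpos hx
  have hσ1 : ∀ x, 1 ≤ x → σ x = 1 := fun x hx => Real.smoothTransition.one_of_one_le hx
  have hσn : ∀ x, 0 ≤ σ x := Real.smoothTransition.nonneg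
  have hσl : ∀ x, σ x ≤ 1 := Real.smoothTransition.le_one
  let a : ℝ → ℝ := fun t => σ (4 * t - 1)
  let b : ℝ → ℝ := fun t => σ (4 * t - 2)
  have hac : ContDiff ℝ (⊤ : ℕ∞) a := hσc.comp (by fun_prop)
  have hbc : ContDiff ℝ (⊤ : ℕ∞) b := hσc.comp (by fun_prop)
  have hbI : ∀ t, b t ∈ Icc (0 : ℝ) 1 := fun t => ⟨hσn _, hσl _⟩
  have haI : ∀ t, a t ∈ Icc (0 : ℝ) 1 := fun t => ⟨hσn _, hσl _⟩
  let R : ℂ → E → E := alexR f A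
  have hR0 : ∀ z, R 0 z = 0 := fun z => by simp [R, alexR]
  have hRat : ∀ β ∈ Icc (0 : ℝ) 1, ∀ z ∈ W,
      ContinuousAt (fun p : ℂ × E => R p.1 p.2) ((β : ℂ), z) := fun β hβ z hz =>
    alexR_continuousAt hV hf h0V hf0 z (hWV (hstar z hz β hβ))
  -- bounds
  obtain ⟨M1, hM1⟩ : ∃ M, ∀ p ∈ Icc (0 : ℝ) 1 ×ˢ W, ‖R (p.1 : ℂ) p.2‖ ≤ M := by
    refine (isCompact_Icc.prod hWc).exists_bound_of_continuousOn ?_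
    intro p hp
    refine ContinuousAt.continuousWithinAt ?_
    exact ContinuousAt.comp (f := fun p : ℝ × E => ((p.1 : ℂ), p.2)) (hRat p.1 hp.1 p.2 hp.2)
      (by apply Continuous.continuousAt; fun_prop)
  obtain ⟨M2, hM2⟩ : ∃ M, ∀ p ∈ Icc (0 : ℝ) 1 ×ˢ W, ‖B p.1 p.2‖ ≤ M :=
    (isCompact_Icc.prod hWc).exists_bound_of_continuousOn hBcont.continuousOn
  obtain ⟨r, hr, hrW⟩ := Metric.mem_nhds_iff.1 (mem_interior_iff_mem_nhds.1 hW0)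
  have hM1n : 0 ≤ M1 := (norm_nonneg _).trans (hM1 (0, 0) ⟨by simp, h0W⟩)
  have hM2n : 0 ≤ M2 := (norm_nonneg _).trans (hM2 (0, 0) ⟨by simp, h0W⟩)
  obtain ⟨ε, hε, hε1, hεM⟩ : ∃ ε : ℝ, 0 < ε ∧ ε ≤ 1 ∧ ε * (M1 + M2) < r := by
    refine ⟨min 1 (r / (M1 + M2 + 1)), by positivity, min_le_left _ _, ?_⟩
    have h1 : min 1 (r / (M1 + M2 + 1)) ≤ r / (M1 + M2 + 1) := min_le_right _ _
    have h2 : r / (M1 + M2 + 1) * (M1 + M2 + 1) = r := by field_simp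
    have h3 : 0 < r / (M1 + M2 + 1) := by positivity
    nlinarith
  let ρ : ℝ → ℝ := fun t => 1 - (1 - ε) * (σ (4 * t) - σ (4 * t - 3))
  have hρc : ContDiff ℝ (⊤ : ℕ∞) ρ := by
    have h1 : ContDiff ℝ (⊤ : ℕ∞) fun t : ℝ => σ (4 * t) := hσc.comp (by fun_prop)
    have h2 : ContDiff ℝ (⊤ : ℕ∞) fun t : ℝ => σ (4 * t - 3) := hσc.comp (by fun_prop)
    exact contDiff_const.sub (contDiff_const.mul (h1.sub h2))
  have hρI : ∀ t, ε ≤ ρ t ∧ ρ t ≤ 1 := by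
    intro t
    have h1 : 0 ≤ σ (4 * t) - σ (4 * t - 3) ∧ σ (4 * t) - σ (4 * t - 3) ≤ 1 := by
      rcases le_total t (1 / 4) with ht | ht
      · rw [hσ0 (4 * t - 3) (by linarith), sub_zero]; exact ⟨hσn _, hσl _⟩
      · rw [hσ1 (4 * t) (by linarith)]
        exact ⟨by linarith [hσl (4 * t - 3)], by linarith [hσn (4 * t - 3)]⟩
    constructor
    · change ε ≤ 1 - (1 - ε) * (σ (4 * t) - σ (4 * t - 3))
      nlinarith
    · change 1 - (1 - ε) * (σ (4 * t) - σ (4 * t - 3)) ≤ 1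
      nlinarith
  have hρ01 : ∀ t, ρ t ∈ Icc (0 : ℝ) 1 := fun t => ⟨hε.le.trans (hρI t).1, (hρI t).2⟩
  have hρ0 : ∀ t, (ρ t : ℂ) ≠ 0 := fun t =>
    Complex.ofReal_ne_zero.2 (hε.trans_le (hρI t).1).ne'
  have hρε : ∀ t, 1 / 4 ≤ t → t ≤ 3 / 4 → ρ t = ε := by
    intro t h1 h2
    simp only [ρ]
    rw [hσ0 (4 * t - 3) (by linarith), hσ1 (4 * t) (by linarith)]
    ring
  let F : ℝ → E → E := fun t z => (ρ t : ℂ) • (R (b t : ℂ) z + B (a t) z)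
  have hF1 : ∀ t, b t = 0 → ∀ z, F t z = (ρ t : ℂ) • B (a t) z := by
    intro t ht z
    simp [F, ht, hR0]
  have hF2 : ∀ t, a t = 1 → b t ≠ 0 → ∀ z,
      F t z = (ρ t : ℂ) • (b t : ℂ)⁻¹ • f ((b t : ℂ) • z) := by
    intro t h1 h2 z
    have h3 : (b t : ℂ) ≠ 0 := Complex.ofReal_ne_zero.2 h2
    simp only [F, h1, hB1, R, alexR, map_smul, smul_sub, inv_smul_smul₀ h3, sub_add_cancel]
  have ha1 : ∀ t, b t ≠ 0 → a t = 1 := by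
    intro t ht
    apply hσ1
    by_contra! h
    exact ht (hσ0 _ (by linarith))
  have hFlow : ∀ t ≤ 1 / 4, ∀ z, F t z = (ρ t : ℂ) • z := by
    intro t ht z
    rw [hF1 t (hσ0 _ (by linarith)), show a t = 0 from hσ0 _ (by linarith), hB0]
  have hFhigh : ∀ t, 3 / 4 ≤ t → ∀ z, F t z = (ρ t : ℂ) • f z := by
    intro t ht z
    have hb : b t = 1 := hσ1 _ (by linarith)
    rw [hF2 t (hσ1 _ (by linarith)) (by rw [hb]; exact one_ne_zero), hb]
    simp
  refine ⟨F, ?_, ?_, ?_, ?_, ?_⟩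
  · intro p hp
    refine ContinuousAt.continuousWithinAt ?_
    have h1 : ContinuousAt (fun p : ℝ × E => R (b p.1 : ℂ) p.2) p :=
      ContinuousAt.comp (f := fun p : ℝ × E => ((b p.1 : ℂ), p.2)) (hRat _ (hbI p.1) p.2 hp.2)
        (by
          have := hbc.continuous
          apply Continuous.continuousAt; fun_prop)
    have h2 : Continuous (fun p : ℝ × E => B (a p.1) p.2) :=
      hBcont.comp (f := fun p : ℝ × E => (a p.1, p.2)) (by
          have := hac.continuous
          fun_prop)
    have h3 : Continuous (fun p : ℝ × E => (ρ p.1 : ℂ)) := by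
      have := hρc.continuous
      fun_prop
    exact h3.continuousAt.smul (h1.add h2.continuousAt)
  · intro z hz
    refine ContDiff.contDiffOn ?_
    have ho : ContDiff ℝ (⊤ : ℕ∞) (fun s : ℝ => (s : ℂ)) := Complex.ofRealCLM.contDiff
    have h1 : ContDiff ℝ (⊤ : ℕ∞) (fun t : ℝ => R (b t : ℂ) z) := by
      rw [contDiff_iff_contDiffAt]
      intro t
      have h2 : ContDiffAt ℂ (⊤ : ℕ∞) (fun ζ => R ζ z) (b t : ℂ) :=
        alexR_contDiffAt hV hf h0V hf0 z (hWV (hstar z hz _ (hbI t)))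
      exact ContDiffAt.comp (f := fun t : ℝ => (b t : ℂ)) t (h2.restrict_scalars ℝ)
        (ho.comp hbc).contDiffAt
    have h2 : ContDiff ℝ (⊤ : ℕ∞) (fun t : ℝ => B (a t) z) := by
      have h3 : ContDiff ℝ (⊤ : ℕ∞) (fun t : ℝ => c (a t)) := hcc.comp hac
      exact ((contDiff_const.sub h3).smul contDiff_const).add (h3.smul contDiff_const)
    exact (ho.comp hρc).smul (h1.add h2)
  · intro z _
    rw [hFlow 0 (by norm_num)]
    have : ρ 0 = 1 := by
      simp only [ρ]
      rw [hσ0 (4 * 0) (by norm_num), hσ0 (4 * 0 - 3) (by norm_num)]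
      ring
    simp [this]
  · intro z _
    rw [hFhigh 1 (by norm_num)]
    have : ρ 1 = 1 := by
      simp only [ρ]
      rw [hσ1 (4 * 1) (by norm_num), hσ1 (4 * 1 - 3) (by norm_num)]
      ring
    simp [this]
  · intro t _
    have himg : F t '' W ⊆ W := by
      rintro _ ⟨z, hz, rfl⟩
      rcases le_total t (1 / 4) with h1 | h1
      · rw [hFlow t h1]; exact hstar z hz _ (hρ01 t)
      rcases le_total t (3 / 4) with h2 | h2
      · apply hrW
        rw [mem_ball_zero_iff]
        simp only [F]
        rw [hρε t h1 h2, norm_smul, Complex.norm_real, Real.norm_of_nonneg hε.le]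
        refine lt_of_le_of_lt ?_ hεM
        refine mul_le_mul_of_nonneg_left ((norm_add_le _ _).trans (add_le_add ?_ ?_)) hε.le
        · exact hM1 (b t, z) ⟨hbI t, hz⟩
        · exact hM2 (a t, z) ⟨haI t, hz⟩
      · rw [hFhigh t h2]; exact hstar _ (hfW ⟨z, hz, rfl⟩) _ (hρ01 t)
    have hFz : F t 0 = 0 := by simp [F, B, R, alexR, hf0]
    by_cases hb : b t = 0
    · have he : F t = fun z => (ρ t : ℂ) • B (a t) z := funext (hF1 t hb)
      refine ⟨univ, F t, isOpen_univ, subset_univ _, ?_, ?_, hFz, fun _ _ => rfl, himg⟩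
      · rw [he]
        apply Differentiable.differentiableOn
        simp only [B]
        fun_prop
      · intro x _ y _ hxy
        rw [he] at hxy
        have h1 := smul_right_injective E (hρ0 t) hxy
        rw [← sub_eq_zero]
        apply hB (a t)
        rw [← sub_eq_zero] at h1
        rw [← h1]
        simp only [B, map_sub]
        module
    · have he : F t = fun z => (ρ t : ℂ) • (b t : ℂ)⁻¹ • f ((b t : ℂ) • z) :=
        funext (hF2 t (ha1 t hb) hb)
      have hb' : (b t : ℂ) ≠ 0 := Complex.ofReal_ne_zero.2 hb
      refine ⟨(fun z => (b t : ℂ) • z) ⁻¹' V, F t, hV.preimage (by fun_prop),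
        fun z hz => hWV (hstar z hz _ (hbI t)), ?_, ?_, hFz, fun _ _ => rfl, himg⟩
      · rw [he]
        intro z hz
        have h1 : DifferentiableAt ℂ f ((b t : ℂ) • z) := hf.differentiableAt (hV.mem_nhds hz)
        have h2 : DifferentiableAt ℂ (fun z : E => f ((b t : ℂ) • z)) z :=
          h1.comp z (by fun_prop)
        exact ((h2.const_smul _).const_smul _).differentiableWithinAt
      · intro x hx y hy hxy
        rw [he] at hxy
        have h1 := smul_right_injective E (inv_ne_zero hb') (smul_right_injective E (hρ0 t) hxy)
        exact smul_right_injective E hb' (hfinj hx hy h1)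


end Helpers

/-- Alexander's trick for holomorphic embeddings: let `W ⊆ ℂⁿ` be compact, starshaped with
respect to the origin (which lies in its interior), and let `f` be a holomorphic embedding
of `W` (holomorphic and injective on an open neighborhood `V ⊇ W`) with `f 0 = 0` and
`f (W) ⊆ W`.  Then `f` can be joined to the inclusion of `W` by a family of holomorphic
embeddings of `W` into `W` fixing the origin. -/
theorem stmt8 (n : ℕ) (hn : 1 ≤ n) (W : Set (EuclideanSpace ℂ (Fin n)))
    (hWc : IsCompact W) (hW0 : 0 ∈ interior W)
    (hstar : ∀ z ∈ W, ∀ t : ℝ, t ∈ Set.Icc (0 : ℝ) 1 → t • z ∈ W)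
    (f : EuclideanSpace ℂ (Fin n) → EuclideanSpace ℂ (Fin n))
    (V : Set (EuclideanSpace ℂ (Fin n))) (hV : IsOpen V) (hWV : W ⊆ V)
    (hf : DifferentiableOn ℂ f V) (hfinj : Set.InjOn f V)
    (hf0 : f 0 = 0) (hfW : f '' W ⊆ W) :
    ∃ F : ℝ → EuclideanSpace ℂ (Fin n) → EuclideanSpace ℂ (Fin n),
      ContinuousOn (fun p : ℝ × EuclideanSpace ℂ (Fin n) => F p.1 p.2)
        (Set.Icc (0 : ℝ) 1 ×ˢ W) ∧
      (∀ z ∈ W, ContDiffOn ℝ (⊤ : ℕ∞) (fun t => F t z) (Set.Icc (0 : ℝ) 1)) ∧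
      (∀ z ∈ W, F 0 z = z) ∧
      (∀ z ∈ W, F 1 z = f z) ∧
      (∀ t ∈ Set.Icc (0 : ℝ) 1,
        ∃ (V' : Set (EuclideanSpace ℂ (Fin n)))
          (g : EuclideanSpace ℂ (Fin n) → EuclideanSpace ℂ (Fin n)),
          IsOpen V' ∧ W ⊆ V' ∧
          DifferentiableOn ℂ g V' ∧ Set.InjOn g V' ∧
          g 0 = 0 ∧ Set.EqOn g (F t) W ∧ g '' W ⊆ W) := by
  have h0 : (0 : EuclideanSpace ℂ (Fin n)) ∈ V := hWV (interior_subset hW0)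
  exact alex_main W hWc hW0 (fun z hz t ht => by simpa using hstar z hz t ht) f V hV hWV hf hfinj
    hf0 hfW fun v hv => osg_main n (EuclideanSpace ℂ (Fin n)) (EuclideanSpace ℂ (Fin n)) V f
      finrank_euclideanSpace_fin finrank_euclideanSpace_fin hV hf hfinj 0 h0 v hv

end
end
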